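/- Let k be a field of characteristic not 2 or 3 and let (A,−) be an (m₁,m₂)-product algebra over k. Then (A,−) is a structurable division algebra if and only if its Albert form Q is anisotropic and the centre Z(A) is a field. -/

import Mathlib

open scoped TensorProduct

noncomputable section

universe u

/-- A unital, not necessarily associative, algebra with involution over a commutative ring. -/
structure AlgebraWithInvolution (R : Type u) [CommRing R] : Type (u + 1) where
  carrier : Type u
  [isNonAssocRing : NonAssocRing carrier]
  [isModule : Module R carrier]
  [isSMulCommClass : SMulCommClass R carrier carrier]
  [isScalarTower : IsScalarTower R carrier carrier]
  invol : carrier →ₗ[R] carrier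
  invol_one : invol 1 = 1
  invol_mul : ∀ x y : carrier, invol (x * y) = invol y * invol x
  invol_invol : ∀ x : carrier, invol (invol x) = x

namespace AlgebraWithInvolution

attribute [instance] isNonAssocRing isModule isSMulCommClass isScalarTower

instance {R : Type u} [CommRing R] : CoeSort (AlgebraWithInvolution R) (Type u) :=
  ⟨carrier⟩

variable {R : Type u} [CommRing R]

/-- The operator `V_{x,y} z = (x ȳ) z + (z ȳ) x − (z x̄) y` of a (candidate) structurable
algebra. -/
def Vop (A : AlgebraWithInvolution R) (x y z : A) : A :=
  (x * A.invol y) * z + (z * A.invol y) * x - (z * A.invol x) * y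

/-- `(A,−)` is a structurable algebra:
`[V_{x,y}, V_{z,w}] = V_{V_{x,y} z, w} − V_{z, V_{y,x} w}`. -/
def IsStructurable (A : AlgebraWithInvolution R) : Prop :=
  ∀ x y z w v : A,
    A.Vop x y (A.Vop z w v) - A.Vop z w (A.Vop x y v) =
      A.Vop (A.Vop x y z) w v - A.Vop z (A.Vop y x w) v

/-- An element `x` is conjugate-invertible if `V_{x,y} = id` for some `y`. -/
def ConjInvertible (A : AlgebraWithInvolution R) (x : A) : Prop :=
  ∃ y : A, ∀ z : A, A.Vop x y z = z

/-- A structurable division algebra: every nonzero element is conjugate-invertible. -/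
def IsStructurableDivisionAlgebra (A : AlgebraWithInvolution R) : Prop :=
  ∀ x : A, x ≠ 0 → A.ConjInvertible x

/-- The submodule of skew elements of an algebra with involution. -/
def skew (A : AlgebraWithInvolution R) : Submodule R A.carrier where
  carrier := {a | A.invol a = -a}
  add_mem' := by
    intro a b ha hb
    simp only [Set.mem_setOf_eq, map_add] at *
    rw [ha, hb, neg_add]
  zero_mem' := by simp
  smul_mem' := by
    intro c a ha
    simp only [Set.mem_setOf_eq, map_smul] at *
    rw [ha, smul_neg]

/-- `ψ(x,y) = x ȳ − y x̄`. -/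
def psi (A : AlgebraWithInvolution R) (x y : A) : A :=
  x * A.invol y - y * A.invol x

/-- Isomorphisms of algebras with involution. -/
structure Iso (A B : AlgebraWithInvolution R) where
  toLinearEquiv : A.carrier ≃ₗ[R] B.carrier
  map_mul : ∀ x y : A, toLinearEquiv (x * y) = toLinearEquiv x * toLinearEquiv y
  map_one : toLinearEquiv 1 = 1
  map_invol : ∀ x : A, toLinearEquiv (A.invol x) = B.invol (toLinearEquiv x)

/-- Isotopies of (structurable) algebras with involution: pairs `(α, α̂)` of linear
bijections with `α ∘ V_{x,y} ∘ α⁻¹ = V_{α x, α̂ y}`. -/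
structure Isotopy (A B : AlgebraWithInvolution R) where
  toLinearEquiv : A.carrier ≃ₗ[R] B.carrier
  hat : A.carrier ≃ₗ[R] B.carrier
  map_Vop : ∀ x y z : A,
    toLinearEquiv (A.Vop x y z) = B.Vop (toLinearEquiv x) (hat y) (toLinearEquiv z)

/-- Two algebras with involution are isotopic if there is an isotopy between them. -/
def IsIsotopic (A B : AlgebraWithInvolution R) : Prop :=
  Nonempty (A.Isotopy B)

/-- The tensor product of two algebras with involution. -/
def tensor (A B : AlgebraWithInvolution R) : AlgebraWithInvolution R where
  carrier := A.carrier ⊗[R] B.carrier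
  invol := TensorProduct.map A.invol B.invol
  invol_one := by
    simp [Algebra.TensorProduct.one_def, A.invol_one, B.invol_one]
  invol_mul := by
    intro x y
    induction x with
    | zero => simp
    | tmul a b =>
      induction y with
      | zero => simp
      | tmul c d =>
        simp [Algebra.TensorProduct.tmul_mul_tmul, A.invol_mul, B.invol_mul]
      | add u v hu hv =>
        simp only [mul_add, map_add, hu, hv, add_mul]
    | add u v hu hv =>
      simp only [add_mul, map_add, hu, hv, mul_add]
  invol_invol := by
    intro x
    induction x with
    | zero => simp
    | tmul a b => simp [A.invol_invol, B.invol_invol]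
    | add u v hu hv => simp [hu, hv]

/-- Base change of an algebra with involution along `R → S`. -/
def baseChange (A : AlgebraWithInvolution R) (S : Type u) [CommRing S] [Algebra R S] :
    AlgebraWithInvolution S where
  carrier := S ⊗[R] A.carrier
  invol := LinearMap.baseChange S A.invol
  invol_one := by
    simp [Algebra.TensorProduct.one_def, A.invol_one]
  invol_mul := by
    intro x y
    induction x with
    | zero => simp
    | tmul s a =>
      induction y with
      | zero => simp
      | tmul t b =>
        simp only [Algebra.TensorProduct.tmul_mul_tmul, LinearMap.baseChange_tmul,
          A.invol_mul, mul_comm s t]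
      | add u v hu hv =>
        simp only [mul_add, map_add, hu, hv, add_mul]
    | add u v hu hv =>
      simp only [add_mul, map_add, hu, hv, mul_add]
  invol_invol := by
    intro x
    induction x with
    | zero => simp
    | tmul s a => simp [A.invol_invol]
    | add u v hu hv => simp [hu, hv]

end AlgebraWithInvolution

/-- A composition algebra over a field `F`: a unital (possibly non-associative) algebra with a
nondegenerate multiplicative quadratic form, together with its standard involution
`x̄ = b(x,1)·1 − x` (where `b` is the polar form of the norm). -/
structure CompositionAlgebra (F : Type u) [Field F] : Type (u + 1) where
  carrier : Type u
  [isNonAssocRing : NonAssocRing carrier]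
  [isModule : Module F carrier]
  [isSMulCommClass : SMulCommClass F carrier carrier]
  [isScalarTower : IsScalarTower F carrier carrier]
  [isFinite : FiniteDimensional F carrier]
  norm : QuadraticForm F carrier
  norm_one : norm 1 = 1
  norm_mul : ∀ x y : carrier, norm (x * y) = norm x * norm y
  nondegenerate : ∀ x : carrier, (∀ y : carrier, norm (x + y) - norm x - norm y = 0) → x = 0
  conj : carrier →ₗ[F] carrier
  conj_def : ∀ x : carrier, conj x = (norm (x + 1) - norm x - norm 1) • (1 : carrier) - x
  conj_one : conj 1 = 1
  conj_mul : ∀ x y : carrier, conj (x * y) = conj y * conj x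
  conj_conj : ∀ x : carrier, conj (conj x) = x

namespace CompositionAlgebra

attribute [instance] isNonAssocRing isModule isSMulCommClass isScalarTower isFinite

variable {F : Type u} [Field F]

/-- A composition algebra, viewed as an algebra with its standard involution. -/
def toAWI (C : CompositionAlgebra F) : AlgebraWithInvolution F where
  carrier := C.carrier
  invol := C.conj
  invol_one := C.conj_one
  invol_mul := C.conj_mul
  invol_invol := C.conj_conj

end CompositionAlgebra

/-- A splitting datum witnessing that `(A,−)` is an `(m₁, m₂)`-product algebra: a field
extension `K/k` over which `(A,−)` becomes isomorphic, as an algebra with involution, to the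
tensor product of two composition algebras (with their standard involutions) of dimensions
`m₁` and `m₂`. -/
structure ProductAlgebraSplitting {k : Type u} [Field k]
    (A : AlgebraWithInvolution k) (m₁ m₂ : ℕ) : Type (u + 1) where
  K : Type u
  [fieldK : Field K]
  [algK : Algebra k K]
  C₁ : CompositionAlgebra K
  C₂ : CompositionAlgebra K
  finrank₁ : Module.finrank K C₁.carrier = m₁
  finrank₂ : Module.finrank K C₂.carrier = m₂
  iso : (A.baseChange K).Iso (C₁.toAWI.tensor C₂.toAWI)

attribute [instance] ProductAlgebraSplitting.fieldK ProductAlgebraSplitting.algK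

/-- `(A,−)` is an `(m₁, m₂)`-product algebra. -/
def IsProductAlgebra {k : Type u} [Field k] (A : AlgebraWithInvolution k) (m₁ m₂ : ℕ) : Prop :=
  Nonempty (ProductAlgebraSplitting A m₁ m₂)

/-- An Albert form of an `(m₁,m₂)`-product algebra `(A,−)`: a quadratic form `Q` on the space
of skew elements, together with the `♮`-map, satisfying `L_s ∘ L_{s♮} = −Q(s)·id` and such that
`Q(s) ≠ 0` iff left multiplication by `s` is invertible. -/
structure AlbertForm {k : Type u} [Field k] (A : AlgebraWithInvolution k) where
  Q : QuadraticForm k A.skew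
  natMap : A.skew →ₗ[k] A.skew
  mul_natMap : ∀ (s : A.skew) (a : A.carrier),
    (s : A.carrier) * ((natMap s : A.carrier) * a) = -(Q s) • a
  nonzero_iff : ∀ s : A.skew,
    Q s ≠ 0 ↔ Function.Bijective fun a : A.carrier => (s : A.carrier) * a

end

section

open Polynomial Module

theorem Polynomial.exists_irreducible_dvd_odd_natDegree {k : Type*} [Field k] (h : k[X]) :
    Odd h.natDegree → ∃ p : k[X], Irreducible p ∧ p ∣ h ∧ Odd p.natDegree := by
  induction h using WfDvdMonoid.induction_on_irreducible with
  | zero => simp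
  | unit u hu => simp [natDegree_eq_zero_of_isUnit hu]
  | mul a i ha hi ih =>
    intro hodd
    rw [natDegree_mul hi.ne_zero ha, Nat.odd_add] at hodd
    by_cases h' : Odd i.natDegree
    · exact ⟨i, hi, dvd_mul_right _ _, h'⟩
    · have : Odd a.natDegree := by
        rw [← Nat.not_even_iff_odd]; exact fun h2 => h' (hodd.2 h2)
      obtain ⟨p, hp, hpa, hpo⟩ := ih this
      exact ⟨p, hp, hpa.mul_left _, hpo⟩

/-- The polynomial form of Springer's theorem: an anisotropic form has no nontrivial zero modulo
an irreducible polynomial of odd degree. -/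
theorem springer_polynomial {ι k : Type*} [Fintype ι] [Field k] (G : ι → ι → k)
    (hG : ∀ v : ι → k, ∑ i, ∑ j, G i j * v i * v j = 0 → v = 0) (n : ℕ) :
    ∀ p : k[X], Irreducible p → p.natDegree = n → Odd n → ∀ v : ι → k[X],
      p ∣ ∑ i, ∑ j, C (G i j) * v i * v j → ∀ i, p ∣ v i := by
  induction n using Nat.strong_induction_on with
  | _ n ih =>
  intro p hp hpn hn v hv
  by_contra! hcon
  obtain ⟨i₀, hi₀⟩ := hcon
  classical
  set v' : ι → k[X] := fun i => v i % p with hv'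
  have hvm : ∀ i, p ∣ v i - v' i := fun i => by
    rw [hv']; exact ⟨v i / p, by simp only; linear_combination - (EuclideanDomain.div_add_mod (v i) p)⟩
  have hqv' : p ∣ ∑ i, ∑ j, C (G i j) * v' i * v' j := by
    have : p ∣ ∑ i, ∑ j, C (G i j) * v i * v j - ∑ i, ∑ j, C (G i j) * v' i * v' j := by
      rw [← Finset.sum_sub_distrib]
      refine Finset.dvd_sum fun i _ => ?_
      rw [← Finset.sum_sub_distrib]
      refine Finset.dvd_sum fun j _ => ?_
      obtain ⟨c, hc⟩ := hvm i
      obtain ⟨d, hd⟩ := hvm j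
      exact ⟨C (G i j) * (c * v j + v' i * d), by
        linear_combination C (G i j) * v j * hc + C (G i j) * v' i * hd⟩
    exact (dvd_sub_right hv).1 this
  have hv'deg : ∀ i, v' i ≠ 0 → (v' i).natDegree < n := fun i hi => by
    rw [← hpn]
    refine natDegree_lt_natDegree hi ?_
    exact EuclideanDomain.mod_lt (v i) hp.ne_zero
  have hi₀' : v' i₀ ≠ 0 := fun h => hi₀ (by simpa [h] using hvm i₀)
  obtain ⟨w, hw, hw1⟩ := Finset.extract_gcd v' (s := Finset.univ) ⟨i₀, Finset.mem_univ _⟩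
  set g := Finset.univ.gcd v' with hg
  have hg0 : g ≠ 0 := fun h => hi₀' (by rw [hw i₀ (Finset.mem_univ _), h, zero_mul])
  have hpg : ¬ p ∣ g := fun h => by
    have h1 : p ∣ v' i₀ := h.trans ⟨w i₀, hw i₀ (Finset.mem_univ _)⟩
    have h2 := natDegree_le_of_dvd h1 hi₀'
    have h3 := hv'deg i₀ hi₀'
    omega
  have hqw : p ∣ ∑ i, ∑ j, C (G i j) * w i * w j := by
    have h1 : ∑ i, ∑ j, C (G i j) * v' i * v' j = g * (g * ∑ i, ∑ j, C (G i j) * w i * w j) := by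
      simp only [Finset.mul_sum]
      refine Finset.sum_congr rfl fun i _ => Finset.sum_congr rfl fun j _ => ?_
      rw [hw i (Finset.mem_univ _), hw j (Finset.mem_univ _)]; ring
    rw [h1] at hqv'
    exact ((hp.prime.dvd_or_dvd hqv').resolve_left hpg |> hp.prime.dvd_or_dvd).resolve_left hpg
  set e := Finset.univ.sup fun i => (w i).natDegree with he
  have hle : ∀ i, (w i).natDegree ≤ e := fun i =>
    Finset.le_sup (f := fun i => (w i).natDegree) (Finset.mem_univ i)
  have hwi₀ : w i₀ ≠ 0 := fun h => hi₀' (by rw [hw i₀ (Finset.mem_univ _), h, mul_zero])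
  obtain ⟨i₁, hi₁⟩ : ∃ i₁, w i₁ ≠ 0 ∧ (w i₁).natDegree = e := by
    obtain ⟨i₁, -, hi₁⟩ := Finset.exists_mem_eq_sup Finset.univ ⟨i₀, Finset.mem_univ _⟩
      (fun i => (w i).natDegree)
    by_cases h : w i₁ = 0
    · refine ⟨i₀, hwi₀, ?_⟩
      have h1 : e = 0 := by rw [he, hi₁, h, natDegree_zero]
      have := hle i₀
      omega
    · exact ⟨i₁, h, hi₁.symm⟩
  have hen : e < n := by
    rw [← hi₁.2]
    have h1 : v' i₁ ≠ 0 := by rw [hw i₁ (Finset.mem_univ _)]; exact mul_ne_zero hg0 hi₁.1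
    have h2 := hv'deg i₁ h1
    have h3 : (w i₁).natDegree ≤ (v' i₁).natDegree :=
      natDegree_le_of_dvd ⟨g, by rw [hw i₁ (Finset.mem_univ _), mul_comm]⟩ h1
    omega
  have hcoeff : (∑ i, ∑ j, C (G i j) * w i * w j).coeff (e + e) ≠ 0 := by
    have h1 : (∑ i, ∑ j, C (G i j) * w i * w j).coeff (e + e)
        = ∑ i, ∑ j, G i j * (w i).coeff e * (w j).coeff e := by
      simp only [finsetSum_coeff]
      refine Finset.sum_congr rfl fun i _ => Finset.sum_congr rfl fun j _ => ?_
      rw [mul_assoc, coeff_C_mul, coeff_mul_add_eq_of_natDegree_le (hle i) (hle j), mul_assoc]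
    rw [h1]
    intro h2
    have h3 := congrFun (hG _ h2) i₁
    simp only [Pi.zero_apply] at h3
    rw [← hi₁.2] at h3
    exact hi₁.1 (leadingCoeff_eq_zero.1 h3)
  have hne : ∑ i, ∑ j, C (G i j) * w i * w j ≠ 0 := fun h => hcoeff (by rw [h, coeff_zero])
  have hdeg : (∑ i, ∑ j, C (G i j) * w i * w j).natDegree = e + e := by
    refine le_antisymm ?_ (le_natDegree_of_ne_zero hcoeff)
    refine natDegree_sum_le_of_forall_le _ _ fun i _ => natDegree_sum_le_of_forall_le _ _ fun j _ => ?_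
    refine natDegree_mul_le.trans (Nat.add_le_add ?_ (hle j))
    exact (natDegree_C_mul_le _ _).trans (hle i)
  obtain ⟨h, hh⟩ := hqw
  have hh0 : h ≠ 0 := fun h0 => hne (by rw [hh, h0, mul_zero])
  have hhdeg : e + e = n + h.natDegree := by
    rw [← hdeg, hh, natDegree_mul hp.ne_zero hh0, hpn]
  have hhodd : Odd h.natDegree := by
    have h1 : Even (n + h.natDegree) := ⟨e, hhdeg.symm⟩
    rcases hn with ⟨a, ha⟩
    rcases h1 with ⟨b, hb⟩
    exact ⟨b - a - 1, by omega⟩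
  obtain ⟨p', hp', hp'h, hp'o⟩ := Polynomial.exists_irreducible_dvd_odd_natDegree h hhodd
  have hp'n : p'.natDegree < n := by
    have := natDegree_le_of_dvd hp'h hh0
    omega
  have hall := ih _ hp'n p' hp' rfl hp'o w (by rw [hh]; exact hp'h.mul_left _)
  have h1 : p' ∣ Finset.univ.gcd w := Finset.dvd_gcd fun i _ => hall i
  rw [hw1] at h1
  exact hp'.not_isUnit (isUnit_of_dvd_one h1)

/-- Springer's theorem: an anisotropic form remains anisotropic over an odd degree extension. -/
theorem springer_odd_extension {ι k K : Type*} [Fintype ι] [Field k] [Field K] [Algebra k K]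
    [FiniteDimensional k K] (hodd : Odd (Module.finrank k K)) (G : ι → ι → k)
    (hG : ∀ v : ι → k, ∑ i, ∑ j, G i j * v i * v j = 0 → v = 0) (v : ι → K)
    (hv : ∑ i, ∑ j, algebraMap k K (G i j) * v i * v j = 0) : v = 0 := by
  refine IntermediateField.induction_on_adjoin (F := k) (E := K) (fun F => ∀ v : ι → K,
    (∀ i, v i ∈ F) → ∑ i, ∑ j, algebraMap k K (G i j) * v i * v j = 0 → v = 0) ?_ ?_ ⊤ v
    (fun _ => IntermediateField.mem_top) hv
  · intro v hvF hv
    choose w hw using fun i => IntermediateField.mem_bot.1 (hvF i)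
    have h0 : w = 0 := by
      refine hG w ?_
      apply (algebraMap k K).injective
      rw [map_zero, ← hv]
      simp [hw]
    funext i
    simp [← hw, h0]
  · intro F x hF v hvF hv
    have hx : IsIntegral F x := IsIntegral.of_finite F x
    have hodd' : Odd (minpoly F x).natDegree := by
      rw [← IntermediateField.adjoin.finrank hx]
      have h1 := Module.finrank_mul_finrank k F K
      have h2 := Module.finrank_mul_finrank F (IntermediateField.adjoin F {x}) K
      rw [← h1, ← h2] at hodd
      exact (Nat.odd_mul.1 (Nat.odd_mul.1 hodd).2).1
    have hex : ∀ i, ∃ f : F[X], aeval x f = v i := fun i => by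
      have h1 : v i ∈ IntermediateField.adjoin F {x} := hvF i
      rw [← IntermediateField.mem_toSubalgebra,
        IntermediateField.adjoin_simple_toSubalgebra_of_isAlgebraic hx.isAlgebraic] at h1
      exact (AlgHom.mem_range _).1 ((Algebra.adjoin_singleton_eq_range_aeval F x) ▸ h1)
    choose f hf using hex
    have h1 := springer_polynomial (fun i j => algebraMap k F (G i j)) (fun w hw => by
      have h2 := hF (fun i => (w i : K)) (fun i => (w i).2) (by
        have := congrArg (algebraMap F K) hw
        simpa [← IsScalarTower.algebraMap_apply] using this)
      funext i
      exact Subtype.ext (congrFun h2 i)) _ (minpoly F x) (minpoly.irreducible hx) rfl hodd' f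
      (minpoly.dvd F x (by
        rw [← hv]
        simp [hf, ← IsScalarTower.algebraMap_apply]))
    funext i
    obtain ⟨c, hc⟩ := h1 i
    rw [← hf, hc, map_mul, minpoly.aeval, zero_mul, Pi.zero_apply]

theorem exists_intermediateField_odd_finrank {k L : Type*} [Field k] [Field L] [Algebra k L]
    [FiniteDimensional k L] [Normal k L] (h2 : (2 : k) ≠ 0) :
    ∃ K : IntermediateField k L, Odd (Module.finrank k K) ∧ ∃ n, Module.finrank K L = 2 ^ n := by
  obtain ⟨P⟩ : Nonempty (Sylow 2 (L ≃ₐ[k] L)) := inferInstance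
  have : Fact (Nat.Prime 2) := ⟨Nat.prime_two⟩
  refine ⟨IntermediateField.fixedField (P : Subgroup (L ≃ₐ[k] L)), ?_, ?_⟩
  · have h1 := Module.finrank_mul_finrank k
      (IntermediateField.fixedField (P : Subgroup (L ≃ₐ[k] L))) L
    rw [IntermediateField.finrank_fixedField_eq_card, ← Field.finSepDegree_mul_finInsepDegree k L]
      at h1
    have h3 : Field.finSepDegree k L = Nat.card (L ≃ₐ[k] L) :=
      Nat.card_congr (Normal.algHomEquivAut k (AlgebraicClosure L) L)
    rw [h3, ← Subgroup.card_mul_index (P : Subgroup (L ≃ₐ[k] L)), mul_comm, mul_assoc] at h1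
    have h4 := Nat.eq_of_mul_eq_mul_left Nat.card_pos h1
    rw [h4, Nat.odd_mul]
    constructor
    · rw [← Nat.not_even_iff_odd, even_iff_two_dvd]
      exact P.not_dvd_index
    · obtain ⟨q, hq⟩ := ExpChar.exists k
      obtain ⟨n, hn⟩ := finInsepDegree_eq_pow k L q
      rw [hn]
      refine Odd.pow ?_
      cases hq with
      | zero => exact odd_one
      | prime hq =>
        refine hq.odd_of_ne_two fun h5 => h2 ?_
        subst h5
        exact_mod_cast CharP.cast_eq_zero k 2
  · rw [IntermediateField.finrank_fixedField_eq_card]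
    exact IsPGroup.iff_card.1 P.isPGroup'

theorem Polynomial.nextCoeff_eq_zero_of_dvd_comp_neg_X {K : Type*} [Field K] (h2 : (2 : K) ≠ 0)
    {p : K[X]} (hp : p.natDegree ≠ 0) (h : p ∣ p.comp (-X)) : p.nextCoeff = 0 := by
  obtain ⟨c, hc⟩ := h
  have hp0 : p ≠ 0 := fun h => hp (by rw [h, natDegree_zero])
  have hc0 : c ≠ 0 := fun h => by
    rw [h, mul_zero, comp_neg_X_eq_zero_iff] at hc
    exact hp0 hc
  have hdeg : c.natDegree = 0 := by
    have := congrArg natDegree hc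
    rw [natDegree_mul hp0 hc0, natDegree_comp, natDegree_neg, natDegree_X] at this
    omega
  rw [eq_C_of_natDegree_eq_zero hdeg] at hc
  have hco : ∀ n, (p.comp (-X)).coeff n = (-1) ^ n * p.coeff n := fun n => by
    have : (-X : K[X]) = C (-1) * X := by simp
    rw [this, comp_C_mul_X_coeff, mul_comm]
  have hn := congrArg (fun f => coeff f p.natDegree) hc
  have hn1 := congrArg (fun f => coeff f (p.natDegree - 1)) hc
  simp only [hco, coeff_mul_C] at hn hn1
  rw [nextCoeff_of_natDegree_pos (Nat.pos_of_ne_zero hp)]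
  obtain ⟨d, hd⟩ := Nat.exists_eq_succ_of_ne_zero hp
  have hl : p.coeff p.natDegree ≠ 0 := leadingCoeff_ne_zero.2 hp0
  have hcv : c.coeff 0 = (-1) ^ p.natDegree := by
    apply mul_left_cancel₀ hl
    rw [← hn, mul_comm]
  rw [hcv, hd, Nat.succ_sub_one, pow_succ] at hn1
  rw [hd, Nat.succ_sub_one]
  have h3 : 2 * ((-1) ^ d * p.coeff d) = 0 := by linear_combination hn1
  have h4 : (-1 : K) ^ d ≠ 0 := pow_ne_zero _ (by simp)
  simpa [h2, h4] using h3

/-- The eigenvalues of a matrix which is skew for an anisotropic diagonal form have trace zero. -/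
theorem trace_eq_zero_of_isRoot_charpoly {ι K L : Type*} [Fintype ι] [DecidableEq ι] [Field K]
    [Field L] [Algebra K L] [FiniteDimensional K L] (h2 : (2 : K) ≠ 0) (q : ι → K)
    (hq : ∀ v : ι → K, ∑ i, q i * v i * v i = 0 → v = 0) (N : Matrix ι ι K)
    (hN : ∀ i j, q i * N i j = -(q j * N j i)) (a : L)
    (ha : (N.map (algebraMap K L)).charpoly.IsRoot a) : Algebra.trace K L a = 0 := by
  have ha_int : IsIntegral K a := IsIntegral.of_finite K a
  rw [trace_eq_finrank_mul_minpoly_nextCoeff]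
  rw [Polynomial.nextCoeff_eq_zero_of_dvd_comp_neg_X h2 (minpoly.natDegree_pos ha_int).ne' ?_]
  · simp
  set p := minpoly K a with hp
  have hpi : Irreducible p := minpoly.irreducible ha_int
  obtain ⟨u, hu0, hu⟩ : ∃ u : ι → K, u ≠ 0 ∧ (aeval N p).mulVec u = 0 := by
    rw [Matrix.exists_mulVec_eq_zero_iff]
    have h1 : ∃ v : ι → L, v ≠ 0 ∧ (Matrix.scalar ι a - N.map (algebraMap K L)).mulVec v = 0 := by
      rw [Matrix.exists_mulVec_eq_zero_iff, ← Matrix.eval_charpoly]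
      exact ha
    obtain ⟨v, hv0, hv⟩ := h1
    have hv' : (N.map (algebraMap K L)).mulVec v = a • v := by
      rw [Matrix.sub_mulVec, sub_eq_zero] at hv
      rw [← hv]
      ext i
      simp [Matrix.scalar_apply, Matrix.mulVec_diagonal]
    have h3 : (aeval (N.map (algebraMap K L)) p).mulVec v = 0 := by
      have h4 : ∀ f : K[X], (aeval (N.map (algebraMap K L)) f).mulVec v = aeval a f • v := by
        intro f
        induction f using Polynomial.induction_on' with
        | add f g hf hg => simp [Matrix.add_mulVec, hf, hg, add_smul]
        | monomial n c =>
          rw [aeval_monomial, aeval_monomial]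
          induction n with
          | zero =>
            ext i
            simp [Matrix.algebraMap_eq_diagonal, Matrix.mulVec_diagonal]
          | succ n ih =>
            rw [pow_succ, ← mul_assoc, ← Matrix.mulVec_mulVec, hv', Matrix.mulVec_smul, ih,
              smul_smul]
            congr 1
            ring
      rw [h4, hp, minpoly.aeval, zero_smul]
    have h5 : (aeval (N.map (algebraMap K L)) p).det = 0 :=
      Matrix.exists_mulVec_eq_zero_iff.1 ⟨v, hv0, h3⟩
    have h6 : aeval (N.map (algebraMap K L)) p = (aeval N p).map (algebraMap K L) := by
      have := Polynomial.aeval_algHom_apply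
        ((Algebra.ofId K L).mapMatrix (m := ι)) N p
      exact this
    rw [h6, ← RingHom.mapMatrix_apply, ← RingHom.map_det] at h5
    exact (algebraMap K L).injective (by rw [h5, map_zero])
  by_contra hnd
  obtain ⟨α, β, hαβ⟩ := (hpi.coprime_iff_not_dvd.2 hnd)
  set w := (aeval N β).mulVec u with hw
  have huw : u = (aeval N (p.comp (-X))).mulVec w := by
    have h1 := congrArg (fun f => (aeval N f).mulVec u) hαβ
    simp only [map_add, map_mul, map_one, Matrix.add_mulVec, Matrix.one_mulVec,
      ← Matrix.mulVec_mulVec, hu, Matrix.mulVec_zero, zero_add] at h1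
    rw [Matrix.mulVec_mulVec, ← map_mul, mul_comm, map_mul, ← Matrix.mulVec_mulVec] at h1
    exact h1.symm
  have hEN : ∀ f : K[X], Matrix.diagonal q * aeval N f
      = (aeval N (f.comp (-X))).transpose * Matrix.diagonal q := by
    have h1 : Matrix.diagonal q * N = (-N).transpose * Matrix.diagonal q := by
      ext i j
      simp [Matrix.diagonal_mul, Matrix.mul_diagonal, hN i j, mul_comm]
    intro f
    induction f using Polynomial.induction_on' with
    | add f g hf hg => simp [mul_add, add_mul, hf, hg]
    | monomial n c =>
      rw [aeval_monomial, monomial_comp, map_mul, aeval_C, map_pow, map_neg, aeval_X,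
        ← Algebra.smul_def, ← Algebra.smul_def, Matrix.transpose_smul, Matrix.transpose_pow]
      have h3 : Matrix.diagonal q * N ^ n = (-N).transpose ^ n * Matrix.diagonal q := by
        induction n with
        | zero => simp
        | succ n ih => rw [pow_succ, ← mul_assoc, ih, mul_assoc, h1, ← mul_assoc, ← pow_succ]
      rw [Matrix.mul_smul, Matrix.smul_mul, h3]
  have hz : dotProduct u ((Matrix.diagonal q).mulVec u) = 0 := by
    have h1 : dotProduct ((aeval N (p.comp (-X))).mulVec w) ((Matrix.diagonal q).mulVec u) = 0 := by
      rw [← Matrix.vecMul_transpose, ← Matrix.dotProduct_mulVec, Matrix.mulVec_mulVec,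
        ← hEN, ← Matrix.mulVec_mulVec, hu]
      simp
    rwa [← huw] at h1
  exact hu0 (hq u (by
    rw [← hz]
    simp only [dotProduct, Matrix.mulVec_diagonal]
    exact Finset.sum_congr rfl fun i _ => by ring))

section Clifford
variable {Ω V : Type*} [Field Ω] [AddCommGroup V] [Module Ω V] [FiniteDimensional Ω V]

theorem finrank_eigenspace_inf_le (W : Submodule Ω V) (g e : End Ω V) (c δ : Ω) (hc : c ≠ 0)
    (hg : g * g = c • 1) (hW : ∀ v ∈ W, g v ∈ W) (hge : g * e = -(e * g)) :
    finrank Ω ↥(W ⊓ LinearMap.ker (e - δ • 1)) ≤ finrank Ω ↥(W ⊓ LinearMap.ker (e + δ • 1)) := by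
  have hinj : Function.Injective g := by
    refine (injective_iff_map_eq_zero _).2 fun v hv => ?_
    have h := LinearMap.congr_fun hg v
    simp only [End.mul_apply, hv, map_zero, LinearMap.smul_apply, End.one_apply] at h
    exact (smul_eq_zero.1 h.symm).resolve_left hc
  rw [LinearEquiv.finrank_eq (Submodule.equivMapOfInjective g hinj _)]
  refine Submodule.finrank_mono ?_
  rintro _ ⟨v, ⟨hv, hv'⟩, rfl⟩
  refine ⟨hW v hv, ?_⟩
  have h := LinearMap.congr_fun hge v
  have h1 : e v = δ • v := by simpa [sub_eq_zero] using hv'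
  simp only [End.mul_apply, LinearMap.neg_apply, h1, map_smul] at h
  simp [h]

/-- A subspace stable under `2 r` pairwise anticommuting invertible operators whose squares are
scalars has dimension divisible by `2 ^ r`. -/
theorem two_pow_dvd_finrank [IsAlgClosed Ω] (h2 : (2 : Ω) ≠ 0) (g : ℕ → End Ω V) (c : ℕ → Ω)
    (r : ℕ) : (∀ i < 2 * r, ∀ j < 2 * r, i ≠ j → g i * g j = -(g j * g i)) →
    (∀ i < 2 * r, g i * g i = c i • 1) → (∀ i < 2 * r, c i ≠ 0) → ∀ W : Submodule Ω V,
    (∀ i < 2 * r, ∀ v ∈ W, g i v ∈ W) → 2 ^ r ∣ finrank Ω W := by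
  induction r with
  | zero => simp
  | succ r ih =>
    intro hg hsq hc W hW
    set a := g (2 * r) with ha
    set b := g (2 * r + 1) with hb
    have hab : a * b = -(b * a) := hg _ (by omega) _ (by omega) (by omega)
    have haa : a * a = c (2 * r) • 1 := hsq _ (by omega)
    have hbb : b * b = c (2 * r + 1) • 1 := hsq _ (by omega)
    obtain ⟨e, he⟩ : ∃ e, e = a * b := ⟨_, rfl⟩
    obtain ⟨δ, hδ⟩ := IsAlgClosed.exists_pow_nat_eq (-(c (2 * r) * c (2 * r + 1))) two_pos
    have hδ0 : δ ≠ 0 := by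
      rintro rfl
      have h1 := hc (2 * r) (by omega)
      have h3 := hc (2 * r + 1) (by omega)
      simp [h1, h3] at hδ
    have hee : e * e = (δ ^ 2) • 1 := by
      calc e * e = -(a * a * (b * b)) := by
            rw [he]; nth_rewrite 1 [hab]
            rw [neg_mul, mul_assoc b a, ← mul_assoc a a, haa, smul_one_mul, mul_smul_comm, hbb,
              smul_one_mul, smul_comm]
        _ = _ := by rw [haa, hbb, hδ, smul_one_mul, smul_smul, neg_smul]
    have hae : a * e = -(e * a) := by
      rw [he, mul_assoc a b a, ← neg_eq_iff_eq_neg.2 hab, mul_neg, neg_neg]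
    have hWa := hW (2 * r) (by omega)
    have hWb := hW (2 * r + 1) (by omega)
    have hWe : ∀ v ∈ W, e v ∈ W := fun v hv => he ▸ hWa _ (hWb v hv)
    have hle1 := finrank_eigenspace_inf_le W a e _ δ (hc (2 * r) (by omega)) haa hWa hae
    have hle2 := finrank_eigenspace_inf_le W a e _ (-δ) (hc (2 * r) (by omega)) haa hWa hae
    rw [neg_smul, sub_neg_eq_add, ← sub_eq_add_neg] at hle2
    set P := W ⊓ LinearMap.ker (e - δ • 1) with hP
    set M := W ⊓ LinearMap.ker (e + δ • 1) with hM
    have hPM : finrank Ω P = finrank Ω M := le_antisymm hle1 hle2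
    have hee' : ∀ v, e (e v) = (δ ^ 2) • v := fun v => LinearMap.congr_fun hee v
    have hsup : P ⊔ M = W := by
      refine le_antisymm (sup_le inf_le_left inf_le_left) fun v hv => ?_
      rw [Submodule.mem_sup]
      refine ⟨(2 * δ)⁻¹ • (δ • v + e v), ?_, (2 * δ)⁻¹ • (δ • v - e v), ?_, ?_⟩
      · refine ⟨W.smul_mem _ (W.add_mem (W.smul_mem _ hv) (hWe v hv)), ?_⟩
        rw [SetLike.mem_coe, LinearMap.mem_ker, map_smul]
        simp only [LinearMap.sub_apply, map_add, map_smul, hee', LinearMap.smul_apply,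
          End.one_apply]
        rw [show δ • (e v - δ • v) + (δ ^ 2 • v - δ • e v) = 0 by module, smul_zero]
      · refine ⟨W.smul_mem _ (W.sub_mem (W.smul_mem _ hv) (hWe v hv)), ?_⟩
        rw [SetLike.mem_coe, LinearMap.mem_ker, map_smul]
        simp only [LinearMap.add_apply, map_sub, map_smul, hee', LinearMap.smul_apply,
          End.one_apply]
        rw [show δ • (e v + δ • v) - (δ ^ 2 • v + δ • e v) = 0 by module, smul_zero]
      · rw [← smul_add, show δ • v + e v + (δ • v - e v) = (2 * δ) • v by
          rw [two_mul, add_smul]; abel, smul_smul, inv_mul_cancel₀ (mul_ne_zero h2 hδ0), one_smul]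
    have hinf : P ⊓ M = ⊥ := by
      rw [eq_bot_iff]
      rintro v ⟨⟨-, h1⟩, ⟨-, h3⟩⟩
      rw [SetLike.mem_coe, LinearMap.mem_ker] at h1 h3
      simp only [LinearMap.sub_apply, LinearMap.add_apply, LinearMap.smul_apply,
        End.one_apply] at h1 h3
      have h4 : (2 * δ) • v = 0 := by
        rw [two_mul, add_smul]
        have : (e v + δ • v) - (e v - δ • v) = 0 := by rw [h1, h3, sub_zero]
        rw [← this]; abel
      exact (smul_eq_zero.1 h4).resolve_left (mul_ne_zero h2 hδ0)
    have hdim : finrank Ω W = 2 * finrank Ω P := by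
      have := Submodule.finrank_sup_add_finrank_inf_eq P M
      rw [hsup, hinf, finrank_bot, ← hPM] at this
      omega
    rw [hdim, pow_succ, mul_comm]
    refine mul_dvd_mul_left 2 (ih (fun i hi j hj => hg i (by omega) j (by omega))
      (fun i hi => hsq i (by omega)) (fun i hi => hc i (by omega)) P ?_)
    rintro i hi v ⟨hv, hv'⟩
    refine ⟨hW i (by omega) v hv, ?_⟩
    have h1 := hg i (by omega) (2 * r) (by omega) (by omega)
    have h3 := hg i (by omega) (2 * r + 1) (by omega) (by omega)
    have hcomm : g i * e = e * g i := by
      rw [he, ← mul_assoc, h1, neg_mul, mul_assoc, h3, mul_neg, neg_neg, mul_assoc]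
    have h4 := LinearMap.congr_fun hcomm v
    have h5 : e v = δ • v := by simpa [sub_eq_zero] using hv'
    simp only [End.mul_apply, h5, map_smul] at h4
    simp [← h4]

end Clifford

section Trace
variable {Ω V : Type*} [Field Ω] [IsAlgClosed Ω] [AddCommGroup V] [Module Ω V]
  [FiniteDimensional Ω V]

theorem trace_sub_smul_mem_of_hasEigenvalue (F : End Ω V) (X : AddSubgroup Ω) (l : Ω)
    (h : ∀ μ, F.HasEigenvalue μ → μ - l ∈ X) :
    LinearMap.trace Ω V F - (finrank Ω V : ℕ) • l ∈ X := by
  have hs : F.charpoly.Splits := IsAlgClosed.splits _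
  rw [Module.End.trace_eq_sum_roots_charpoly_of_splits hs, ← LinearMap.charpoly_natDegree F,
    hs.natDegree_eq_card_roots]
  have hroots : ∀ μ ∈ F.charpoly.roots, μ - l ∈ X := fun μ hμ =>
    h μ ((Module.End.hasEigenvalue_iff_isRoot_charpoly F μ).2 (isRoot_of_mem_roots hμ))
  generalize F.charpoly.roots = s at hroots
  induction s using Multiset.induction_on with
  | empty => simp
  | cons a s ih =>
    rw [Multiset.sum_cons, Multiset.card_cons, succ_nsmul]
    have := X.add_mem (hroots a (Multiset.mem_cons_self _ _))
      (ih fun μ hμ => hroots μ (Multiset.mem_cons_of_mem hμ))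
    convert this using 1
    ring

variable {ι : Type*} [Fintype ι] [DecidableEq ι]

omit [IsAlgClosed Ω] [FiniteDimensional Ω V] [DecidableEq ι] in
theorem pow_sub_apply_eq_zero_of_commutator (g : ι → End Ω V) (T : End Ω V) (N : Matrix ι ι Ω)
    (hN : ∀ j, T * g j - g j * T = ∑ i, N i j • g i) (a ν : Ω) (s : ℕ) :
    ∀ (n m : ℕ) (u : ι → Ω) (v : V), n + m = s → ((N.mulVecLin - a • 1) ^ n) u = 0 →
    ((T - ν • 1) ^ m) v = 0 → ((T - (ν + a) • 1) ^ s) (∑ i, u i • g i v) = 0 := by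
  induction s with
  | zero =>
    intro n m u v hnm hu hv
    obtain rfl : n = 0 := by omega
    have : u = 0 := by simpa using hu
    simp [this]
  | succ s ih =>
    intro n m u v hnm hu hv
    rcases n with _ | n
    · have : u = 0 := by simpa using hu
      simp [this]
    rcases m with _ | m
    · have : v = 0 := by simpa using hv
      simp [this]
    have hcomm : T (∑ i, u i • g i v) = ∑ i, (N.mulVecLin u) i • g i v + ∑ i, u i • g i (T v) := by
      have h1 : ∀ j, T (g j v) = g j (T v) + ∑ i, N i j • g i v := fun j => by
        have := LinearMap.congr_fun (hN j) v
        simp only [LinearMap.sub_apply, End.mul_apply, LinearMap.sum_apply,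
          LinearMap.smul_apply] at this
        rw [← this]; abel
      simp only [map_sum, map_smul, h1, smul_add, Finset.sum_add_distrib]
      rw [add_comm]
      congr 1
      simp only [Finset.smul_sum, smul_smul, Matrix.mulVecLin_apply, Matrix.mulVec, dotProduct,
        Finset.sum_smul]
      rw [Finset.sum_comm]
      simp only [mul_comm]
    have hstep : (T - (ν + a) • 1) (∑ i, u i • g i v)
        = ∑ i, ((N.mulVecLin - a • 1) u) i • g i v + ∑ i, u i • g i ((T - ν • 1) v) := by
      rw [LinearMap.sub_apply, hcomm]
      simp only [LinearMap.sub_apply, LinearMap.smul_apply, End.one_apply, Pi.sub_apply,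
        Pi.smul_apply, sub_smul, map_sub, map_smul, smul_sub, Finset.sum_sub_distrib, add_smul,
        LinearMap.add_apply, Finset.smul_sum, smul_smul, smul_eq_mul, mul_comm]
      abel
    rw [pow_succ, End.mul_apply, hstep, map_add,
      ih n (m + 1) _ v (by omega) (by rwa [pow_succ, End.mul_apply] at hu) hv,
      ih (n + 1) m u _ (by omega) hu (by rwa [pow_succ, End.mul_apply] at hv), add_zero]

omit [FiniteDimensional Ω V] in
theorem apply_mem_iSup_maxGenEigenspace (X : AddSubgroup Ω) (g : ι → End Ω V) (T : End Ω V)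
    (N : Matrix ι ι Ω) (hTN : ∀ j, T * g j - g j * T = ∑ i, N i j • g i)
    (hNX : ∀ a, N.charpoly.IsRoot a → a ∈ X) (l : Ω) (u : ι → Ω) :
    (⨆ (ν : Ω) (_ : ν - l ∈ X), T.maxGenEigenspace ν) ≤
      (⨆ (ν : Ω) (_ : ν - l ∈ X), T.maxGenEigenspace ν).comap (∑ i, u i • g i) := by
  set W : Submodule Ω V := ⨆ (ν : Ω) (_ : ν - l ∈ X), T.maxGenEigenspace ν with hW
  set N' : End Ω (ι → Ω) := N.mulVecLin with hN'
  have hu : u ∈ ⨆ a : Ω, N'.maxGenEigenspace a := by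
    rw [End.iSup_maxGenEigenspace_eq_top]; trivial
  refine Submodule.iSup_induction (fun a : Ω => N'.maxGenEigenspace a) (motive := fun u => W ≤ W.comap (∑ i, u i • g i)) hu
    ?_ ?_ ?_
  · intro a u hu
    refine iSup₂_le fun ν hν v hv => ?_
    obtain ⟨n, hn⟩ := (End.mem_maxGenEigenspace _ _ _).1 hu
    obtain ⟨m, hm⟩ := (End.mem_maxGenEigenspace _ _ _).1 hv
    by_cases ha : N.charpoly.IsRoot a
    · refine Submodule.mem_iSup_of_mem (ν + a) (Submodule.mem_iSup_of_mem ?_ ?_)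
      · rw [add_sub_right_comm]
        exact X.add_mem hν (hNX a ha)
      · rw [End.mem_maxGenEigenspace]
        refine ⟨n + m, ?_⟩
        have := pow_sub_apply_eq_zero_of_commutator g T N hTN a ν _ n m u v rfl hn hm
        simpa [LinearMap.sum_apply] using this
    · have hinj : Function.Injective (N' - a • 1 : End Ω (ι → Ω)) := by
        refine (injective_iff_map_eq_zero _).2 fun w hw => ?_
        by_contra hw0
        refine ha ?_
        rw [IsRoot.def, Matrix.eval_charpoly, ← Matrix.exists_mulVec_eq_zero_iff]
        refine ⟨w, hw0, ?_⟩
        have h1 : N.mulVec w = a • w := by simpa [hN', sub_eq_zero] using hw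
        rw [Matrix.sub_mulVec, h1, sub_eq_zero]
        ext i
        simp [Matrix.scalar_apply, Matrix.mulVec_diagonal]
      have hu0 : u = 0 := by
        have := hinj.iterate n
        rw [← End.coe_pow] at this
        exact this (by rw [hn, map_zero])
      simp [hu0]
  · intro v _
    simp
  · intro x y hx hy v hv
    have := W.add_mem (hx hv) (hy hv)
    simpa [add_smul, Finset.sum_add_distrib] using this

theorem exists_stable_nsmul_mem (h2 : (2 : Ω) ≠ 0) (X : AddSubgroup Ω) (g : ι → End Ω V)
    (hg : ∀ i j, i ≠ j → g i * g j = -(g j * g i)) (c : ι → ι → Ω) (hc : ∀ i, c i i = 0)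
    (R : End Ω V) (N : Matrix ι ι Ω)
    (hN : ∀ j, (∑ i, ∑ j, c i j • (g i * g j)) * g j - g j * (∑ i, ∑ j, c i j • (g i * g j))
      = ∑ i, N i j • g i)
    (hR : ∀ j, R * g j = g j * R) (hNX : ∀ a, N.charpoly.IsRoot a → a ∈ X)
    (hRX : ∀ a, R.HasEigenvalue a → a ∈ X) (l : Ω)
    (hl : ((∑ i, ∑ j, c i j • (g i * g j)) + R).HasEigenvalue l) :
    ∃ W : Submodule Ω V, W ≠ ⊥ ∧ (∀ i, ∀ v ∈ W, g i v ∈ W) ∧ (finrank Ω W) • l ∈ X := by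
  set D := ∑ i, ∑ j, c i j • (g i * g j) with hD
  set T := D + R with hT
  set W : Submodule Ω V := ⨆ (ν : Ω) (_ : ν - l ∈ X), T.maxGenEigenspace ν with hW
  have hWg : ∀ i, ∀ v ∈ W, g i v ∈ W := by
    have hTN : ∀ j, T * g j - g j * T = ∑ i, N i j • g i := fun j => by
      rw [← hN, hT, add_mul, mul_add, hR]; abel
    have key := apply_mem_iSup_maxGenEigenspace X g T N hTN hNX l
    intro i v hv
    have := key (Pi.single i 1) hv
    simpa [Pi.single_apply, ite_smul] using this
  have hWD : ∀ v ∈ W, D v ∈ W := fun v hv => by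
    simp only [hD, LinearMap.sum_apply, LinearMap.smul_apply, End.mul_apply]
    exact W.sum_mem fun i _ => W.sum_mem fun j _ => W.smul_mem _ (hWg _ _ (hWg _ _ hv))
  have hWT : ∀ v ∈ W, T v ∈ W := by
    suffices W ≤ W.comap T from this
    refine iSup₂_le fun ν hν v hv => ?_
    exact Submodule.mem_iSup_of_mem ν (Submodule.mem_iSup_of_mem hν
      (End.mapsTo_maxGenEigenspace_of_comm (Commute.refl T) ν hv))
  have hWR : ∀ v ∈ W, R v ∈ W := fun v hv => by
    have : R v = T v - D v := by simp [hT]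
    rw [this]; exact W.sub_mem (hWT v hv) (hWD v hv)
  refine ⟨W, ?_, hWg, ?_⟩
  · obtain ⟨v, hv⟩ := hl.exists_hasEigenvector
    refine fun h => hv.2 ?_
    rw [← Submodule.mem_bot Ω, ← h]
    refine Submodule.mem_iSup_of_mem l (Submodule.mem_iSup_of_mem (by simp) ?_)
    rw [End.mem_maxGenEigenspace]
    exact ⟨1, by simp [hv.apply_eq_smul]⟩
  · have hsum : T.restrict hWT = ∑ i, ∑ j, c i j • ((g i).restrict (hWg i) * (g j).restrict (hWg j))
        + R.restrict hWR := by
      ext v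
      simp [hT, hD, LinearMap.sum_apply]
    have hD0 : LinearMap.trace Ω W
        (∑ i, ∑ j, c i j • ((g i).restrict (hWg i) * (g j).restrict (hWg j))) = 0 := by
      rw [map_sum]
      refine Finset.sum_eq_zero fun i _ => ?_
      rw [map_sum]
      refine Finset.sum_eq_zero fun j _ => ?_
      by_cases hij : i = j
      · simp [hij, hc]
      rw [map_smul]
      have h1 : (g i).restrict (hWg i) * (g j).restrict (hWg j)
          = -((g j).restrict (hWg j) * (g i).restrict (hWg i)) := by
        ext v
        have := LinearMap.congr_fun (hg i j hij) v
        simpa using this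
      have h3 := LinearMap.trace_mul_comm Ω ((g i).restrict (hWg i)) ((g j).restrict (hWg j))
      have h4 := congrArg (LinearMap.trace Ω W) h1
      rw [map_neg, ← h3] at h4
      have h5 : (2 : Ω) * LinearMap.trace Ω W
          ((g i).restrict (hWg i) * (g j).restrict (hWg j)) = 0 := by
        linear_combination h4
      rw [(mul_eq_zero.1 h5).resolve_left h2, smul_zero]
    have htr := congrArg (LinearMap.trace Ω W) hsum
    rw [map_add, hD0, zero_add] at htr
    have h1 := trace_sub_smul_mem_of_hasEigenvalue (T.restrict hWT) X l ?_
    · have h3 := trace_sub_smul_mem_of_hasEigenvalue (R.restrict hWR) X 0 ?_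
      · rw [smul_zero, sub_zero, ← htr] at h3
        have := X.sub_mem h3 h1
        rwa [sub_sub_cancel] at this
      · intro μ hμ
        rw [sub_zero]
        refine hRX μ ?_
        obtain ⟨v, hv⟩ := hμ.exists_hasEigenvector
        refine End.hasEigenvalue_of_hasEigenvector (x := (v : V)) ⟨?_, ?_⟩
        · rw [End.mem_eigenspace_iff]
          simpa using congrArg Subtype.val hv.apply_eq_smul
        · simpa using hv.2
    · intro μ hμ
      by_contra hμX
      obtain ⟨v, hv⟩ := hμ.exists_hasEigenvector
      have h3 : (v : V) ∈ T.maxGenEigenspace μ := by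
        rw [End.mem_maxGenEigenspace]
        refine ⟨1, ?_⟩
        have := congrArg Subtype.val hv.apply_eq_smul
        simp only [LinearMap.coe_restrict_apply, Submodule.coe_smul] at this
        simp [this]
      have h4 : W ≤ ⨆ (ν : Ω) (_ : ν ≠ μ), T.maxGenEigenspace ν :=
        iSup₂_le fun ν hν => le_iSup₂_of_le ν (fun h => hμX (h ▸ hν)) le_rfl
      have h5 := (End.independent_maxGenEigenspace T) μ
      have h6 := Submodule.disjoint_def.1 h5 _ h3 (h4 v.2)
      exact hv.2 (by simpa using h6)

end Trace

theorem clifford_commutator {k E ι : Type*} [CommRing k] [Ring E] [Algebra k E] [Fintype ι]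
    [DecidableEq ι] (q : ι → k) (g : ι → E) (hg : ∀ i j, i ≠ j → g i * g j = -(g j * g i))
    (hsq : ∀ i, g i * g i = q i • 1) (c : ι → ι → k) (j : ι) :
    (∑ i, ∑ l, c i l • (g i * g l)) * g j - g j * (∑ i, ∑ l, c i l • (g i * g l))
      = ∑ i, (2 * q j * (c i j - c j i)) • g i := by
  have h1 : ∀ i l, g i * g l * g j - g j * (g i * g l)
      = (if l = j then (2 * q j) • g i else 0) - (if i = j then (2 * q j) • g l else 0) := by
    intro i l
    by_cases hl : l = j <;> by_cases hi : i = j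
    · subst hl; subst hi; simp [mul_assoc]
    · subst hl
      rw [if_pos rfl, if_neg hi, sub_zero, mul_assoc, hsq, ← mul_assoc, hg l i (Ne.symm hi),
        neg_mul, mul_assoc, hsq, sub_neg_eq_add, mul_smul_comm, mul_one, two_mul, add_smul]
    · subst hi
      rw [if_pos rfl, if_neg hl, zero_sub, ← mul_assoc, hsq, mul_assoc, hg l i hl,
        mul_neg, ← mul_assoc, hsq, smul_one_mul, two_mul, add_smul]
      abel
    · rw [if_neg hi, if_neg hl, sub_zero, mul_assoc, hg l j hl, mul_neg, ← mul_assoc, hg i j hi]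
      simp [mul_assoc]
  calc _ = ∑ i, ∑ l, c i l • (g i * g l * g j - g j * (g i * g l)) := by
        simp only [Finset.sum_mul, Finset.mul_sum, smul_mul_assoc, mul_smul_comm, smul_sub,
          Finset.sum_sub_distrib]
    _ = _ := by
        simp only [h1, smul_sub, Finset.sum_sub_distrib, smul_ite, smul_zero,
          Finset.sum_ite_eq', Finset.mem_univ, if_true, mul_sub, sub_smul, smul_smul]
        congr 1
        · simp only [mul_comm]
        · rw [Finset.sum_comm]
          simp [mul_comm]

theorem natCast_ne_zero_of_le_four {k : Type*} [Field k] (h2 : (2 : k) ≠ 0) (h3 : (3 : k) ≠ 0)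
    {j : ℕ} (hj : j ≠ 0) (hj4 : j ≤ 4) : (j : k) ≠ 0 := by
  have h4 : (4 : k) ≠ 0 := by
    rw [show (4 : k) = 2 * 2 by norm_num]
    exact mul_ne_zero h2 h2
  obtain rfl | rfl | rfl | rfl : j = 1 ∨ j = 2 ∨ j = 3 ∨ j = 4 := by omega
  · simp
  · exact_mod_cast h2
  · exact_mod_cast h3
  · exact_mod_cast h4

theorem trace_eq_zero_of_sq_eq {k K L : Type*} [Field k] [Field K] [Field L] [Algebra k K]
    [Algebra k L] [Algebra K L] [IsScalarTower k K L] [FiniteDimensional k K] [FiniteDimensional K L]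
    (h2 : (2 : K) ≠ 0) (hodd : Odd (finrank k K)) {β : k} (hβ : ¬ IsSquare β) {b : L}
    (hb : b ^ 2 = algebraMap k L β) : Algebra.trace K L b = 0 := by
  have haniso : ∀ v : Fin 2 → K,
      ∑ i, algebraMap k K ((![1, -β] : Fin 2 → k) i) * v i * v i = 0 → v = 0 := by
    intro v hv
    refine springer_odd_extension hodd
      (fun i j => if i = j then (![1, -β] : Fin 2 → k) i else 0) ?_ v ?_
    · intro w hw
      have hw' : w 0 * w 0 = β * (w 1 * w 1) := by
        simp [Fin.sum_univ_two, -mul_eq_mul_left_iff] at hw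
        linear_combination hw
      have h1 : w 1 = 0 := by
        by_contra h1
        exact hβ ⟨w 0 / w 1, by field_simp; linear_combination -hw'⟩
      rw [h1, mul_zero, mul_zero] at hw'
      funext i
      fin_cases i
      · exact mul_self_eq_zero.1 hw'
      · exact h1
    · simpa [apply_ite (algebraMap k K), ite_mul] using hv
  refine trace_eq_zero_of_isRoot_charpoly h2
    (fun i => algebraMap k K ((![1, -β] : Fin 2 → k) i)) haniso
    !![0, algebraMap k K β; 1, 0] ?_ b ?_
  · intro i j
    fin_cases i <;> fin_cases j <;> simp
  · simp [Matrix.charpoly_fin_two, Matrix.trace_fin_two, Matrix.det_fin_two, hb,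
      ← IsScalarTower.algebraMap_apply]

set_option maxHeartbeats 1000000 in
/-- Let `g i` be anticommuting operators with `(g i)² = q i` for an anisotropic diagonal form `q`,
acting on a space of small dimension. If `D` is a combination of products `g i * g j` with `i ≠ j`
and `R` commutes with all `g i` and is either nilpotent or a square root of a nonsquare, then
`D + R` has no nonzero fixed vector. -/
theorem eq_zero_of_clifford_fixed {k ι M : Type*} [Field k] [AddCommGroup M] [Module k M]
    [FiniteDimensional k M] [Fintype ι] [DecidableEq ι] (h2 : (2 : k) ≠ 0) (h3 : (3 : k) ≠ 0)
    (q : ι → k) (hq : ∀ v : ι → k, ∑ i, q i * v i * v i = 0 → v = 0) (g : ι → End k M)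
    (hg : ∀ i j, i ≠ j → g i * g j = -(g j * g i)) (hsq : ∀ i, g i * g i = q i • 1)
    (c : ι → ι → k) (hc : ∀ i, c i i = 0) (R : End k M) (hR : ∀ i, R * g i = g i * R) (β : k)
    (hRβ : R * R = β • 1) (hβ : β = 0 ∨ ¬ IsSquare β) (r : ℕ) (hr : 2 * r ≤ Fintype.card ι)
    (hdim : finrank k M ≤ 4 * 2 ^ r) (x : M)
    (hx : (∑ i, ∑ j, c i j • (g i * g j)) x + R x = x) : x = 0 := by
  by_contra hx0
  set N : Matrix ι ι k := Matrix.of fun i j => 2 * q j * (c i j - c j i) with hN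
  set f : k[X] := N.charpoly * (X ^ 2 - C β) with hf
  let L := f.SplittingField
  have hf0 : f ≠ 0 := mul_ne_zero N.charpoly_monic.ne_zero (X_pow_sub_C_ne_zero two_pos β)
  have hfs : (f.map (algebraMap k L)).Splits := SplittingField.splits f
  have hnorm : Normal k L := Normal.of_isSplittingField f
  obtain ⟨K, hKodd, s, hs⟩ := exists_intermediateField_odd_finrank (L := L) h2
  have hs0 : ((finrank K L : ℕ) : K) ≠ 0 := by
    rw [hs]; push_cast
    refine pow_ne_zero _ fun h => h2 ((algebraMap k K).injective ?_)
    rw [map_ofNat, h, map_zero]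
  have h2K : (2 : K) ≠ 0 := fun h => h2 ((algebraMap k K).injective (by
    rw [map_ofNat, h, map_zero]))
  let Ω := AlgebraicClosure L
  have h2Ω : (2 : Ω) ≠ 0 := fun h => h2 ((algebraMap k Ω).injective (by
    rw [map_ofNat, h, map_zero]))
  let X₀ : AddSubgroup Ω :=
    (LinearMap.ker (Algebra.trace K L)).toAddSubgroup.map (algebraMap L Ω).toAddMonoidHom
  have hX₀ : ∀ b : L, Algebra.trace K L b = 0 → algebraMap L Ω b ∈ X₀ := fun b hb =>
    ⟨b, hb, rfl⟩
  have hroot : ∀ p : k[X], p ∣ f → ∀ a : Ω, (p.map (algebraMap k Ω)).IsRoot a →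
      ∃ b : L, algebraMap L Ω b = a ∧ (p.map (algebraMap k L)).IsRoot b := by
    intro p hp a ha
    have hp0 : p ≠ 0 := ne_zero_of_dvd_ne_zero hf0 hp
    have hps : (p.map (algebraMap k L)).Splits := by
      refine hfs.of_dvd ?_ ?_
      · exact (Polynomial.map_ne_zero_iff (algebraMap k L).injective).2 hf0
      · exact Polynomial.map_dvd _ hp
    rw [IsScalarTower.algebraMap_eq k L Ω, ← Polynomial.map_map] at ha
    obtain ⟨b, rfl⟩ := hps.mem_range_of_isRoot
      ((Polynomial.map_ne_zero_iff (algebraMap k L).injective).2 hp0) ha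
    refine ⟨b, rfl, ?_⟩
    rw [IsRoot.def, eval_map, eval₂_hom] at ha
    exact (algebraMap L Ω).injective (by rw [ha, map_zero])
  have hqK : ∀ v : ι → K, ∑ i, algebraMap k K (q i) * v i * v i = 0 → v = 0 := by
    intro v hv
    refine springer_odd_extension hKodd (fun i j => if i = j then q i else 0) ?_ v ?_
    · intro w hw
      refine hq w ?_
      simpa [ite_mul] using hw
    · simpa [apply_ite (algebraMap k K), ite_mul] using hv
  let φ := Module.End.baseChangeHom k Ω M
  have hφs : ∀ (a : k) (F : End k M), φ (a • F) = algebraMap k Ω a • φ F := fun a F => by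
    rw [map_smul, algebraMap_smul]
  have hNΩ : ∀ j, (∑ i, ∑ l, algebraMap k Ω (c i l) • (φ (g i) * φ (g l))) * φ (g j)
      - φ (g j) * (∑ i, ∑ l, algebraMap k Ω (c i l) • (φ (g i) * φ (g l)))
      = ∑ i, N.map (algebraMap k Ω) i j • φ (g i) := fun j => by
    have h4 := congrArg φ (clifford_commutator q g hg hsq c j)
    simp only [map_sub, map_mul, map_sum, hφs] at h4
    rw [h4]
    simp [hN]
  have hl : ((∑ i, ∑ l, algebraMap k Ω (c i l) • (φ (g i) * φ (g l))) + φ R).HasEigenvalue 1 := by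
    refine End.hasEigenvalue_of_hasEigenvector (x := (1 : Ω) ⊗ₜ[k] x) ⟨?_, ?_⟩
    · rw [End.mem_eigenspace_iff, one_smul]
      have h4 : (∑ i, ∑ l, algebraMap k Ω (c i l) • (φ (g i) * φ (g l))) + φ R
          = φ ((∑ i, ∑ j, c i j • (g i * g j)) + R) := by
        simp only [map_add, map_mul, map_sum, hφs]
      rw [h4]
      change LinearMap.baseChange Ω _ _ = _
      rw [LinearMap.baseChange_tmul, LinearMap.add_apply, hx]
    · intro h
      refine hx0 (Module.FaithfullyFlat.tensorProduct_mk_injective (A := k) (B := Ω) M ?_)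
      simpa using h
  have hXN : ∀ a : Ω, (N.map (algebraMap k Ω)).charpoly.IsRoot a → a ∈ X₀ := by
    intro a ha
    rw [Matrix.charpoly_map] at ha
    obtain ⟨b, rfl, hb⟩ := hroot N.charpoly (dvd_mul_right _ _) a ha
    refine hX₀ b (trace_eq_zero_of_isRoot_charpoly h2K (fun i => algebraMap k K (q i)) hqK
      (N.map (algebraMap k K)) ?_ b ?_)
    · intro i j
      simp only [Matrix.map_apply, ← map_mul, ← map_neg, hN, Matrix.of_apply]
      congr 1; ring
    · rw [Matrix.map_map, ← RingHom.coe_comp, ← IsScalarTower.algebraMap_eq, Matrix.charpoly_map]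
      exact hb
  have hXR : ∀ a : Ω, End.HasEigenvalue (φ R) a → a ∈ X₀ := by
    intro a ha
    have ha2 : a ^ 2 = algebraMap k Ω β := by
      obtain ⟨v, hv⟩ := ha.exists_hasEigenvector
      have h4 : φ R (φ R v) = algebraMap k Ω β • v := by
        rw [← End.mul_apply, ← map_mul, hRβ, hφs, map_one]; rfl
      rw [hv.apply_eq_smul, map_smul, hv.apply_eq_smul, smul_smul, ← sub_eq_zero, ← sub_smul] at h4
      rw [pow_two]
      exact sub_eq_zero.1 ((smul_eq_zero.1 h4).resolve_right hv.2)
    obtain ⟨b, rfl, hb⟩ := hroot (X ^ 2 - C β) (dvd_mul_left _ _) a (by simp [ha2])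
    refine hX₀ b ?_
    have hb2 : b ^ 2 = algebraMap k L β := by simpa [sub_eq_zero] using hb
    rcases hβ with rfl | hβ
    · rw [map_zero] at hb2
      rw [pow_eq_zero_iff two_ne_zero |>.1 hb2, map_zero]
    · exact trace_eq_zero_of_sq_eq h2K hKodd hβ hb2
  obtain ⟨W, hW0, hWg, hWX⟩ := exists_stable_nsmul_mem h2Ω X₀ (fun i => φ (g i))
    (fun i j hij => by rw [← map_mul, hg i j hij, map_neg, map_mul])
    (fun i j => algebraMap k Ω (c i j)) (fun i => by rw [hc, map_zero]) (φ R)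
    (N.map (algebraMap k Ω)) hNΩ (fun i => by rw [← map_mul, hR, map_mul]) hXN hXR 1 hl
  have hqi : ∀ i, q i ≠ 0 := fun i hi => by
    have := congrFun (hq (Pi.single i 1) (by
      refine Finset.sum_eq_zero fun j _ => ?_
      by_cases hij : j = i
      · simp [hij, hi]
      · simp [hij])) i
    simp at this
  let e := Fintype.equivFin ι
  have hcard : ∀ {i}, i < 2 * r → i < Fintype.card ι := fun hi => lt_of_lt_of_le hi hr
  let g' : ℕ → End Ω (Ω ⊗[k] M) := fun i =>
    if h : i < Fintype.card ι then φ (g (e.symm ⟨i, h⟩)) else 0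
  let q' : ℕ → Ω := fun i =>
    if h : i < Fintype.card ι then algebraMap k Ω (q (e.symm ⟨i, h⟩)) else 0
  have hdvd : 2 ^ r ∣ finrank Ω W := by
    refine two_pow_dvd_finrank h2Ω g' q' r ?_ ?_ ?_ W ?_
    · intro i hi j hj hij
      simp only [g', dif_pos (hcard hi), dif_pos (hcard hj)]
      rw [← map_mul, hg, map_neg, map_mul]
      simpa using hij
    · intro i hi
      simp only [g', q', dif_pos (hcard hi)]
      rw [← map_mul, hsq, hφs, map_one]
    · intro i hi
      simp only [q', dif_pos (hcard hi)]
      exact (map_ne_zero_iff _ (algebraMap k Ω).injective).2 (hqi _)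
    · intro i hi
      simp only [g', dif_pos (hcard hi)]
      exact hWg _
  obtain ⟨t, ht, htn⟩ := hWX
  have htn' : algebraMap L Ω t = algebraMap L Ω ((finrank Ω W : ℕ) : L) := by
    rw [map_natCast]
    simpa using htn
  have ht' := (algebraMap L Ω).injective htn'
  have ht0 : Algebra.trace K L ((finrank Ω W : ℕ) : L) = 0 := by rw [← ht']; exact ht
  rw [← map_natCast (algebraMap K L), Algebra.trace_algebraMap, nsmul_eq_mul] at ht0
  have hk0 : ((finrank Ω W : ℕ) : k) = 0 := (algebraMap k K).injective (by
    rw [map_natCast, map_zero]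
    exact (mul_eq_zero.1 ht0).resolve_left hs0)
  obtain ⟨j, hj⟩ := hdvd
  have hj4 : j ≤ 4 := by
    have h4 : finrank Ω W ≤ finrank k M := by
      rw [← Module.finrank_baseChange (R := Ω) (S := k)]
      exact Submodule.finrank_le W
    have h5 := h4.trans hdim
    rw [hj, mul_comm] at h5
    exact Nat.le_of_mul_le_mul_right h5 (by positivity)
  have hj0 : j ≠ 0 := by
    rintro rfl
    rw [mul_zero] at hj
    exact hW0 (Submodule.finrank_eq_zero.1 hj)
  rw [hj] at hk0
  push_cast at hk0
  have hjk := (mul_eq_zero.1 hk0).resolve_left (pow_ne_zero _ h2)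
  exact natCast_ne_zero_of_le_four h2 h3 hj0 hj4 hjk

namespace AlbertForm

variable {k : Type u} [Field k] {A : AlgebraWithInvolution k} (Φ : AlbertForm A)

theorem injective_mul {s : A.skew} (hs : Φ.Q s ≠ 0) {a b : A.carrier}
    (h : (s : A.carrier) * a = s * b) : a = b :=
  ((Φ.nonzero_iff s).1 hs).1 h

theorem natMap_mul (hQ : Φ.Q.Anisotropic) (s : A.skew) (a : A.carrier) :
    (Φ.natMap s : A.carrier) * ((s : A.carrier) * a) = -(Φ.Q s) • a := by
  by_cases hs : s = 0
  · simp [hs]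
  · refine Φ.injective_mul (fun h => hs (hQ s h)) ?_
    rw [Φ.mul_natMap, mul_smul_comm]

theorem mul_natMap_add (s t : A.skew) (a : A.carrier) :
    (s : A.carrier) * ((Φ.natMap t : A.carrier) * a) + t * ((Φ.natMap s : A.carrier) * a) =
      -(QuadraticMap.polar Φ.Q s t) • a := by
  have h := Φ.mul_natMap (s + t) a
  have h1 := Φ.mul_natMap s a
  have h2 := Φ.mul_natMap t a
  simp only [map_add, Submodule.coe_add, add_mul, mul_add] at h
  rw [QuadraticMap.polar]
  linear_combination (norm := module) h - h1 - h2

theorem natMap_mul_add (hQ : Φ.Q.Anisotropic) (s t : A.skew) (a : A.carrier) :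
    (Φ.natMap s : A.carrier) * ((t : A.carrier) * a) + (Φ.natMap t : A.carrier) * (s * a) =
      -(QuadraticMap.polar Φ.Q s t) • a := by
  have h := Φ.natMap_mul hQ (s + t) a
  have h1 := Φ.natMap_mul hQ s a
  have h2 := Φ.natMap_mul hQ t a
  simp only [map_add, Submodule.coe_add, add_mul, mul_add] at h
  rw [QuadraticMap.polar]
  linear_combination (norm := module) h - h1 - h2

/-- The Clifford action `(a, b) ↦ (s b, s♮ a)` of a skew element `s` on `A × A`. -/
def clifford (s : A.skew) : End k (A.carrier × A.carrier) :=
  (LinearMap.mulLeft k (s : A.carrier) ∘ₗ LinearMap.snd k A.carrier A.carrier).prod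
    (LinearMap.mulLeft k (Φ.natMap s : A.carrier) ∘ₗ LinearMap.fst k A.carrier A.carrier)

theorem clifford_apply (s : A.skew) (z : A.carrier × A.carrier) :
    Φ.clifford s z = ((s : A.carrier) * z.2, (Φ.natMap s : A.carrier) * z.1) := rfl

variable [FiniteDimensional k A.carrier] (hk2 : (2 : k) ≠ 0) (hk3 : (3 : k) ≠ 0)
include hk2

theorem exists_basis_clifford (hQ : Φ.Q.Anisotropic) :
    ∃ e : Basis (Fin (finrank k A.skew)) k A.skew,
      (∀ v : Fin (finrank k A.skew) → k, ∑ i, -Φ.Q (e i) * v i * v i = 0 → v = 0) ∧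
      (∀ i j, i ≠ j → Φ.clifford (e i) * Φ.clifford (e j) =
        -(Φ.clifford (e j) * Φ.clifford (e i))) ∧
      ∀ i, Φ.clifford (e i) * Φ.clifford (e i) = (-Φ.Q (e i)) • 1 := by
  have : Invertible (2 : k) := invertibleOfNonzero hk2
  obtain ⟨e, he⟩ := LinearMap.BilinForm.exists_orthogonal_basis
    (QuadraticForm.associated_isSymm k Φ.Q)
  refine ⟨e, fun v hv => ?_, fun i j hij => ?_, fun i => ?_⟩
  · have h0 : Φ.Q (∑ i, v i • e i) = 0 := by
      rw [← QuadraticMap.basisRepr_apply, QuadraticMap.basisRepr_eq_of_iIsOrtho _ _ he,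
        QuadraticMap.weightedSumSquares_apply, ← neg_eq_zero, ← Finset.sum_neg_distrib, ← hv]
      exact Finset.sum_congr rfl fun i _ => by simp only [smul_eq_mul]; ring
    have h1 := hQ _ h0
    funext i
    exact Fintype.linearIndependent_iff.1 e.linearIndependent v h1 i
  · have hp : QuadraticMap.polar Φ.Q (e i) (e j) = 0 := by
      have := he hij
      rw [Function.onFun, QuadraticMap.associated_apply] at this
      simpa [QuadraticMap.polar, hk2] using this
    rw [eq_neg_iff_add_eq_zero]
    refine LinearMap.ext fun z => ?_
    refine Prod.ext ?_ ?_
    · change (e i : A.carrier) * ((Φ.natMap (e j) : A.carrier) * z.1) +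
        (e j : A.carrier) * ((Φ.natMap (e i) : A.carrier) * z.1) = 0
      rw [mul_natMap_add, hp, neg_zero, zero_smul]
    · change (Φ.natMap (e i) : A.carrier) * ((e j : A.carrier) * z.2) +
        (Φ.natMap (e j) : A.carrier) * ((e i : A.carrier) * z.2) = 0
      rw [Φ.natMap_mul_add hQ, hp, neg_zero, zero_smul]
  · refine LinearMap.ext fun z => ?_
    exact Prod.ext (Φ.mul_natMap (e i) z.1) (Φ.natMap_mul hQ (e i) z.2)

include hk3

theorem exists_functional (hQ : Φ.Q.Anisotropic) (r : ℕ) (hr : 2 * r ≤ finrank k A.skew)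
    (hdim : 2 * finrank k A.carrier ≤ 4 * 2 ^ r) (N : Submodule k A.carrier)
    (hN : ∀ b ∈ N, (∀ (s : A.skew) (a : A.carrier), (s : A.carrier) * (a * b) = s * a * b) ∧
      ∃ β : k, (β = 0 ∨ ¬ IsSquare β) ∧ ∀ a, a * b * b = β • a)
    {x : A.carrier} (hx : x ≠ 0) :
    ∃ f : A.carrier →ₗ[k] k, f x = 1 ∧
      (∀ s t : A.skew, f (s * ((Φ.natMap t : A.carrier) * x)) =
        f (t * ((Φ.natMap s : A.carrier) * x))) ∧
      ∀ b ∈ N, f (x * b) = 0 := by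
  obtain ⟨e, hq, hg, hsq⟩ := Φ.exists_basis_clifford hk2 hQ
  let W : Submodule k A.carrier := Submodule.span k (Set.range fun p : A.skew × A.skew =>
    (p.1 : A.carrier) * ((Φ.natMap p.2 : A.carrier) * x) - p.2 * ((Φ.natMap p.1 : A.carrier) * x))
  have hW : ∀ w ∈ W, ∃ c : Fin (finrank k A.skew) → Fin (finrank k A.skew) → k,
      (∀ i, c i i = 0) ∧
      w = ∑ i, ∑ j, c i j • ((e i : A.carrier) * ((Φ.natMap (e j) : A.carrier) * x)) := by
    intro w hw
    induction hw using Submodule.span_induction with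
    | mem w h =>
      obtain ⟨⟨s, t⟩, rfl⟩ := h
      refine ⟨fun i j => e.repr s i * e.repr t j - e.repr t i * e.repr s j,
        fun i => by ring, ?_⟩
      have hst : ∀ s t : A.skew, (s : A.carrier) * ((Φ.natMap t : A.carrier) * x) =
          ∑ i, ∑ j, (e.repr s i * e.repr t j) •
            ((e i : A.carrier) * ((Φ.natMap (e j) : A.carrier) * x)) := by
        intro s t
        have hs : (s : A.carrier) = ∑ i, e.repr s i • (e i : A.carrier) := by
          simpa [-Basis.sum_repr] using (congrArg (Submodule.subtype _) (e.sum_repr s)).symm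
        have ht : (Φ.natMap t : A.carrier) = ∑ j, e.repr t j • (Φ.natMap (e j) : A.carrier) := by
          simpa [-Basis.sum_repr] using
            (congrArg (fun t => (Φ.natMap t : A.carrier)) (e.sum_repr t)).symm
        rw [hs, ht, Finset.sum_mul]
        refine Finset.sum_congr rfl fun i _ => ?_
        rw [Finset.sum_mul, Finset.mul_sum]
        refine Finset.sum_congr rfl fun j _ => ?_
        rw [smul_mul_assoc, smul_mul_assoc, mul_smul_comm, smul_smul]
      beta_reduce
      rw [hst s t, hst t s]
      simp only [sub_smul, Finset.sum_sub_distrib]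
    | zero => exact ⟨0, by simp, by simp⟩
    | add w w' _ _ h h' =>
      obtain ⟨c, hc, rfl⟩ := h
      obtain ⟨c', hc', rfl⟩ := h'
      exact ⟨c + c', fun i => by simp [hc, hc'], by
        simp only [Pi.add_apply, add_smul, Finset.sum_add_distrib]⟩
    | smul l w _ h =>
      obtain ⟨c, hc, rfl⟩ := h
      exact ⟨l • c, fun i => by simp [hc], by
        simp only [Pi.smul_apply, smul_eq_mul, mul_smul, Finset.smul_sum]⟩
  have hxW : x ∉ W ⊔ N.map (LinearMap.mulLeft k x) := by
    intro hmem
    obtain ⟨w, hw, _, ⟨b, hb, rfl⟩, hsum⟩ := Submodule.mem_sup.1 hmem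
    obtain ⟨c, hc, rfl⟩ := hW w hw
    obtain ⟨hb, β, hβ, hbb⟩ := hN b hb
    have := eq_zero_of_clifford_fixed hk2 hk3 _ hq (fun i => Φ.clifford (e i)) hg hsq c hc
      ((LinearMap.mulRight k b).prodMap (LinearMap.mulRight k b))
      (fun i => by
        refine LinearMap.ext fun z => ?_
        exact Prod.ext (hb (e i) z.2).symm (hb (Φ.natMap (e i)) z.1).symm)
      β (LinearMap.ext fun z => Prod.ext (hbb z.1) (hbb z.2)) hβ r (by simpa using hr)
      (by rw [finrank_prod]; omega) (x, 0) (by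
        rw [LinearMap.mulLeft_apply] at hsum
        refine Prod.ext ?_ ?_
        · simp only [LinearMap.sum_apply, LinearMap.smul_apply, Module.End.mul_apply,
            clifford_apply, Prod.fst_add, Prod.fst_sum, Prod.smul_fst, LinearMap.prodMap_apply,
            LinearMap.mulRight_apply]
          exact hsum
        · simp only [LinearMap.sum_apply, LinearMap.smul_apply, Module.End.mul_apply,
            clifford_apply, Prod.snd_add, Prod.snd_sum, Prod.smul_snd, LinearMap.prodMap_apply,
            LinearMap.mulRight_apply, mul_zero, zero_mul, smul_zero, Finset.sum_const_zero,
            add_zero])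
    exact hx (congrArg Prod.fst this)
  obtain ⟨f, hfx, hf⟩ := Submodule.exists_dual_map_eq_bot_of_notMem hxW inferInstance
  have hf0 : ∀ w ∈ W ⊔ N.map (LinearMap.mulLeft k x), f w = 0 := fun w hw =>
    (Submodule.mem_bot k).1 (hf ▸ Submodule.mem_map_of_mem hw)
  refine ⟨(f x)⁻¹ • f, by simp [hfx], fun s t => ?_, fun b hb => ?_⟩
  · have := hf0 _ (Submodule.mem_sup_left (Submodule.subset_span ⟨(s, t), rfl⟩))
    rw [map_sub, sub_eq_zero] at this
    rw [LinearMap.smul_apply, LinearMap.smul_apply, this]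
  · rw [LinearMap.smul_apply, ← LinearMap.mulLeft_apply (R := k),
      hf0 _ (Submodule.mem_sup_right (Submodule.mem_map_of_mem hb)), smul_zero]

end AlbertForm

end

section

open Module

theorem two_ne_zero_of_algebra (k K : Type*) [Field k] [Field K] [Algebra k K]
    (h : (2 : k) ≠ 0) : (2 : K) ≠ 0 := by
  rw [← map_ofNat (algebraMap k K) 2, Ne, FaithfulSMul.algebraMap_eq_zero_iff]
  exact h

namespace CompositionAlgebra

section Basic

variable {F : Type u} [Field F] (C : CompositionAlgebra F)

/-- The polar form of the norm. -/
def bilin : LinearMap.BilinForm F C.carrier := C.norm.polarBilin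

theorem bilin_apply (x y : C.carrier) :
    C.bilin x y = C.norm (x + y) - C.norm x - C.norm y := rfl

theorem bilin_comm (x y : C.carrier) : C.bilin x y = C.bilin y x :=
  QuadraticMap.polar_comm _ _ _

theorem bilin_self (x : C.carrier) : C.bilin x x = 2 * C.norm x :=
  (QuadraticMap.polar_self C.norm x).trans (two_nsmul _ |>.trans (two_mul _).symm)

theorem bilin_nondegenerate {x : C.carrier} (h : ∀ y, C.bilin x y = 0) : x = 0 :=
  C.nondegenerate x h

theorem eq_of_bilin_eq {x y : C.carrier} (h : ∀ z, C.bilin x z = C.bilin y z) : x = y :=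
  sub_eq_zero.1 (C.bilin_nondegenerate fun z => by
    rw [map_sub, LinearMap.sub_apply, h, sub_self])

theorem conj_eq (x : C.carrier) : C.conj x = C.bilin x 1 • (1 : C.carrier) - x := C.conj_def x

theorem bilin_one_one : C.bilin 1 1 = 2 := by rw [bilin_self, C.norm_one, mul_one]

theorem norm_add (x y : C.carrier) : C.norm (x + y) = C.norm x + C.norm y + C.bilin x y := by
  rw [bilin_apply]; ring

theorem bilin_mul_mul_right (x y a : C.carrier) :
    C.bilin (x * a) (y * a) = C.bilin x y * C.norm a := by
  simp only [bilin_apply, ← add_mul, C.norm_mul]; ring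

theorem bilin_mul_mul_left (a x y : C.carrier) :
    C.bilin (a * x) (a * y) = C.norm a * C.bilin x y := by
  simp only [bilin_apply, ← mul_add, C.norm_mul]; ring

theorem bilin_mul_mul_add (a c x y : C.carrier) :
    C.bilin (a * x) (c * y) + C.bilin (c * x) (a * y) = C.bilin a c * C.bilin x y := by
  have h := C.bilin_mul_mul_left (a + c) x y
  rw [C.norm_add, add_mul, add_mul, map_add, map_add, LinearMap.add_apply, LinearMap.add_apply,
    C.bilin_mul_mul_left, C.bilin_mul_mul_left] at h
  linear_combination h

theorem bilin_mul_left (a x y : C.carrier) : C.bilin (a * x) y = C.bilin x (C.conj a * y) := by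
  have h := C.bilin_mul_mul_add a 1 x y
  rw [C.conj_eq, sub_mul, smul_mul_assoc, one_mul, map_sub, map_smul, smul_eq_mul]
  rw [one_mul, one_mul] at h
  linear_combination h

theorem bilin_mul_right (x a y : C.carrier) : C.bilin (x * a) y = C.bilin x (y * C.conj a) := by
  have h := C.bilin_mul_mul_add x y a 1
  rw [C.conj_eq, mul_sub, mul_smul_comm, mul_one, map_sub, map_smul, smul_eq_mul]
  rw [mul_one, mul_one, C.bilin_comm (y * a)] at h
  rw [C.bilin_comm x (y * a)]
  rw [C.bilin_comm x (y * a)] at h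
  linear_combination h

theorem conj_mul_self_mul (a x : C.carrier) : C.conj a * (a * x) = C.norm a • x := by
  refine C.eq_of_bilin_eq fun z => ?_
  rw [C.bilin_mul_left, C.conj_conj, C.bilin_mul_mul_left, map_smul, LinearMap.smul_apply,
    smul_eq_mul]

theorem mul_self_mul_conj (x a : C.carrier) : x * a * C.conj a = C.norm a • x := by
  refine C.eq_of_bilin_eq fun z => ?_
  rw [C.bilin_mul_right, C.conj_conj, C.bilin_mul_mul_right, map_smul, LinearMap.smul_apply,
    smul_eq_mul, mul_comm]

theorem conj_mul_add (a c x : C.carrier) :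
    C.conj a * (c * x) + C.conj c * (a * x) = C.bilin a c • x := by
  have h := C.conj_mul_self_mul (a + c) x
  rw [map_add, add_mul, add_mul, mul_add, mul_add, C.norm_add, C.conj_mul_self_mul,
    C.conj_mul_self_mul, add_smul, add_smul] at h
  linear_combination (norm := abel) h

theorem mul_conj_add (x a c : C.carrier) :
    x * a * C.conj c + x * c * C.conj a = C.bilin a c • x := by
  have h := C.mul_self_mul_conj x (a + c)
  rw [map_add, mul_add, mul_add, add_mul, add_mul, C.norm_add, C.mul_self_mul_conj,
    C.mul_self_mul_conj, add_smul, add_smul] at h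
  linear_combination (norm := abel) h

theorem conj_mul_self (a : C.carrier) : C.conj a * a = C.norm a • (1 : C.carrier) := by
  simpa using C.conj_mul_self_mul a 1

theorem mul_self (a : C.carrier) :
    a * a = C.bilin a 1 • a - C.norm a • (1 : C.carrier) := by
  have h := C.conj_mul_self a
  rw [C.conj_eq, sub_mul, smul_mul_assoc, one_mul] at h
  rw [← h]; abel

theorem mul_mul_self_left (a x : C.carrier) : a * a * x = a * (a * x) := by
  have h := C.conj_mul_self_mul a x
  rw [C.conj_eq, sub_mul, smul_mul_assoc, one_mul] at h
  rw [C.mul_self, sub_mul, smul_mul_assoc, smul_mul_assoc, one_mul, ← h]; abel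

theorem mul_mul_self_right (x a : C.carrier) : x * a * a = x * (a * a) := by
  have h := C.mul_self_mul_conj x a
  rw [C.conj_eq, mul_sub, mul_smul_comm, mul_one] at h
  rw [C.mul_self, mul_sub, mul_smul_comm, mul_smul_comm, mul_one, ← h]; abel

theorem associator_swap_left (x y z : C.carrier) : associator y x z = -associator x y z := by
  have h := C.mul_mul_self_left (x + y) z
  have hx := C.mul_mul_self_left x z
  have hy := C.mul_mul_self_left y z
  simp only [add_mul, mul_add] at h
  simp only [associator_apply]
  linear_combination (norm := abel) h - hx - hy

theorem associator_swap_right (x y z : C.carrier) : associator x z y = -associator x y z := by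
  have h := C.mul_mul_self_right x (y + z)
  have hy := C.mul_mul_self_right x y
  have hz := C.mul_mul_self_right x z
  simp only [add_mul, mul_add] at h
  simp only [associator_apply]
  linear_combination (norm := abel) h - hy - hz

theorem associator_cycle (x y z : C.carrier) : associator y z x = associator x y z := by
  rw [C.associator_swap_right, C.associator_swap_left, neg_neg]

theorem associator_reverse (x y z : C.carrier) : associator z y x = -associator x y z := by
  rw [C.associator_swap_left y z x, C.associator_cycle]

theorem associator_mul_cycle (x y z t : C.carrier) :
    associator (x * y) z t + associator (y * z) x t + associator (z * t) x y
      - x * associator y z t - associator x y z * t = 0 := by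
  have h := associator_cocycle x y z t
  rw [← C.associator_cycle x y (z * t), ← C.associator_cycle y (z * t) x] at h
  rw [C.associator_swap_left (y * z) x t] at h
  linear_combination (norm := abel) -h

theorem associator_mul_middle (a s v w : C.carrier) :
    associator s (a * w) v + associator s v w * a + associator s (v * w) a
      - associator s w a * v = 0 := by
  have h1 := C.associator_mul_cycle a w v s
  have h2 := C.associator_mul_cycle a v w s
  have h3 := C.associator_mul_cycle w s a v
  have h4 := C.associator_mul_cycle w v s a
  simp only [
    C.associator_swap_right a v w,
    C.associator_swap_right (a * v) s w,
    C.associator_swap_right (a * w) s v,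
    C.associator_swap_left a s v,
    C.associator_swap_left (a * w) s v,
    (C.associator_cycle s (v * w) a).symm,
    C.associator_cycle a s w,
    C.associator_swap_right (s * a) v w,
    C.associator_reverse a s v,
    C.associator_cycle s v w,
    C.associator_swap_right (v * s) a w,
    C.associator_reverse a s w,
    C.associator_reverse s v w,
    C.associator_swap_right (w * v) a s, neg_mul, mul_neg] at *
  linear_combination (norm := abel) h1 + h2 - h3 + h4

theorem bilin_associator_one (x y z : C.carrier) : C.bilin (associator x y z) 1 = 0 := by
  rw [associator_apply, map_sub, LinearMap.sub_apply, C.bilin_mul_right, C.bilin_mul_right,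
    C.bilin_mul_right x (y * z), C.conj_mul]
  simp

theorem bilin_mul_comm_one (x y : C.carrier) : C.bilin (x * y) 1 = C.bilin (y * x) 1 := by
  rw [C.bilin_mul_right, C.bilin_mul_left, one_mul, mul_one]

theorem conj_eq_neg_iff (h2 : (2 : F) ≠ 0) (x : C.carrier) : C.conj x = -x ↔ C.bilin x 1 = 0 := by
  have h10 : (1 : C.carrier) ≠ 0 := fun h => by
    have := C.bilin_one_one
    rw [h, map_zero] at this
    exact h2 this.symm
  rw [C.conj_eq, sub_eq_neg_self, smul_eq_zero]
  simp [h10]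

theorem bilin_conj_left (x y : C.carrier) : C.bilin (C.conj x) y = C.bilin x (C.conj y) := by
  rw [C.conj_eq, C.conj_eq, map_sub, map_sub, LinearMap.sub_apply, map_smul, map_smul,
    LinearMap.smul_apply, smul_eq_mul, smul_eq_mul, C.bilin_comm 1 y, mul_comm]

theorem mul_self_of_skew {a : C.carrier} (ha : C.conj a = -a) (x : C.carrier) :
    a * (a * x) = -C.norm a • x := by
  have := C.conj_mul_self_mul a x
  rw [ha, neg_mul] at this
  rw [neg_smul, ← this, neg_neg]

theorem mul_add_mul_of_skew {a c : C.carrier} (ha : C.conj a = -a) (hc : C.conj c = -c)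
    (x : C.carrier) : a * (c * x) + c * (a * x) = -C.bilin a c • x := by
  have := C.conj_mul_add a c x
  rw [ha, hc, neg_mul, neg_mul] at this
  rw [neg_smul, ← this]; abel

theorem eq_zero_of_mul_eq_zero {a x : C.carrier} (ha : C.norm a ≠ 0) (h : a * x = 0) : x = 0 := by
  have := C.conj_mul_self_mul a x
  rw [h, mul_zero] at this
  exact (smul_eq_zero.1 this.symm).resolve_left ha

/-- Four times the derivation-like operator attached to `a` and `c` in the decomposition of
`V_{x,y}` on a tensor product of composition algebras. -/
def delta (a c : C.carrier) : C.carrier →ₗ[F] C.carrier where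
  toFun v := (2 : F) • (a * C.conj c * v) + (4 : F) • (v * C.conj c * a)
    - (3 * C.bilin a c) • v
  map_add' v w := by simp only [mul_add, add_mul]; module
  map_smul' r v := by simp only [mul_smul_comm, smul_mul_assoc, RingHom.id_apply]; module

theorem delta_apply (a c v : C.carrier) : C.delta a c v =
    (2 : F) • (a * C.conj c * v) + (4 : F) • (v * C.conj c * a) - (3 * C.bilin a c) • v := rfl

theorem delta_mul (a c s v : C.carrier) :
    C.delta a c (s * v) - s * C.delta a c v = (C.delta a c s - s * C.delta a c 1) * v := by
  have h := congrArg (fun z => (4 : F) • z) (C.associator_mul_middle a s v (C.conj c))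
  simp only [associator_apply, smul_zero] at h
  have h2 := congrArg (fun z => (2 : F) • z) (C.associator_swap_left s (a * C.conj c) v)
  simp only [associator_apply] at h2
  simp only [delta_apply, mul_sub, mul_add, sub_mul, add_mul, smul_mul_assoc, mul_smul_comm,
    mul_one, one_mul] at *
  linear_combination (norm := module) h - h2

theorem bilin_delta_one_one (a c : C.carrier) : C.bilin (C.delta a c 1) 1 = 0 := by
  rw [delta_apply, one_mul, mul_one, map_sub, map_add, map_smul, map_smul, map_smul,
    LinearMap.sub_apply, LinearMap.add_apply, LinearMap.smul_apply, LinearMap.smul_apply,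
    LinearMap.smul_apply, C.bilin_mul_comm_one (C.conj c), C.bilin_mul_right, C.conj_conj, one_mul,
    bilin_one_one]
  simp only [smul_eq_mul]
  ring

theorem bilin_delta_one {b : C.carrier} (hb : C.conj b = -b) (hb1 : C.bilin b 1 = 0)
    (a c : C.carrier) :
    C.bilin (C.delta a c 1) b = -2 * C.bilin (b * a) c - 4 * C.bilin (a * b) c := by
  rw [delta_apply, one_mul, mul_one, map_sub, map_add, map_smul, map_smul, map_smul,
    LinearMap.sub_apply, LinearMap.add_apply, LinearMap.smul_apply, LinearMap.smul_apply,
    LinearMap.smul_apply, C.bilin_mul_right, C.conj_conj, C.bilin_mul_left (C.conj c),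
    C.conj_conj, C.bilin_comm 1 b, hb1, C.bilin_mul_left b, C.bilin_mul_right a b, hb]
  simp only [smul_eq_mul, neg_mul, mul_neg, map_neg]
  ring

theorem bilin_delta_sub {s t : C.carrier} (hs : C.conj s = -s) (ht : C.conj t = -t)
    (a c : C.carrier) :
    C.bilin (C.delta a c s - s * C.delta a c 1) t
      = -2 * C.bilin (s * (t * a) - t * (s * a)) c := by
  have h1 : C.bilin (a * C.conj c * s) t = -C.bilin (s * t * a) c := by
    rw [C.bilin_mul_right, C.bilin_mul_right, C.conj_conj, C.bilin_mul_left, C.conj_mul, hs, ht]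
    simp
  have h2 : C.bilin (s * (a * C.conj c)) t = -C.bilin (t * s * a) c := by
    rw [C.bilin_mul_left, C.bilin_mul_right, C.conj_conj, C.bilin_mul_left, C.conj_mul, hs, ht]
    simp
  have h3 : C.bilin (s * C.conj c * a) t = -C.bilin (a * t * s) c := by
    rw [C.bilin_mul_right, C.bilin_mul_left, C.bilin_conj_left, C.bilin_comm, C.conj_mul,
      C.conj_mul, C.conj_conj, C.conj_conj, ht, mul_neg, neg_mul, map_neg, LinearMap.neg_apply]
  have h4 : C.bilin (s * (C.conj c * a)) t = -C.bilin (a * (t * s)) c := by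
    rw [C.bilin_mul_left, C.bilin_mul_right, C.bilin_conj_left, C.bilin_comm, C.conj_mul,
      C.conj_mul, C.conj_conj, C.conj_conj, ht, neg_mul, mul_neg, map_neg, LinearMap.neg_apply]
  have h5 : a * t * s - a * (t * s) = -(s * t * a - s * (t * a)) :=
    C.associator_reverse s t a
  have h6 : t * s * a - t * (s * a) = -(s * t * a - s * (t * a)) :=
    C.associator_swap_left s t a
  have h5' := congrArg (fun z => C.bilin z c) h5
  have h6' := congrArg (fun z => C.bilin z c) h6
  simp only [map_sub, map_neg, LinearMap.sub_apply, LinearMap.neg_apply] at h5' h6'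
  simp only [delta_apply, one_mul, mul_one, mul_sub, mul_add, mul_smul_comm, map_sub, map_add,
    map_smul, LinearMap.sub_apply, LinearMap.add_apply, LinearMap.smul_apply, h1, h2, h3, h4,
    smul_eq_mul]
  linear_combination (-4) * h5' + 2 * h6'

end Basic

end CompositionAlgebra

namespace CompositionAlgebra

section Dimension

variable {F : Type u} [Field F] (C : CompositionAlgebra F)

theorem bilin_isRefl : C.bilin.IsRefl := fun x y h => by rw [C.bilin_comm, h]

theorem bilin_form_nondegenerate : C.bilin.Nondegenerate :=
  C.bilin_isRefl.nondegenerate_iff_separatingLeft.2 fun _ h => C.bilin_nondegenerate h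

theorem exists_orthogonal_norm_ne_zero (W : Submodule F C.carrier) (h1 : 1 ∈ W)
    (hW : 2 * finrank F W ≤ finrank F C.carrier) :
    ∃ b, C.norm b ≠ 0 ∧ ∀ w ∈ W, C.bilin b w = 0 := by
  by_contra! h
  have h0 : ∀ b ∈ C.bilin.orthogonal W, C.norm b = 0 := fun b hb => by
    by_contra hb0
    obtain ⟨w, hw, hbw⟩ := h b hb0
    exact hbw (by rw [C.bilin_comm]; exact hb w hw)
  have hle : C.bilin.orthogonal W ≤ W := by
    intro b hb
    rw [← LinearMap.BilinForm.orthogonal_orthogonal C.bilin_form_nondegenerate C.bilin_isRefl W]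
    intro c hc
    change C.bilin c b = 0
    rw [C.bilin_apply, h0 _ (add_mem hc hb), h0 _ hb, h0 _ hc]
    simp
  have heq := Submodule.eq_of_le_of_finrank_le hle (by
    rw [LinearMap.BilinForm.finrank_orthogonal C.bilin_form_nondegenerate]; omega)
  have := h0 1 (by rw [heq]; exact h1)
  rw [C.norm_one] at this
  exact one_ne_zero this

theorem anticomm_of_orthogonal {x y : C.carrier} (hx : C.conj x = -x) (hy : C.conj y = -y)
    (hxy : C.bilin x y = 0) : x * y = -(y * x) := by
  have := C.mul_add_mul_of_skew hx hy 1
  rw [hxy, neg_zero, zero_smul, mul_one, mul_one] at this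
  exact eq_neg_of_add_eq_zero_left this

theorem finrank_span_finset_le {V : Type*} [AddCommGroup V] [Module F V] (l : List V) :
    finrank F (Submodule.span F {x | x ∈ l}) ≤ l.length := by
  classical
  have h := finrank_span_finset_le_card (R := F) l.toFinset
  have h2 : ((l.toFinset : Finset V) : Set V) = {x | x ∈ l} := by ext; simp
  rw [h2] at h
  exact h.trans l.toFinset_card_le

theorem exists_orthogonal_list (l : List C.carrier) (hl : 2 * (l.length + 1) ≤ finrank F C.carrier) :
    ∃ b, C.norm b ≠ 0 ∧ C.bilin b 1 = 0 ∧ ∀ w ∈ l, C.bilin b w = 0 := by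
  obtain ⟨b, hb, hbW⟩ := C.exists_orthogonal_norm_ne_zero (Submodule.span F {x | x ∈ 1 :: l})
    (Submodule.subset_span (by simp))
    (le_trans (Nat.mul_le_mul_left 2 (finrank_span_finset_le (1 :: l))) (by simpa using hl))
  exact ⟨b, hb, hbW 1 (Submodule.subset_span (by simp)),
    fun w hw => hbW w (Submodule.subset_span (by simp [hw]))⟩

variable (h2 : (2 : F) ≠ 0)
include h2

theorem eq_zero_of_skew_of_commute {u : C.carrier} (h4 : 4 ≤ finrank F C.carrier)
    (hu : C.conj u = -u) (hc : ∀ x, C.conj x = -x → x * u = u * x) : u = 0 := by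
  obtain ⟨b, hb, hb1, hbu⟩ := C.exists_orthogonal_list [u] (by simpa using h4)
  have hb1 := (C.conj_eq_neg_iff h2 b).2 hb1
  have h := C.anticomm_of_orthogonal hb1 hu (hbu u (by simp))
  rw [← hc b hb1, eq_neg_iff_add_eq_zero, ← two_smul F, smul_eq_zero] at h
  exact C.eq_zero_of_mul_eq_zero hb (h.resolve_left h2)

theorem eq_zero_of_skew_of_nucleus {u : C.carrier} (h8 : 8 ≤ finrank F C.carrier)
    (hu : C.conj u = -u) (hn : ∀ s t, s * t * u = s * (t * u)) : u = 0 := by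
  obtain ⟨a, ha, ha1, hau⟩ := C.exists_orthogonal_list [u] (by simp; omega)
  have ha1 := (C.conj_eq_neg_iff h2 a).2 ha1
  obtain ⟨b, hb, hb1, hbl⟩ := C.exists_orthogonal_list [u, a, a * u] (by simpa using h8)
  have hb1 := (C.conj_eq_neg_iff h2 b).2 hb1
  have hau' : C.conj (a * u) = -(a * u) := by
    rw [C.conj_mul, ha1, hu, neg_mul_neg, C.anticomm_of_orthogonal hu ha1
      (by rw [C.bilin_comm]; exact hau u (by simp))]
  have h1 := C.mul_conj_add a b u
  rw [hbl u (by simp), zero_smul, hu, hb1, mul_neg, mul_neg, ← neg_add, neg_eq_zero] at h1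
  have h3 := C.anticomm_of_orthogonal hb1 hau' (hbl (a * u) (by simp))
  have h4 := C.mul_add_mul_of_skew hb1 ha1 u
  rw [hbl a (by simp), neg_zero, zero_smul] at h4
  have h5 := hn a b
  have h6 : (2 : F) • (a * (b * u)) = 0 := by
    rw [two_smul]
    linear_combination (norm := abel) h1 - h5 + h4 - h3
  exact C.eq_zero_of_mul_eq_zero hb (C.eq_zero_of_mul_eq_zero ha ((smul_eq_zero.1 h6).resolve_left h2))

theorem eq_zero_of_finrank_le_one {b : C.carrier} (h1 : finrank F C.carrier ≤ 1)
    (hb : C.conj b = -b) : b = 0 := by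
  have hd : ¬ LinearIndependent F ![1, b] := fun h => by
    have := h.fintype_card_le_finrank
    simp at this; omega
  obtain ⟨g, hg, i, hi⟩ := Fintype.not_linearIndependent_iff.1 hd
  simp only [Fin.sum_univ_two, Matrix.cons_val_zero, Matrix.cons_val_one] at hg
  have h3 := congrArg (fun z => C.bilin z 1) hg
  simp only [map_add, map_smul, LinearMap.add_apply, LinearMap.smul_apply, C.bilin_one_one,
    (C.conj_eq_neg_iff h2 b).1 hb, map_zero, LinearMap.zero_apply, smul_eq_mul, mul_zero, add_zero] at h3
  have h0 : g 0 = 0 := (mul_eq_zero.1 h3).resolve_right h2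
  rw [h0, zero_smul, zero_add, smul_eq_zero] at hg
  refine hg.resolve_left fun h => hi ?_
  fin_cases i
  · exact h0
  · exact h

omit h2 in
theorem one_ne_zero' : (1 : C.carrier) ≠ 0 := fun h => by
  have := C.norm_one
  rw [h, QuadraticMap.map_zero] at this
  exact zero_ne_one this

omit h2 in
theorem mul_comm_of_finrank_le_two (h2 : finrank F C.carrier ≤ 2) (x y : C.carrier) :
    x * y = y * x := by
  have hd : ¬ LinearIndependent F ![1, x, y] := fun h => by
    have := h.fintype_card_le_finrank
    simp at this; omega
  obtain ⟨g, hg, i, hi⟩ := Fintype.not_linearIndependent_iff.1 hd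
  simp only [Fin.sum_univ_three, Matrix.cons_val_zero, Matrix.cons_val_one, Matrix.cons_val] at hg
  by_contra hne
  have hne := sub_ne_zero.2 hne
  have e1 := congrArg (fun z => z * y - y * z) hg
  have e2 := congrArg (fun z => x * z - z * x) hg
  simp only [mul_add, add_mul, smul_mul_assoc, mul_smul_comm, one_mul, mul_one, zero_mul,
    mul_zero, sub_zero] at e1 e2
  have h1 : g 1 • (x * y - y * x) = 0 := by linear_combination (norm := module) e1
  have h2 : g 2 • (x * y - y * x) = 0 := by linear_combination (norm := module) e2
  have h1 := (smul_eq_zero.1 h1).resolve_right hne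
  have h2 := (smul_eq_zero.1 h2).resolve_right hne
  rw [h1, h2, zero_smul, zero_smul, add_zero, add_zero, smul_eq_zero] at hg
  have h0 := hg.resolve_right C.one_ne_zero'
  fin_cases i
  · exact hi h0
  · exact hi h1
  · exact hi h2

omit h2 in
theorem bilin_associator_self (x y z : C.carrier) : C.bilin (associator x y z) z = 0 := by
  have h := C.bilin_mul_mul_right (x * y) 1 z
  rw [one_mul] at h
  rw [associator_apply, map_sub, LinearMap.sub_apply, h, C.bilin_mul_left x, C.bilin_mul_left x,
    C.bilin_mul_mul_right, mul_one, sub_self]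

omit h2 in
theorem mul_assoc_of_finrank_le_four (h4 : finrank F C.carrier ≤ 4) (x y z : C.carrier) :
    x * y * z = x * (y * z) := by
  rw [← sub_eq_zero]
  change associator x y z = 0
  by_cases hd : LinearIndependent F ![1, x, y, z]
  · have hs := hd.span_eq_top_of_card_eq_finrank' (by
      have := hd.fintype_card_le_finrank
      simp at this ⊢; omega)
    refine C.bilin_nondegenerate fun w => ?_
    have hw : w ∈ Submodule.span F (Set.range ![1, x, y, z]) := hs ▸ Submodule.mem_top
    induction hw using Submodule.span_induction with
    | mem w hw =>
      obtain ⟨i, rfl⟩ := hw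
      fin_cases i
      · exact C.bilin_associator_one x y z
      · rw [← C.associator_cycle]; exact C.bilin_associator_self _ _ _
      · rw [← C.associator_cycle, ← C.associator_cycle]; exact C.bilin_associator_self _ _ _
      · exact C.bilin_associator_self _ _ _
    | zero => simp
    | add a b _ _ ha hb => rw [map_add, ha, hb, add_zero]
    | smul c a _ ha => rw [map_smul, ha, smul_zero]
  obtain ⟨g, hg, i, hi⟩ := Fintype.not_linearIndependent_iff.1 hd
  simp only [Fin.sum_univ_four, Matrix.cons_val_zero, Matrix.cons_val_one, Matrix.cons_val] at hg
  by_contra hne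
  have hr : ∀ u v : C.carrier, associator u v u = 0 := fun u v => by
    rw [C.associator_swap_left, associator_apply, C.mul_mul_self_right, sub_self, neg_zero]
  simp only [associator_apply] at hr hne
  have e1 := congrArg (fun w => w * y * z - w * (y * z)) hg
  have e2 := congrArg (fun w => x * w * z - x * (w * z)) hg
  have e3 := congrArg (fun w => x * y * w - x * (y * w)) hg
  simp only [mul_add, add_mul, smul_mul_assoc, mul_smul_comm, one_mul, mul_one, zero_mul,
    mul_zero, sub_zero] at e1 e2 e3
  have h1 : g 1 • (x * y * z - x * (y * z)) = 0 := by
    linear_combination (norm := module) e1 - g 2 • C.mul_mul_self_left y z - g 3 • hr z y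
  have h2 : g 2 • (x * y * z - x * (y * z)) = 0 := by
    linear_combination (norm := module) e2 - g 1 • C.mul_mul_self_left x z
      - g 3 • C.mul_mul_self_right x z
  have h3 : g 3 • (x * y * z - x * (y * z)) = 0 := by
    linear_combination (norm := module) e3 - g 1 • hr x y - g 2 • C.mul_mul_self_right x y
  have h1 := (smul_eq_zero.1 h1).resolve_right hne
  have h2 := (smul_eq_zero.1 h2).resolve_right hne
  have h3 := (smul_eq_zero.1 h3).resolve_right hne
  rw [h1, h2, h3, zero_smul, zero_smul, zero_smul, add_zero, add_zero, add_zero,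
    smul_eq_zero] at hg
  have h0 := hg.resolve_right C.one_ne_zero'
  fin_cases i
  · exact hi h0
  · exact hi h1
  · exact hi h2
  · exact hi h3

end Dimension

end CompositionAlgebra

namespace CompositionAlgebra

section Tensor

variable {F : Type u} [Field F] (C C₁ C₂ : CompositionAlgebra F)

theorem tmul_induction₂ {C₁ C₂ : CompositionAlgebra F}
    {P : C₁.carrier ⊗[F] C₂.carrier → C₁.carrier ⊗[F] C₂.carrier → Prop}
    (zero_left : ∀ y, P 0 y) (zero_right : ∀ x, P x 0)
    (tmul : ∀ a b c d, P (a ⊗ₜ b) (c ⊗ₜ d))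
    (add_left : ∀ x x' y, P x y → P x' y → P (x + x') y)
    (add_right : ∀ x y y', P x y → P x y' → P x (y + y')) (x y) : P x y := by
  induction x with
  | zero => exact zero_left y
  | add x x' hx hx' => exact add_left x x' y hx hx'
  | tmul a b =>
    induction y with
    | zero => exact zero_right _
    | add y y' hy hy' => exact add_right _ y y' hy hy'
    | tmul c d => exact tmul a b c d

/-- The form on `C₁ ⊗ C₂` induced by the polar forms of the two norms. -/
noncomputable def tau : LinearMap.BilinForm F (C₁.carrier ⊗[F] C₂.carrier) :=
  C₁.bilin.tmul C₂.bilin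

theorem tau_tmul (a c : C₁.carrier) (b d : C₂.carrier) :
    tau C₁ C₂ (a ⊗ₜ b) (c ⊗ₜ d) = C₁.bilin a c * C₂.bilin b d := by
  rw [tau, LinearMap.BilinForm.tensorDistrib_tmul, smul_eq_mul, mul_comm]

theorem tau_comm (x y : C₁.carrier ⊗[F] C₂.carrier) : tau C₁ C₂ x y = tau C₁ C₂ y x := by
  induction x, y using tmul_induction₂ with
  | zero_left | zero_right => simp
  | tmul a b c d => rw [tau_tmul, tau_tmul, C₁.bilin_comm, C₂.bilin_comm]
  | add_left x x' y h h' => rw [map_add, map_add, LinearMap.add_apply, h, h']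
  | add_right x y y' h h' => rw [map_add, map_add, LinearMap.add_apply, h, h']

theorem tau_eq_zero {y : C₁.carrier ⊗[F] C₂.carrier}
    (h : ∀ a b, tau C₁ C₂ (a ⊗ₜ b) y = 0) : y = 0 := by
  let e := finBasis F C₂.carrier
  let d := C₂.bilin.dualBasis C₂.bilin_form_nondegenerate e
  let κ : C₂.carrier → C₁.carrier ⊗[F] C₂.carrier →ₗ[F] C₁.carrier := fun z =>
    (TensorProduct.rid F _).toLinearMap ∘ₗ LinearMap.lTensor C₁.carrier (C₂.bilin z)
  have hκ : ∀ a z w, C₁.bilin a (κ z w) = tau C₁ C₂ (a ⊗ₜ z) w := by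
    intro a z w
    induction w with
    | zero => simp
    | add w w' h h' => rw [map_add, map_add, map_add, h, h']
    | tmul c d => simp [κ, tau_tmul, mul_comm]
  have hsum : ∀ w : C₁.carrier ⊗[F] C₂.carrier, w = ∑ j, κ (d j) w ⊗ₜ[F] e j := by
    intro w
    induction w with
    | zero => simp
    | add w w' h h' =>
      conv_lhs => rw [h, h']
      simp only [map_add, TensorProduct.add_tmul, Finset.sum_add_distrib]
    | tmul c z =>
      have hz : ∑ j, C₂.bilin (d j) z • e j = z := by
        conv_rhs => rw [← e.sum_repr z]
        refine Finset.sum_congr rfl fun j _ => ?_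
        have h := congrArg (C₂.bilin (d j)) (e.sum_repr z)
        simp only [map_sum, map_smul, d, LinearMap.BilinForm.apply_dualBasis_left, smul_eq_mul,
          mul_ite, mul_one, mul_zero, Finset.sum_ite_eq', Finset.mem_univ, if_true] at h
        rw [h]
      conv_lhs => rw [← hz]
      simp [κ, TensorProduct.tmul_sum, TensorProduct.smul_tmul]
  rw [hsum y]
  refine Finset.sum_eq_zero fun j _ => ?_
  have : κ (d j) y = 0 := C₁.bilin_nondegenerate fun a => by
    rw [C₁.bilin_comm, hκ, h]
  rw [this, TensorProduct.zero_tmul]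

theorem tau_ext {x y : C₁.carrier ⊗[F] C₂.carrier}
    (h : ∀ a b, tau C₁ C₂ (a ⊗ₜ b) x = tau C₁ C₂ (a ⊗ₜ b) y) : x = y :=
  sub_eq_zero.1 (tau_eq_zero C₁ C₂ fun a b => by rw [map_sub, h, sub_self])

theorem exists_tau_eq (f : C₁.carrier ⊗[F] C₂.carrier →ₗ[F] F) :
    ∃ y, ∀ x, f x = tau C₁ C₂ x y := by
  have hr : (tau C₁ C₂).IsRefl := fun x y h => by rw [tau_comm, h]
  have hn : (tau C₁ C₂).Nondegenerate :=
    hr.nondegenerate_iff_separatingLeft.2 fun x h => tau_eq_zero C₁ C₂ fun a b => by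
      rw [tau_comm, h]
  refine ⟨((tau C₁ C₂).toDual hn).symm f, fun x => ?_⟩
  rw [tau_comm, LinearMap.BilinForm.apply_toDual_symm_apply]

theorem exists_bilin_eq (f : C.carrier →ₗ[F] F) : ∃ y, ∀ x, f x = C.bilin x y := by
  refine ⟨(C.bilin.toDual C.bilin_form_nondegenerate).symm f, fun x => ?_⟩
  rw [bilin_comm, LinearMap.BilinForm.apply_toDual_symm_apply]

/-- The map `x ↦ x - x̄`. -/
def rho : C.carrier →ₗ[F] C.carrier := LinearMap.id - C.conj

theorem rho_apply (x : C.carrier) : C.rho x = x - C.conj x := rfl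

theorem conj_rho (x : C.carrier) : C.conj (C.rho x) = -C.rho x := by
  rw [rho_apply, map_sub, C.conj_conj, neg_sub]

theorem rho_eq (x : C.carrier) : C.rho x = (2 : F) • x - C.bilin x 1 • 1 := by
  rw [rho_apply, C.conj_eq]; module

theorem two_smul_eq (x : C.carrier) : (2 : F) • x = C.bilin x 1 • 1 + C.rho x := by
  rw [rho_eq]; abel

theorem rho_of_skew {x : C.carrier} (hx : C.conj x = -x) : C.rho x = (2 : F) • x := by
  rw [rho_apply, hx]; module

theorem rho_one : C.rho 1 = 0 := by rw [rho_apply, C.conj_one, sub_self]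

theorem bilin_rho_left (x y : C.carrier) : C.bilin (C.rho x) y = C.bilin x (C.rho y) := by
  rw [rho_apply, rho_apply, map_sub, map_sub, LinearMap.sub_apply, bilin_conj_left]

theorem eq_zero_of_bilin_skew (h2 : (2 : F) ≠ 0) {x : C.carrier} (h1 : C.bilin x 1 = 0)
    (h : ∀ t, C.conj t = -t → C.bilin x t = 0) : x = 0 := by
  refine C.bilin_nondegenerate fun y => ?_
  have := congrArg (C.bilin x) (C.two_smul_eq y)
  rw [map_add, map_smul, map_smul, h1, h _ (C.conj_rho y), smul_zero, add_zero, smul_eq_mul] at this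
  exact (mul_eq_zero.1 this).resolve_left h2

theorem exists_commute_of_commutator (h2 : (2 : F) ≠ 0) (f : C.carrier →ₗ[F] F)
    (hf : ∀ s t, C.conj s = -s → C.conj t = -t → f (s * t) = f (t * s)) :
    ∃ g, (∀ x, f x = C.bilin x g) ∧ ∀ x, x * g = g * x := by
  obtain ⟨g, hg⟩ := C.exists_bilin_eq f
  refine ⟨g, hg, fun x => ?_⟩
  have h : ∀ t, C.conj t = -t → t * g = g * t := by
    intro t ht
    rw [← sub_eq_zero]
    refine C.eq_zero_of_bilin_skew h2 ?_ fun s hs => ?_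
    · rw [map_sub, LinearMap.sub_apply, C.bilin_mul_comm_one, sub_self]
    · have h1 := hf s t hs ht
      rw [hg, hg, C.bilin_mul_right, C.bilin_mul_left, ht, mul_neg, neg_mul, map_neg, map_neg,
        neg_inj] at h1
      rw [map_sub, LinearMap.sub_apply, C.bilin_comm _ s, C.bilin_comm _ s, h1, sub_self]
  have h3 : (2 : F) • (x * g - g * x) = 0 := by
    rw [smul_sub, ← smul_mul_assoc, ← mul_smul_comm, two_smul_eq, add_mul, mul_add,
      h _ (C.conj_rho x)]
    simp
  exact sub_eq_zero.1 ((smul_eq_zero.1 h3).resolve_left h2)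

/-- The involution of `C₁ ⊗ C₂`. -/
noncomputable def conjTensor : C₁.carrier ⊗[F] C₂.carrier →ₗ[F] C₁.carrier ⊗[F] C₂.carrier :=
  TensorProduct.map C₁.conj C₂.conj

theorem conjTensor_tmul (a : C₁.carrier) (b : C₂.carrier) :
    conjTensor C₁ C₂ (a ⊗ₜ b) = C₁.conj a ⊗ₜ C₂.conj b := rfl

theorem tau_mul_conjTensor (s : C₁.carrier) (t : C₂.carrier) (x y : C₁.carrier ⊗[F] C₂.carrier) :
    tau C₁ C₂ (s ⊗ₜ t) (y * conjTensor C₁ C₂ x) = tau C₁ C₂ ((s ⊗ₜ t) * x) y := by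
  induction x, y using tmul_induction₂ with
  | zero_left | zero_right => simp
  | tmul a b c d =>
    rw [conjTensor_tmul, Algebra.TensorProduct.tmul_mul_tmul, Algebra.TensorProduct.tmul_mul_tmul,
      tau_tmul, tau_tmul, C₁.bilin_mul_right, C₂.bilin_mul_right]
  | add_left x x' y h h' => simp only [map_add, mul_add, LinearMap.add_apply, h, h']
  | add_right x y y' h h' => simp only [map_add, add_mul, h, h']

theorem tau_conjTensor (x y : C₁.carrier ⊗[F] C₂.carrier) :
    tau C₁ C₂ (conjTensor C₁ C₂ x) y = tau C₁ C₂ x (conjTensor C₁ C₂ y) := by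
  induction x, y using tmul_induction₂ with
  | zero_left | zero_right => simp
  | tmul a b c d =>
    rw [conjTensor_tmul, conjTensor_tmul, tau_tmul, tau_tmul, bilin_conj_left, bilin_conj_left]
  | add_left x x' y h h' => simp only [map_add, LinearMap.add_apply, h, h']
  | add_right x y y' h h' => simp only [map_add, h, h']

theorem conjTensor_mul (x y : C₁.carrier ⊗[F] C₂.carrier) :
    conjTensor C₁ C₂ (x * y) = conjTensor C₁ C₂ y * conjTensor C₁ C₂ x :=
  (C₁.toAWI.tensor C₂.toAWI).invol_mul x y

theorem conjTensor_conjTensor (x : C₁.carrier ⊗[F] C₂.carrier) :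
    conjTensor C₁ C₂ (conjTensor C₁ C₂ x) = x :=
  (C₁.toAWI.tensor C₂.toAWI).invol_invol x

theorem exists_eq_tmul_add_tmul_of_skew (h2 : (2 : F) ≠ 0) {x : C₁.carrier ⊗[F] C₂.carrier}
    (hx : conjTensor C₁ C₂ x = -x) :
    ∃ s t, C₁.conj s = -s ∧ C₂.conj t = -t ∧ x = s ⊗ₜ 1 + 1 ⊗ₜ t := by
  have key : ∀ y, ∃ s t, C₁.conj s = -s ∧ C₂.conj t = -t ∧
      (2 : F) • (y - conjTensor C₁ C₂ y) = s ⊗ₜ 1 + 1 ⊗ₜ t := by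
    intro y
    induction y with
    | zero => exact ⟨0, 0, by simp, by simp, by simp⟩
    | add y z hy hz =>
      obtain ⟨s, t, hs, ht, h⟩ := hy
      obtain ⟨s', t', hs', ht', h'⟩ := hz
      refine ⟨s + s', t + t', by rw [map_add, hs, hs', neg_add], by rw [map_add, ht, ht', neg_add],
        ?_⟩
      rw [map_add, TensorProduct.add_tmul, TensorProduct.tmul_add]
      linear_combination (norm := module) h + h'
    | tmul a b =>
      refine ⟨C₂.bilin b 1 • C₁.rho a, C₁.bilin a 1 • C₂.rho b,
        by rw [map_smul, conj_rho, smul_neg], by rw [map_smul, conj_rho, smul_neg], ?_⟩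
      rw [conjTensor_tmul, conj_eq, conj_eq, rho_eq, rho_eq]
      simp only [TensorProduct.sub_tmul, TensorProduct.tmul_sub, ← TensorProduct.smul_tmul',
        TensorProduct.tmul_smul]
      module
  obtain ⟨s, t, hs, ht, h⟩ := key x
  have h4 : (4 : F) ≠ 0 := by
    rw [show (4 : F) = 2 * 2 by norm_num]; exact mul_ne_zero h2 h2
  refine ⟨(4 : F)⁻¹ • s, (4 : F)⁻¹ • t, by rw [map_smul, hs, smul_neg],
    by rw [map_smul, ht, smul_neg], ?_⟩
  rw [TensorProduct.tmul_smul, ← TensorProduct.smul_tmul', ← smul_add, ← h, hx, eq_inv_smul_iff₀ h4]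
  module

end Tensor

end CompositionAlgebra

namespace CompositionAlgebra

section TensorDelta

variable {F : Type u} [Field F] (C C₁ C₂ : CompositionAlgebra F)

/-- The map `delta` as a bilinear map. -/
noncomputable def deltaBilin : C.carrier →ₗ[F] C.carrier →ₗ[F] C.carrier →ₗ[F] C.carrier :=
  LinearMap.mk₂ F C.delta
    (fun a a' c => by
      ext v; simp only [delta_apply, LinearMap.add_apply, map_add, mul_add, add_mul]; module)
    (fun r a c => by
      ext v
      simp only [delta_apply, LinearMap.smul_apply, map_smul, mul_smul_comm, smul_mul_assoc,
        smul_eq_mul]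
      module)
    (fun a c c' => by
      ext v; simp only [delta_apply, LinearMap.add_apply, map_add, mul_add, add_mul]; module)
    (fun r a c => by
      ext v
      simp only [delta_apply, LinearMap.smul_apply, map_smul, mul_smul_comm, smul_mul_assoc,
        smul_eq_mul]
      module)

/-- The bilinear extension of `(a ⊗ b, c ⊗ d) ↦ B₂(b, d) δ_{a,c}` to `C₁ ⊗ C₂`. -/
noncomputable def deltaTensor : C₁.carrier ⊗[F] C₂.carrier →ₗ[F]
    C₁.carrier ⊗[F] C₂.carrier →ₗ[F] C₁.carrier →ₗ[F] C₁.carrier :=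
  (TensorProduct.map₂ C₁.deltaBilin C₂.bilin).compr₂
    (TensorProduct.rid F (C₁.carrier →ₗ[F] C₁.carrier)).toLinearMap

theorem deltaTensor_tmul (a c v : C₁.carrier) (b d : C₂.carrier) :
    deltaTensor C₁ C₂ (a ⊗ₜ b) (c ⊗ₜ d) v = C₂.bilin b d • C₁.delta a c v := rfl

/-- The flip `C₁ ⊗ C₂ → C₂ ⊗ C₁`. -/
noncomputable abbrev flipTensor : C₁.carrier ⊗[F] C₂.carrier ≃ₗ[F] C₂.carrier ⊗[F] C₁.carrier :=
  TensorProduct.comm F C₁.carrier C₂.carrier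

theorem tau_flipTensor (x y : C₁.carrier ⊗[F] C₂.carrier) :
    tau C₂ C₁ (flipTensor C₁ C₂ x) (flipTensor C₁ C₂ y) = tau C₁ C₂ x y := by
  induction x, y using tmul_induction₂ with
  | zero_left | zero_right => simp
  | tmul a b c d =>
    rw [TensorProduct.comm_tmul, TensorProduct.comm_tmul, tau_tmul, tau_tmul, mul_comm]
  | add_left x x' y h h' => simp only [map_add, LinearMap.add_apply, h, h']
  | add_right x y y' h h' => simp only [map_add, h, h']

theorem flipTensor_mul (x y : C₁.carrier ⊗[F] C₂.carrier) :
    flipTensor C₁ C₂ (x * y) = flipTensor C₁ C₂ x * flipTensor C₁ C₂ y := by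
  induction x, y using tmul_induction₂ with
  | zero_left | zero_right => simp
  | tmul a b c d => simp
  | add_left x x' y h h' => simp only [map_add, add_mul, h, h']
  | add_right x y y' h h' => simp only [map_add, mul_add, h, h']

/-- The operator `V_{x,y} z` of `C₁ ⊗ C₂`. -/
noncomputable def vopTensor (x y z : C₁.carrier ⊗[F] C₂.carrier) : C₁.carrier ⊗[F] C₂.carrier :=
  x * conjTensor C₁ C₂ y * z + z * conjTensor C₁ C₂ y * x - z * conjTensor C₁ C₂ x * y

theorem four_smul_vopTensor_tmul (x y : C₁.carrier ⊗[F] C₂.carrier) (v : C₁.carrier) (w : C₂.carrier) :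
    (4 : F) • vopTensor C₁ C₂ x y (v ⊗ₜ w) =
      tau C₁ C₂ x y • (v ⊗ₜ[F] w) +
      TensorProduct.map C₁.rho C₂.rho (x * conjTensor C₁ C₂ y) * (v ⊗ₜ w) +
      deltaTensor C₁ C₂ x y v ⊗ₜ w +
      v ⊗ₜ deltaTensor C₂ C₁ (flipTensor C₁ C₂ x) (flipTensor C₁ C₂ y) w := by
  simp only [vopTensor]
  induction x, y using tmul_induction₂ with
  | zero_left | zero_right => simp
  | tmul a b c d =>
    have h1 := C₁.mul_conj_add v (C₁.conj a) (C₁.conj c)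
    have h2 := C₂.mul_conj_add w (C₂.conj b) (C₂.conj d)
    rw [conj_conj, conj_conj, bilin_conj_left, conj_conj] at h1 h2
    have e1 : C₁.bilin (a * C₁.conj c) 1 = C₁.bilin a c := by
      rw [bilin_mul_right, conj_conj, one_mul]
    have e2 : C₂.bilin (b * C₂.conj d) 1 = C₂.bilin b d := by
      rw [bilin_mul_right, conj_conj, one_mul]
    simp only [conjTensor_tmul, Algebra.TensorProduct.tmul_mul_tmul, TensorProduct.map_tmul,
      TensorProduct.comm_tmul, deltaTensor_tmul, tau_tmul, delta_apply, rho_eq, sub_mul,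
      smul_mul_assoc, one_mul, e1, e2, eq_sub_of_add_eq h1, eq_sub_of_add_eq h2,
      TensorProduct.sub_tmul, TensorProduct.tmul_sub, TensorProduct.add_tmul,
      TensorProduct.tmul_add, ← TensorProduct.smul_tmul', TensorProduct.tmul_smul]
    module
  | add_left x x' y h h' =>
    simp only [map_add, add_mul, mul_add, LinearMap.add_apply, TensorProduct.add_tmul,
      TensorProduct.tmul_add] at *
    linear_combination (norm := module) h + h'
  | add_right x y y' h h' =>
    simp only [map_add, add_mul, mul_add, LinearMap.add_apply, TensorProduct.add_tmul,
      TensorProduct.tmul_add] at *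
    linear_combination (norm := module) h + h'

variable {C₁ C₂}
variable (x y : C₁.carrier ⊗[F] C₂.carrier)

theorem deltaTensor_mul (s v : C₁.carrier) :
    deltaTensor C₁ C₂ x y (s * v) - s * deltaTensor C₁ C₂ x y v =
      (deltaTensor C₁ C₂ x y s - s * deltaTensor C₁ C₂ x y 1) * v := by
  induction x, y using tmul_induction₂ with
  | zero_left | zero_right => simp
  | tmul a b c d =>
    simp only [deltaTensor_tmul]
    have := congrArg (fun z => C₂.bilin b d • z) (C₁.delta_mul a c s v)
    simp only [smul_sub, sub_mul, smul_mul_assoc, mul_smul_comm] at *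
    exact this
  | add_left x x' y h h' =>
    simp only [map_add, add_mul, sub_mul, mul_add, LinearMap.add_apply] at *
    linear_combination (norm := abel) h + h'
  | add_right x y y' h h' =>
    simp only [map_add, add_mul, sub_mul, mul_add, LinearMap.add_apply] at *
    linear_combination (norm := abel) h + h'

theorem bilin_deltaTensor_one_one : C₁.bilin (deltaTensor C₁ C₂ x y 1) 1 = 0 := by
  induction x, y using tmul_induction₂ with
  | zero_left | zero_right => simp
  | tmul a b c d =>
    simp only [deltaTensor_tmul, map_smul, LinearMap.smul_apply, bilin_delta_one_one, smul_zero]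
  | add_left x x' y h h' => simp only [map_add, LinearMap.add_apply, h, h', add_zero]
  | add_right x y y' h h' => simp only [map_add, LinearMap.add_apply, h, h', add_zero]

theorem bilin_deltaTensor_one {b : C₁.carrier} (hb : C₁.conj b = -b) (hb1 : C₁.bilin b 1 = 0) :
    C₁.bilin (deltaTensor C₁ C₂ x y 1) b =
      -2 * tau C₁ C₂ ((b ⊗ₜ 1) * x) y - 4 * tau C₁ C₂ (x * (b ⊗ₜ 1)) y := by
  induction x, y using tmul_induction₂ with
  | zero_left | zero_right => simp
  | tmul a e c d =>
    simp only [deltaTensor_tmul, map_smul, LinearMap.smul_apply, C₁.bilin_delta_one hb hb1,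
      Algebra.TensorProduct.tmul_mul_tmul, one_mul, mul_one, tau_tmul, smul_eq_mul]
    ring
  | add_left x x' y h h' =>
    simp only [map_add, LinearMap.add_apply, mul_add, add_mul, h, h']; ring
  | add_right x y y' h h' =>
    simp only [map_add, LinearMap.add_apply, h, h']; ring

theorem bilin_deltaTensor_sub {s t : C₁.carrier} (hs : C₁.conj s = -s) (ht : C₁.conj t = -t) :
    C₁.bilin (deltaTensor C₁ C₂ x y s - s * deltaTensor C₁ C₂ x y 1) t =
      -2 * tau C₁ C₂ ((s ⊗ₜ 1) * ((t ⊗ₜ 1) * x) - (t ⊗ₜ 1) * ((s ⊗ₜ 1) * x)) y := by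
  induction x, y using tmul_induction₂ with
  | zero_left | zero_right => simp
  | tmul a e c d =>
    have h := C₁.bilin_delta_sub hs ht a c
    simp only [map_sub, LinearMap.sub_apply] at h
    simp only [deltaTensor_tmul, mul_smul_comm, map_smul, LinearMap.smul_apply,
      Algebra.TensorProduct.tmul_mul_tmul, one_mul, map_sub, LinearMap.sub_apply, tau_tmul,
      smul_eq_mul]
    linear_combination C₂.bilin e d * h
  | add_left x x' y h h' =>
    simp only [map_add, map_sub, LinearMap.add_apply, LinearMap.sub_apply, mul_add] at *
    linear_combination h + h'
  | add_right x y y' h h' =>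
    simp only [map_add, map_sub, LinearMap.add_apply, LinearMap.sub_apply, mul_add] at *
    linear_combination h + h'

end TensorDelta

end CompositionAlgebra

namespace CompositionAlgebra

section TensorInverse

variable {F : Type u} [Field F] {C₁ C₂ : CompositionAlgebra F}
variable (x y : C₁.carrier ⊗[F] C₂.carrier)

theorem bilin_deltaTensor_sub_one (s : C₁.carrier) :
    C₁.bilin (deltaTensor C₁ C₂ x y s - s * deltaTensor C₁ C₂ x y 1) 1 = 0 := by
  induction x, y using tmul_induction₂ with
  | zero_left | zero_right => simp
  | tmul a e c d =>
    have h1 := C₁.bilin_mul_comm_one s (a * C₁.conj c)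
    have h2 := C₁.bilin_associator_one s (C₁.conj c) a
    rw [associator_apply, map_sub, LinearMap.sub_apply] at h2
    simp only [deltaTensor_tmul, mul_smul_comm, map_smul, LinearMap.smul_apply, map_sub,
      LinearMap.sub_apply, smul_eq_mul, delta_apply, map_add, LinearMap.add_apply, mul_add,
      mul_sub, mul_one, one_mul]
    linear_combination C₂.bilin e d * (4 * h2 - 2 * h1)
  | add_left x x' y h h' =>
    simp only [map_add, map_sub, LinearMap.add_apply, LinearMap.sub_apply, mul_add] at *
    linear_combination h + h'
  | add_right x y y' h h' =>
    simp only [map_add, map_sub, LinearMap.add_apply, LinearMap.sub_apply, mul_add] at *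
    linear_combination h + h'

theorem tmul_one_mul_mul (h4 : finrank F C₁.carrier ≤ 4) (s t : C₁.carrier) :
    (s ⊗ₜ[F] (1 : C₂.carrier)) * ((t ⊗ₜ 1) * x) = ((s * t) ⊗ₜ 1) * x := by
  induction x with
  | zero => simp
  | add x x' h h' => simp only [mul_add, h, h']
  | tmul a b => simp [C₁.mul_assoc_of_finrank_le_four h4]

theorem tmul_one_mul_comm (h2 : finrank F C₁.carrier ≤ 2) (s : C₁.carrier) :
    (s ⊗ₜ[F] (1 : C₂.carrier)) * x = x * (s ⊗ₜ 1) := by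
  induction x with
  | zero => simp
  | add x x' h h' => simp only [mul_add, add_mul, h, h']
  | tmul a b => simp [C₁.mul_comm_of_finrank_le_two h2 s]

variable (h2 : (2 : F) ≠ 0)
include h2

variable {x y}

theorem exists_commute_bilin_eq_tau (h4 : finrank F C₁.carrier ≤ 4)
    (hl : ∀ s t, C₁.conj s = -s → C₁.conj t = -t →
      tau C₁ C₂ ((s ⊗ₜ 1) * ((t ⊗ₜ 1) * x) - (t ⊗ₜ 1) * ((s ⊗ₜ 1) * x)) y = 0) :
    ∃ g, (∀ a, tau C₁ C₂ ((a ⊗ₜ 1) * x) y = C₁.bilin a g) ∧ ∀ a, a * g = g * a := by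
  refine C₁.exists_commute_of_commutator h2
    ((tau C₁ C₂).flip y ∘ₗ LinearMap.mulRight F x ∘ₗ (TensorProduct.mk F _ _).flip 1)
    fun s t hs ht => ?_
  have := hl s t hs ht
  rw [tmul_one_mul_mul x h4, tmul_one_mul_mul x h4, map_sub, LinearMap.sub_apply, sub_eq_zero] at this
  exact this

theorem deltaTensor_eq_zero (hm : finrank F C₁.carrier ∈ ({1, 2, 4, 8} : Set ℕ))
    (hl : ∀ s t, C₁.conj s = -s → C₁.conj t = -t →
      tau C₁ C₂ ((s ⊗ₜ 1) * ((t ⊗ₜ 1) * x) - (t ⊗ₜ 1) * ((s ⊗ₜ 1) * x)) y = 0)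
    (hr : finrank F C₁.carrier ≤ 4 → ∀ b, C₁.conj b = -b → tau C₁ C₂ (x * (b ⊗ₜ 1)) y = 0) :
    deltaTensor C₁ C₂ x y = 0 := by
  obtain ⟨D, hD⟩ : ∃ D, D = deltaTensor C₁ C₂ x y := ⟨_, rfl⟩
  have hskew : ∀ s, C₁.conj s = -s → D s - s * D 1 = 0 := fun s hs => by
    refine C₁.eq_zero_of_bilin_skew h2 ?_ fun t ht => ?_
    · rw [hD, bilin_deltaTensor_sub_one]
    · rw [hD, bilin_deltaTensor_sub x y hs ht, hl s t hs ht, mul_zero]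
  have hmul : ∀ s v, C₁.conj s = -s → D (s * v) = s * D v := fun s v hs => by
    rw [← sub_eq_zero, hD, deltaTensor_mul, ← hD, hskew s hs, zero_mul]
  have hall : ∀ s v, D (s * v) = s * D v := fun s v => by
    have h : (2 : F) • (D (s * v) - s * D v) = 0 := by
      rw [smul_sub, ← map_smul, ← smul_mul_assoc, ← smul_mul_assoc, two_smul_eq, add_mul, add_mul,
        map_add, hmul _ v (C₁.conj_rho s), smul_mul_assoc, smul_mul_assoc, one_mul, one_mul,
        map_smul, sub_self]
    exact sub_eq_zero.1 ((smul_eq_zero.1 h).resolve_left h2)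
  have hu1 : C₁.bilin (D 1) 1 = 0 := by rw [hD, bilin_deltaTensor_one_one]
  have hu : C₁.conj (D 1) = -D 1 := (C₁.conj_eq_neg_iff h2 _).2 hu1
  suffices h : D 1 = 0 by
    rw [← hD]
    ext v
    rw [← mul_one v, hall, h, mul_zero, LinearMap.zero_apply]
  by_cases h4 : finrank F C₁.carrier ≤ 4
  · refine C₁.eq_zero_of_bilin_skew h2 hu1 fun b hb => ?_
    rw [hD, bilin_deltaTensor_one x y hb ((C₁.conj_eq_neg_iff h2 _).1 hb), hr h4 b hb, mul_zero,
      sub_zero, mul_eq_zero]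
    right
    by_cases hm2 : finrank F C₁.carrier ≤ 2
    · rw [tmul_one_mul_comm x hm2, hr h4 b hb]
    · obtain ⟨g, hg, hgc⟩ := exists_commute_bilin_eq_tau h2 h4 hl
      have hm4 : 4 ≤ finrank F C₁.carrier := by
        simp only [Set.mem_insert_iff, Set.mem_singleton_iff] at hm; omega
      have hρ : C₁.rho g = 0 :=
        C₁.eq_zero_of_skew_of_commute h2 hm4 (C₁.conj_rho g) fun z _ => by
          rw [rho_eq, mul_sub, sub_mul, mul_smul_comm, smul_mul_assoc, hgc, mul_smul_comm,
            smul_mul_assoc, one_mul, mul_one]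
      have h := C₁.bilin_rho_left b g
      rw [hρ, map_zero, C₁.rho_of_skew hb, map_smul, LinearMap.smul_apply, ← hg, smul_eq_zero] at h
      exact h.resolve_left h2
  · refine C₁.eq_zero_of_skew_of_nucleus h2 ?_ hu fun s t => ?_
    · simp only [Set.mem_insert_iff, Set.mem_singleton_iff] at hm; omega
    · rw [← hall t 1, ← hall s, ← hall (s * t) 1, mul_one, mul_one]

omit h2 in
theorem map_rho_eq_zero (h : ∀ s t, C₁.conj s = -s → C₂.conj t = -t →
    tau C₁ C₂ ((s ⊗ₜ t) * x) y = 0) :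
    TensorProduct.map C₁.rho C₂.rho (x * conjTensor C₁ C₂ y) = 0 := by
  have hρ : ∀ a b z, tau C₁ C₂ (a ⊗ₜ b) (TensorProduct.map C₁.rho C₂.rho z) =
      tau C₁ C₂ (C₁.rho a ⊗ₜ C₂.rho b) z := by
    intro a b z
    induction z with
    | zero => simp
    | add z z' h h' => simp only [map_add, h, h']
    | tmul c d => rw [TensorProduct.map_tmul, tau_tmul, tau_tmul, bilin_rho_left, bilin_rho_left]
  refine tau_eq_zero C₁ C₂ fun a b => ?_
  have hc : x * conjTensor C₁ C₂ y = conjTensor C₁ C₂ (y * conjTensor C₁ C₂ x) := by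
    rw [conjTensor_mul, conjTensor_conjTensor]
  rw [hρ, hc, ← tau_conjTensor, conjTensor_tmul, conj_rho, conj_rho, TensorProduct.neg_tmul,
    TensorProduct.tmul_neg, neg_neg, tau_mul_conjTensor, h _ _ (conj_rho _ _) (conj_rho _ _)]

omit h2 in
theorem four_ne_zero_of_two_ne_zero (h2 : (2 : F) ≠ 0) : (4 : F) ≠ 0 := by
  rw [show (4 : F) = 2 * 2 by norm_num]; exact mul_ne_zero h2 h2

theorem vopTensor_eq_self (hm₁ : finrank F C₁.carrier ∈ ({1, 2, 4, 8} : Set ℕ))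
    (hm₂ : finrank F C₂.carrier ∈ ({1, 2, 4, 8} : Set ℕ))
    (h : ∀ s t, C₁.conj s = -s → C₂.conj t = -t → tau C₁ C₂ ((s ⊗ₜ t) * x) y = 0)
    (hl₁ : ∀ s t, C₁.conj s = -s → C₁.conj t = -t →
      tau C₁ C₂ ((s ⊗ₜ 1) * ((t ⊗ₜ 1) * x) - (t ⊗ₜ 1) * ((s ⊗ₜ 1) * x)) y = 0)
    (hr₁ : finrank F C₁.carrier ≤ 4 → ∀ b, C₁.conj b = -b → tau C₁ C₂ (x * (b ⊗ₜ 1)) y = 0)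
    (hl₂ : ∀ s t, C₂.conj s = -s → C₂.conj t = -t →
      tau C₁ C₂ ((1 ⊗ₜ s) * ((1 ⊗ₜ t) * x) - (1 ⊗ₜ t) * ((1 ⊗ₜ s) * x)) y = 0)
    (hr₂ : finrank F C₂.carrier ≤ 4 → ∀ b, C₂.conj b = -b → tau C₁ C₂ (x * (1 ⊗ₜ b)) y = 0)
    (hxy : tau C₁ C₂ x y = 4) (z : C₁.carrier ⊗[F] C₂.carrier) : vopTensor C₁ C₂ x y z = z := by
  have hD₁ := deltaTensor_eq_zero h2 hm₁ hl₁ hr₁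
  have hD₂ : deltaTensor C₂ C₁ (flipTensor C₁ C₂ x) (flipTensor C₁ C₂ y) = 0 := by
    refine deltaTensor_eq_zero h2 hm₂ (fun s t hs ht => ?_) fun h4 b hb => ?_
    · rw [← hl₂ s t hs ht, ← tau_flipTensor C₁ C₂]
      simp only [map_sub, flipTensor_mul, TensorProduct.comm_tmul]
    · rw [← hr₂ h4 b hb, ← tau_flipTensor C₁ C₂]
      simp only [flipTensor_mul, TensorProduct.comm_tmul]
  induction z with
  | zero => simp [vopTensor]
  | add z z' hz hz' =>
    conv_rhs => rw [← hz, ← hz']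
    simp only [vopTensor, mul_add, add_mul]
    abel
  | tmul v w =>
    have := four_smul_vopTensor_tmul C₁ C₂ x y v w
    rw [map_rho_eq_zero h, hD₁, hD₂, hxy, zero_mul, LinearMap.zero_apply, LinearMap.zero_apply,
      TensorProduct.zero_tmul, TensorProduct.tmul_zero, add_zero, add_zero, add_zero] at this
    exact smul_right_injective _ (four_ne_zero_of_two_ne_zero h2) this

theorem commute_mul_conjTensor (h4₁ : finrank F C₁.carrier ≤ 4) (h4₂ : finrank F C₂.carrier ≤ 4)
    (h : ∀ s t, C₁.conj s = -s → C₂.conj t = -t → tau C₁ C₂ ((s ⊗ₜ t) * x) y = 0)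
    (hl₁ : ∀ s t, C₁.conj s = -s → C₁.conj t = -t →
      tau C₁ C₂ ((s ⊗ₜ 1) * ((t ⊗ₜ 1) * x) - (t ⊗ₜ 1) * ((s ⊗ₜ 1) * x)) y = 0)
    (hl₂ : ∀ s t, C₂.conj s = -s → C₂.conj t = -t →
      tau C₁ C₂ ((1 ⊗ₜ s) * ((1 ⊗ₜ t) * x) - (1 ⊗ₜ t) * ((1 ⊗ₜ s) * x)) y = 0)
    (z : C₁.carrier ⊗[F] C₂.carrier) :
    y * conjTensor C₁ C₂ x * z = z * (y * conjTensor C₁ C₂ x) := by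
  obtain ⟨g₁, hg₁, hc₁⟩ := exists_commute_bilin_eq_tau h2 h4₁ hl₁
  obtain ⟨g₂, hg₂, hc₂⟩ := exists_commute_bilin_eq_tau (C₁ := C₂) (C₂ := C₁)
    (x := flipTensor C₁ C₂ x) (y := flipTensor C₁ C₂ y) h2 h4₂ fun s t hs ht => by
      rw [← hl₂ s t hs ht, ← tau_flipTensor C₁ C₂]
      simp only [map_sub, flipTensor_mul, TensorProduct.comm_tmul]
  have hg₂ : ∀ b, tau C₁ C₂ ((1 ⊗ₜ b) * x) y = C₂.bilin b g₂ := fun b => by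
    rw [← hg₂, ← tau_flipTensor C₁ C₂, flipTensor_mul, TensorProduct.comm_tmul]
  have hP : (4 : F) • (y * conjTensor C₁ C₂ x) = (2 : F) • (g₁ ⊗ₜ[F] (1 : C₂.carrier)) +
      (2 : F) • ((1 : C₁.carrier) ⊗ₜ[F] g₂) - tau C₁ C₂ x y • ((1 : C₁.carrier) ⊗ₜ[F] 1) := by
    refine tau_ext C₁ C₂ fun a b => ?_
    have e : (4 : F) • (a ⊗ₜ[F] b) = C₁.rho a ⊗ₜ[F] C₂.rho b +
        (2 * C₂.bilin b 1) • (a ⊗ₜ[F] (1 : C₂.carrier)) +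
        (2 * C₁.bilin a 1) • ((1 : C₁.carrier) ⊗ₜ[F] b) -
        (C₁.bilin a 1 * C₂.bilin b 1) • ((1 : C₁.carrier) ⊗ₜ[F] (1 : C₂.carrier)) := by
      simp only [rho_eq, TensorProduct.sub_tmul, TensorProduct.tmul_sub,
        ← TensorProduct.smul_tmul', TensorProduct.tmul_smul]
      module
    have e1 := hg₁ 1
    rw [← Algebra.TensorProduct.one_def, one_mul] at e1
    rw [map_smul, ← LinearMap.smul_apply, ← map_smul, e]
    simp only [map_add, map_sub, map_smul, LinearMap.add_apply, LinearMap.sub_apply,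
      LinearMap.smul_apply, tau_mul_conjTensor C₁ C₂ _ _ x y, h _ _ (C₁.conj_rho a) (C₂.conj_rho b),
      hg₁, hg₂, tau_tmul, e1, smul_eq_mul]
    ring
  have hc : ∀ z, (4 : F) • (y * conjTensor C₁ C₂ x) * z = z * (4 : F) • (y * conjTensor C₁ C₂ x) := by
    intro z
    rw [hP]
    induction z with
    | zero => simp
    | add z z' h h' => rw [mul_add, add_mul, h, h']
    | tmul p q => simp [mul_add, add_mul, mul_sub, sub_mul, smul_mul_assoc, mul_smul_comm, hc₁, hc₂]
  have := hc z
  rw [smul_mul_assoc, mul_smul_comm] at this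
  exact smul_right_injective _ (four_ne_zero_of_two_ne_zero h2) this

end TensorInverse

end CompositionAlgebra

namespace CompositionAlgebra

section TensorConverse

variable {F : Type u} [Field F] {C₁ C₂ : CompositionAlgebra F}
variable {x y : C₁.carrier ⊗[F] C₂.carrier}

theorem conjTensor_flipTensor (w : C₁.carrier ⊗[F] C₂.carrier) :
    conjTensor C₂ C₁ (flipTensor C₁ C₂ w) = flipTensor C₁ C₂ (conjTensor C₁ C₂ w) := by
  induction w with
  | zero => simp
  | add w w' h h' => simp only [map_add, h, h']
  | tmul a b => rfl

variable (h2 : (2 : F) ≠ 0)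
include h2

theorem tau_eq_four_of_vopTensor_eq_self (h : ∀ z, vopTensor C₁ C₂ x y z = z) :
    TensorProduct.map C₁.rho C₂.rho (x * conjTensor C₁ C₂ y) = 0 ∧ tau C₁ C₂ x y = 4 ∧
      deltaTensor C₁ C₂ x y = 0 := by
  have h4 := four_ne_zero_of_two_ne_zero h2
  have hV := four_smul_vopTensor_tmul C₁ C₂ x y
  simp only [h] at hV
  obtain ⟨P, hP⟩ : ∃ P, P = x * conjTensor C₁ C₂ y := ⟨_, rfl⟩
  rw [← hP] at hV ⊢
  have hρ : ∀ z, TensorProduct.map C₁.rho C₂.rho (TensorProduct.map C₁.rho C₂.rho z) =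
      (4 : F) • TensorProduct.map C₁.rho C₂.rho z := by
    intro z
    induction z with
    | zero => simp
    | add z z' h h' => simp only [map_add, h, h', smul_add]
    | tmul a b =>
      rw [TensorProduct.map_tmul, TensorProduct.map_tmul, C₁.rho_of_skew (C₁.conj_rho a),
        C₂.rho_of_skew (C₂.conj_rho b), TensorProduct.tmul_smul, ← TensorProduct.smul_tmul',
        smul_smul]
      norm_num
  have hΛ : TensorProduct.map C₁.rho C₂.rho P = 0 := by
    have := congrArg (TensorProduct.map C₁.rho C₂.rho) (hV 1 1)
    rw [← Algebra.TensorProduct.one_def, mul_one, Algebra.TensorProduct.one_def] at this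
    simp only [map_add, map_smul, TensorProduct.map_tmul, rho_one, TensorProduct.tmul_zero,
      TensorProduct.zero_tmul, smul_zero, hρ, zero_add, add_zero] at this
    exact (smul_eq_zero.1 this.symm).resolve_left h4
  simp only [hΛ, zero_mul, add_zero] at hV
  have hτ : tau C₁ C₂ x y = 4 := by
    have := congrArg (tau C₁ C₂ (1 ⊗ₜ 1)) (hV 1 1)
    simp only [map_add, map_smul, tau_tmul, bilin_one_one, C₁.bilin_comm 1 (deltaTensor _ _ _ _ _),
      C₂.bilin_comm 1 (deltaTensor _ _ _ _ _), bilin_deltaTensor_one_one, smul_eq_mul, zero_mul,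
      mul_zero, add_zero] at this
    have h5 : (2 : F) * 2 ≠ 0 := mul_ne_zero h2 h2
    exact mul_right_cancel₀ h5 this.symm
  refine ⟨hΛ, hτ, ?_⟩
  ext v
  refine C₁.bilin_nondegenerate fun c => ?_
  have := congrArg (tau C₁ C₂ (c ⊗ₜ 1)) (hV v 1)
  simp only [map_add, map_smul, tau_tmul, bilin_one_one, hτ,
    C₂.bilin_comm 1 (deltaTensor _ _ _ _ _), bilin_deltaTensor_one_one, smul_eq_mul,
    mul_zero, add_zero] at this
  rw [C₁.bilin_comm]
  exact (mul_eq_zero.1 (left_eq_add.1 this)).resolve_right h2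

theorem eq_zero_of_vopTensor_eq_self {s₁ : C₁.carrier} {s₂ : C₂.carrier} (h₁ : C₁.conj s₁ = -s₁)
    (h₂ : C₂.conj s₂ = -s₂) (hn : C₁.norm s₁ = C₂.norm s₂) (hx : x = s₁ ⊗ₜ 1 + 1 ⊗ₜ s₂)
    (h : ∀ z, vopTensor C₁ C₂ x y z = z) : s₁ = 0 := by
  obtain ⟨hΛ, hτ, hD⟩ := tau_eq_four_of_vopTensor_eq_self h2 h
  refine C₁.eq_zero_of_bilin_skew h2 ((C₁.conj_eq_neg_iff h2 _).1 h₁) fun t ht => ?_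
  have hl : tau C₁ C₂ ((s₁ ⊗ₜ 1) * ((t ⊗ₜ 1) * x)) y = tau C₁ C₂ ((t ⊗ₜ 1) * ((s₁ ⊗ₜ 1) * x)) y := by
    have := bilin_deltaTensor_sub x y h₁ ht
    rw [hD, LinearMap.zero_apply, LinearMap.zero_apply, mul_zero, sub_zero, map_zero,
      LinearMap.zero_apply, zero_eq_mul, neg_eq_zero, map_sub, LinearMap.sub_apply, sub_eq_zero] at this
    exact this.resolve_left h2
  have e : (t ⊗ₜ 1) * ((s₁ ⊗ₜ 1) * x) = (t ⊗ₜ s₂) * x := by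
    have e₁ := C₁.mul_self_of_skew h₁ 1
    have e₂ := C₂.mul_self_of_skew h₂ 1
    rw [mul_one] at e₁ e₂
    simp only [hx, mul_add, Algebra.TensorProduct.tmul_mul_tmul, one_mul, mul_one, e₁, e₂, hn,
      mul_smul_comm, TensorProduct.tmul_smul, ← TensorProduct.smul_tmul']
    abel
  have hρ : ∀ z, tau C₁ C₂ (t ⊗ₜ s₂) (TensorProduct.map C₁.rho C₂.rho z) =
      4 * tau C₁ C₂ (t ⊗ₜ s₂) z := by
    intro z
    induction z with
    | zero => simp
    | add z z' h h' => simp only [map_add, h, h', mul_add]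
    | tmul c d =>
      rw [TensorProduct.map_tmul, tau_tmul, tau_tmul, ← bilin_rho_left, ← bilin_rho_left,
        C₁.rho_of_skew ht, C₂.rho_of_skew h₂, map_smul, map_smul, LinearMap.smul_apply,
        LinearMap.smul_apply, smul_eq_mul, smul_eq_mul]
      ring
  have h0 : tau C₁ C₂ ((t ⊗ₜ s₂) * x) y = 0 := by
    rw [← tau_mul_conjTensor]
    have hc : y * conjTensor C₁ C₂ x = conjTensor C₁ C₂ (x * conjTensor C₁ C₂ y) := by
      rw [conjTensor_mul, conjTensor_conjTensor]
    rw [hc, ← tau_conjTensor, conjTensor_tmul, ht, h₂, TensorProduct.neg_tmul,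
      TensorProduct.tmul_neg, neg_neg]
    have := hρ (x * conjTensor C₁ C₂ y)
    rw [hΛ, map_zero, zero_eq_mul] at this
    exact this.resolve_left (four_ne_zero_of_two_ne_zero h2)
  have hsum : ∀ z : C₁.carrier ⊗[F] C₂.carrier, (s₁ ⊗ₜ[F] (1 : C₂.carrier)) * ((t ⊗ₜ 1) * z) +
      (t ⊗ₜ 1) * ((s₁ ⊗ₜ 1) * z) = -C₁.bilin s₁ t • z := by
    intro z
    induction z with
    | zero => simp
    | add z z' h h' => simp only [mul_add, smul_add, ← h, ← h']; abel
    | tmul c d =>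
      simp only [Algebra.TensorProduct.tmul_mul_tmul, one_mul]
      rw [← TensorProduct.add_tmul, C₁.mul_add_mul_of_skew h₁ ht, TensorProduct.smul_tmul']
  have := congrArg (fun z => tau C₁ C₂ z y) (hsum x)
  simp only [map_add, LinearMap.add_apply, hl, e, h0, map_smul, LinearMap.smul_apply, hτ,
    smul_eq_mul, add_zero] at this
  exact neg_eq_zero.1 ((zero_eq_mul.1 this).resolve_right (four_ne_zero_of_two_ne_zero h2))

end TensorConverse

end CompositionAlgebra

namespace AlgebraWithInvolution.Iso

variable {k K : Type u} [Field k] [Field K] [Algebra k K] {A : AlgebraWithInvolution k}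
  {C₁ C₂ : CompositionAlgebra K} (e : (A.baseChange K).Iso (C₁.toAWI.tensor C₂.toAWI))

/-- The linear equivalence `K ⊗ A ≃ C₁ ⊗ C₂` underlying a splitting isomorphism. -/
noncomputable def tensorEquiv : K ⊗[k] A.carrier ≃ₗ[K] C₁.carrier ⊗[K] C₂.carrier :=
  e.toLinearEquiv

theorem tensorEquiv_mul (x y : K ⊗[k] A.carrier) :
    e.tensorEquiv (x * y) = e.tensorEquiv x * e.tensorEquiv y :=
  e.map_mul x y

theorem tensorEquiv_one : e.tensorEquiv 1 = 1 :=
  e.map_one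

theorem tensorEquiv_baseChange_invol (x : K ⊗[k] A.carrier) :
    e.tensorEquiv (LinearMap.baseChange K A.invol x) =
      CompositionAlgebra.conjTensor C₁ C₂ (e.tensorEquiv x) :=
  e.map_invol x

/-- The embedding of `A` in `C₁ ⊗ C₂` given by a splitting isomorphism. -/
noncomputable def embed : A.carrier →+ C₁.carrier ⊗[K] C₂.carrier :=
  e.tensorEquiv.toAddMonoidHom.comp (TensorProduct.mk k K A.carrier 1).toAddMonoidHom

theorem embed_apply (a : A.carrier) : e.embed a = e.tensorEquiv (1 ⊗ₜ a) := rfl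

theorem smul_embed (c : K) (a : A.carrier) : c • e.embed a = e.tensorEquiv (c ⊗ₜ a) := by
  rw [embed_apply, ← map_smul, TensorProduct.smul_tmul', smul_eq_mul, mul_one]

theorem embed_smul (c : k) (a : A.carrier) : e.embed (c • a) = algebraMap k K c • e.embed a := by
  rw [smul_embed, embed_apply, TensorProduct.tmul_smul, TensorProduct.smul_tmul',
    Algebra.algebraMap_eq_smul_one]

theorem embed_mul (a b : A.carrier) : e.embed (a * b) = e.embed a * e.embed b := by
  rw [embed_apply, embed_apply, embed_apply, ← tensorEquiv_mul,
    Algebra.TensorProduct.tmul_mul_tmul, one_mul]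

theorem embed_one : e.embed 1 = 1 := e.tensorEquiv_one

theorem embed_invol (a : A.carrier) :
    e.embed (A.invol a) = CompositionAlgebra.conjTensor C₁ C₂ (e.embed a) := by
  rw [embed_apply, embed_apply, ← tensorEquiv_baseChange_invol, LinearMap.baseChange_tmul]

theorem embed_injective : Function.Injective e.embed :=
  e.tensorEquiv.injective.comp (Module.FaithfullyFlat.tensorProduct_mk_injective A.carrier)

@[elab_as_elim]
theorem embed_induction {p : C₁.carrier ⊗[K] C₂.carrier → Prop} (z : C₁.carrier ⊗[K] C₂.carrier)
    (smul : ∀ (c : K) a, p (c • e.embed a)) (add : ∀ x y, p x → p y → p (x + y)) : p z := by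
  rw [← e.tensorEquiv.apply_symm_apply z]
  induction e.tensorEquiv.symm z with
  | zero => simpa using smul 0 0
  | tmul c a => simpa only [smul_embed] using smul c a
  | add x y hx hy => rw [map_add]; exact add _ _ hx hy

/-- The `K`-linear extension to `C₁ ⊗ C₂` of a linear form on `A`. -/
noncomputable def extend (f : A.carrier →ₗ[k] k) : C₁.carrier ⊗[K] C₂.carrier →ₗ[K] K :=
  (TensorProduct.AlgebraTensorModule.rid k K K).toLinearMap ∘ₗ f.baseChange K ∘ₗ
    e.tensorEquiv.symm.toLinearMap

theorem extend_embed (f : A.carrier →ₗ[k] k) (a : A.carrier) :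
    e.extend f (e.embed a) = algebraMap k K (f a) := by
  simp [extend, embed_apply, Algebra.algebraMap_eq_smul_one]

/-- The contraction `C₁ ⊗ C₂ ≃ K ⊗ A → A` along a linear form `K → k`. -/
noncomputable def contract (φ : K →ₗ[k] k) : C₁.carrier ⊗[K] C₂.carrier →+ A.carrier :=
  (((TensorProduct.lid k A.carrier).toLinearMap ∘ₗ φ.rTensor A.carrier).toAddMonoidHom).comp
    e.tensorEquiv.symm.toAddMonoidHom

theorem contract_smul_embed (φ : K →ₗ[k] k) (c : K) (a : A.carrier) :
    e.contract φ (c • e.embed a) = φ c • a := by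
  rw [smul_embed]
  simp [contract]

theorem contract_embed (φ : K →ₗ[k] k) (a : A.carrier) :
    e.contract φ (e.embed a) = φ 1 • a := by
  rw [← e.contract_smul_embed, one_smul]

theorem contract_embed_mul (φ : K →ₗ[k] k) (a : A.carrier) (z : C₁.carrier ⊗[K] C₂.carrier) :
    e.contract φ (e.embed a * z) = a * e.contract φ z := by
  induction z using e.embed_induction with
  | smul c b =>
    rw [mul_smul_comm, ← embed_mul, contract_smul_embed, contract_smul_embed, mul_smul_comm]
  | add x y hx hy => rw [mul_add, map_add, map_add, mul_add, hx, hy]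

theorem contract_mul_embed (φ : K →ₗ[k] k) (a : A.carrier) (z : C₁.carrier ⊗[K] C₂.carrier) :
    e.contract φ (z * e.embed a) = e.contract φ z * a := by
  induction z using e.embed_induction with
  | smul c b =>
    rw [smul_mul_assoc, ← embed_mul, contract_smul_embed, contract_smul_embed, smul_mul_assoc]
  | add x y hx hy => rw [add_mul, map_add, map_add, add_mul, hx, hy]

theorem contract_conjTensor (φ : K →ₗ[k] k) (z : C₁.carrier ⊗[K] C₂.carrier) :
    e.contract φ (CompositionAlgebra.conjTensor C₁ C₂ z) = A.invol (e.contract φ z) := by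
  induction z using e.embed_induction with
  | smul c b =>
    rw [map_smul, ← embed_invol, contract_smul_embed, contract_smul_embed, map_smul]
  | add x y hx hy => rw [map_add, map_add, map_add, map_add, hx, hy]

theorem apply_extend (φ : K →ₗ[k] k) (f : A.carrier →ₗ[k] k) (z : C₁.carrier ⊗[K] C₂.carrier) :
    φ (e.extend f z) = f (e.contract φ z) := by
  induction z using e.embed_induction with
  | smul c b =>
    rw [(e.extend f).map_smul, extend_embed, contract_smul_embed, f.map_smul, smul_eq_mul,
      smul_eq_mul, mul_comm, ← Algebra.smul_def, φ.map_smul, smul_eq_mul, mul_comm]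
  | add x y hx hy => rw [map_add, map_add, map_add, map_add, hx, hy]

open Classical in
theorem eq_zero_of_contract {z : C₁.carrier ⊗[K] C₂.carrier}
    (h : ∀ φ : K →ₗ[k] k, e.contract φ z = 0) : z = 0 := by
  rw [← e.tensorEquiv.symm.map_eq_zero_iff]
  let b := Basis.ofVectorSpace k K
  refine (TensorProduct.equivFinsuppOfBasisLeft (N := A.carrier) b).injective ?_
  rw [map_zero]
  exact Finsupp.ext fun i =>
    (TensorProduct.equivFinsuppOfBasisLeft_apply b _ i).trans (h (b.coord i))

theorem exists_contract_ne_zero {z : C₁.carrier ⊗[K] C₂.carrier} (hz : z ≠ 0) :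
    ∃ φ : K →ₗ[k] k, e.contract φ z ≠ 0 := by
  by_contra! h
  exact hz (e.eq_zero_of_contract h)

include e in
theorem finrank_eq : finrank k A.carrier = finrank K C₁.carrier * finrank K C₂.carrier := by
  rw [← finrank_tensorProduct (R := K) (S := K), ← e.tensorEquiv.finrank_eq, finrank_baseChange]

omit A C₁ C₂ e in
theorem exists_apply_one : ∃ φ : K →ₗ[k] k, φ 1 = 1 := by
  exact Projective.exists_dual_eq_one k one_ne_zero

theorem linearIndependent_embed {ι : Type*} {v : ι → A.carrier} (hv : LinearIndependent k v) :
    LinearIndependent K fun i => e.embed (v i) :=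
  (Module.Flat.linearIndependent_one_tmul (S := K) hv).map' e.tensorEquiv.toLinearMap e.tensorEquiv.ker

/-- The splitting obtained by exchanging the two tensor factors. -/
noncomputable def flip : (A.baseChange K).Iso (C₂.toAWI.tensor C₁.toAWI) where
  toLinearEquiv := e.tensorEquiv.trans (CompositionAlgebra.flipTensor C₁ C₂)
  map_mul x y := by
    refine (congrArg (CompositionAlgebra.flipTensor C₁ C₂) (e.tensorEquiv_mul x y)).trans ?_
    exact CompositionAlgebra.flipTensor_mul (C₁ := C₁) (C₂ := C₂) _ _
  map_one := congrArg (CompositionAlgebra.flipTensor C₁ C₂) e.tensorEquiv_one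
  map_invol x := by
    refine (congrArg (CompositionAlgebra.flipTensor C₁ C₂)
      (e.tensorEquiv_baseChange_invol x)).trans ?_
    exact (CompositionAlgebra.conjTensor_flipTensor _).symm

end AlgebraWithInvolution.Iso

namespace CompositionAlgebra

variable {F : Type u} [Field F] {C₁ C₂ : CompositionAlgebra F}

/-- The partial conjugation `a ⊗ b ↦ a ⊗ b̄` of `C₁ ⊗ C₂`. -/
noncomputable def dagger (C₁ C₂ : CompositionAlgebra F) :
    C₁.carrier ⊗[F] C₂.carrier →ₗ[F] C₁.carrier ⊗[F] C₂.carrier :=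
  TensorProduct.map LinearMap.id C₂.conj

theorem dagger_tmul (a : C₁.carrier) (b : C₂.carrier) :
    dagger C₁ C₂ (a ⊗ₜ b) = a ⊗ₜ C₂.conj b := rfl

theorem dagger_dagger (x : C₁.carrier ⊗[F] C₂.carrier) : dagger C₁ C₂ (dagger C₁ C₂ x) = x := by
  induction x with
  | zero => simp
  | add x y hx hy => rw [map_add, map_add, hx, hy]
  | tmul a b => rw [dagger_tmul, dagger_tmul, C₂.conj_conj]

theorem dagger_tmul_one (s : C₁.carrier) : dagger C₁ C₂ (s ⊗ₜ 1) = s ⊗ₜ 1 := by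
  rw [dagger_tmul, C₂.conj_one]

theorem dagger_one_tmul {t : C₂.carrier} (ht : C₂.conj t = -t) :
    dagger C₁ C₂ (1 ⊗ₜ t) = -(1 ⊗ₜ t) := by
  rw [dagger_tmul, ht, TensorProduct.tmul_neg]

theorem conjTensor_tmul_one {s : C₁.carrier} (hs : C₁.conj s = -s) :
    conjTensor C₁ C₂ (s ⊗ₜ 1) = -(s ⊗ₜ 1) := by
  rw [conjTensor_tmul, hs, C₂.conj_one, TensorProduct.neg_tmul]

theorem conjTensor_one_tmul {t : C₂.carrier} (ht : C₂.conj t = -t) :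
    conjTensor C₁ C₂ (1 ⊗ₜ t) = -(1 ⊗ₜ t) := by
  rw [conjTensor_tmul, ht, C₁.conj_one, TensorProduct.tmul_neg]

theorem tmul_one_mul_one_tmul_mul (s : C₁.carrier) (t : C₂.carrier)
    (x : C₁.carrier ⊗[F] C₂.carrier) :
    (s ⊗ₜ[F] (1 : C₂.carrier)) * (((1 : C₁.carrier) ⊗ₜ[F] t) * x) = (s ⊗ₜ t) * x := by
  induction x with
  | zero => simp
  | add x y hx hy => simp only [mul_add, hx, hy]
  | tmul a b => simp [Algebra.TensorProduct.tmul_mul_tmul]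

theorem one_tmul_mul_tmul_one_mul (s : C₁.carrier) (t : C₂.carrier)
    (x : C₁.carrier ⊗[F] C₂.carrier) :
    ((1 : C₁.carrier) ⊗ₜ[F] t) * ((s ⊗ₜ[F] (1 : C₂.carrier)) * x) = (s ⊗ₜ t) * x := by
  induction x with
  | zero => simp
  | add x y hx hy => simp only [mul_add, hx, hy]
  | tmul a b => simp [Algebra.TensorProduct.tmul_mul_tmul]

theorem tmul_one_mul_self_mul {s : C₁.carrier} (hs : C₁.conj s = -s)
    (x : C₁.carrier ⊗[F] C₂.carrier) :
    (s ⊗ₜ[F] (1 : C₂.carrier)) * ((s ⊗ₜ 1) * x) = -C₁.norm s • x := by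
  induction x with
  | zero => simp
  | add x y hx hy => simp only [mul_add, hx, hy, smul_add]
  | tmul a b =>
    simp [Algebra.TensorProduct.tmul_mul_tmul, C₁.mul_self_of_skew hs, TensorProduct.neg_tmul,
      TensorProduct.smul_tmul']

theorem one_tmul_mul_self_mul {t : C₂.carrier} (ht : C₂.conj t = -t)
    (x : C₁.carrier ⊗[F] C₂.carrier) :
    ((1 : C₁.carrier) ⊗ₜ[F] t) * ((1 ⊗ₜ t) * x) = -C₂.norm t • x := by
  induction x with
  | zero => simp
  | add x y hx hy => simp only [mul_add, hx, hy, smul_add]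
  | tmul a b =>
    simp [Algebra.TensorProduct.tmul_mul_tmul, C₂.mul_self_of_skew ht, TensorProduct.tmul_neg]

section Skew

variable {s : C₁.carrier} {t : C₂.carrier} (hs : C₁.conj s = -s) (ht : C₂.conj t = -t)
include hs ht

theorem mul_dagger_mul_of_skew (x : C₁.carrier ⊗[F] C₂.carrier) :
    (s ⊗ₜ[F] (1 : C₂.carrier) + 1 ⊗ₜ t) * (dagger C₁ C₂ (s ⊗ₜ 1 + 1 ⊗ₜ t) * x) =
      -(C₁.norm s - C₂.norm t) • x := by
  rw [map_add, dagger_tmul_one, dagger_one_tmul ht]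
  simp only [add_mul, mul_add, neg_mul, mul_neg, tmul_one_mul_self_mul hs,
    one_tmul_mul_self_mul ht, tmul_one_mul_one_tmul_mul, one_tmul_mul_tmul_one_mul]
  module

theorem dagger_mul_mul_of_skew (x : C₁.carrier ⊗[F] C₂.carrier) :
    dagger C₁ C₂ (s ⊗ₜ[F] (1 : C₂.carrier) + 1 ⊗ₜ t) * ((s ⊗ₜ 1 + 1 ⊗ₜ t) * x) =
      -(C₁.norm s - C₂.norm t) • x := by
  rw [map_add, dagger_tmul_one, dagger_one_tmul ht]
  simp only [add_mul, mul_add, neg_mul, tmul_one_mul_self_mul hs,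
    one_tmul_mul_self_mul ht, tmul_one_mul_one_tmul_mul, one_tmul_mul_tmul_one_mul]
  module

end Skew

theorem eq_zero_of_tmul_one_add_one_tmul (h2 : (2 : F) ≠ 0) {s : C₁.carrier} {t : C₂.carrier}
    (ht : C₂.conj t = -t) (h : s ⊗ₜ[F] (1 : C₂.carrier) + 1 ⊗ₜ t = 0) : s = 0 := by
  refine C₁.bilin_nondegenerate fun a => ?_
  have := congrArg (fun x => tau C₁ C₂ x (a ⊗ₜ 1)) h
  simp only [map_add, LinearMap.add_apply, tau_tmul, (C₂.conj_eq_neg_iff h2 t).1 ht, mul_zero,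
    add_zero, map_zero, LinearMap.zero_apply, bilin_one_one] at this
  exact (mul_eq_zero.1 this).resolve_right h2

end CompositionAlgebra

namespace AlgebraWithInvolution.Iso

open CompositionAlgebra

variable {k K : Type u} [Field k] [Field K] [Algebra k K] {A : AlgebraWithInvolution k}
  {C₁ C₂ : CompositionAlgebra K} (e : (A.baseChange K).Iso (C₁.toAWI.tensor C₂.toAWI))

theorem embed_skew (s : A.skew) : conjTensor C₁ C₂ (e.embed s) = -e.embed s := by
  rw [← embed_invol, ← map_neg]
  exact congrArg e.embed s.2

variable (h2 : (2 : K) ≠ 0)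
include h2

theorem mem_span_of_skew {x : C₁.carrier ⊗[K] C₂.carrier} (hx : conjTensor C₁ C₂ x = -x) :
    x ∈ Submodule.span K (Set.range fun s : A.skew => e.embed s) := by
  have key : ∀ w, w - conjTensor C₁ C₂ w ∈
      Submodule.span K (Set.range fun s : A.skew => e.embed s) := by
    intro w
    induction w using e.embed_induction with
    | smul c a =>
      rw [map_smul, ← embed_invol, ← smul_sub, ← map_sub]
      refine Submodule.smul_mem _ _ (Submodule.subset_span ⟨⟨a - A.invol a, ?_⟩, rfl⟩)
      change A.invol (a - A.invol a) = -(a - A.invol a)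
      rw [map_sub, A.invol_invol, neg_sub]
    | add x y hx hy =>
      rw [map_add, add_sub_add_comm]
      exact add_mem hx hy
  have h := Submodule.smul_mem _ (2 : K)⁻¹ (key x)
  rwa [hx, sub_neg_eq_add, ← two_smul K, smul_smul, inv_mul_cancel₀ h2, one_smul] at h

include e in
theorem finrank_add_finrank_le [FiniteDimensional k A.carrier] :
    finrank K C₁.carrier + finrank K C₂.carrier ≤ finrank k A.skew + 2 := by
  have hU : ∀ C : CompositionAlgebra K,
      finrank K C.carrier ≤ finrank K (LinearMap.ker (C.bilin 1)) + 1 := by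
    intro C
    rw [← (C.bilin 1).finrank_range_add_finrank_ker, add_comm]
    refine Nat.add_le_add_left ((Submodule.finrank_le _).trans (finrank_self K).le) _
  have hmem : ∀ (C : CompositionAlgebra K) (s : LinearMap.ker (C.bilin 1)),
      C.conj s = -s := fun C s => (C.conj_eq_neg_iff h2 s).2 ((C.bilin_comm _ _).trans s.2)
  let W := Submodule.span K (Set.range fun s : A.skew => e.embed s)
  let L : LinearMap.ker (C₁.bilin 1) × LinearMap.ker (C₂.bilin 1) →ₗ[K] W :=
    LinearMap.codRestrict W (((TensorProduct.mk K C₁.carrier C₂.carrier).flip 1 ∘ₗ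
      Submodule.subtype _).coprod (TensorProduct.mk K C₁.carrier C₂.carrier 1 ∘ₗ
      Submodule.subtype _)) fun p => e.mem_span_of_skew h2 (by
        change conjTensor C₁ C₂ ((p.1 : C₁.carrier) ⊗ₜ 1 + 1 ⊗ₜ (p.2 : C₂.carrier)) =
          -((p.1 : C₁.carrier) ⊗ₜ 1 + 1 ⊗ₜ (p.2 : C₂.carrier))
        rw [map_add, conjTensor_tmul_one (hmem _ _), conjTensor_one_tmul (hmem _ _), neg_add])
  have hL : Function.Injective L := by
    rw [← LinearMap.ker_eq_bot, LinearMap.ker_eq_bot']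
    rintro ⟨s, t⟩ hst
    have h : (s : C₁.carrier) ⊗ₜ[K] (1 : C₂.carrier) + 1 ⊗ₜ (t : C₂.carrier) = 0 :=
      congrArg Subtype.val hst
    have hs : s = 0 := Subtype.ext (eq_zero_of_tmul_one_add_one_tmul h2 (hmem _ t) h)
    have h' := congrArg (flipTensor C₁ C₂) h
    rw [map_add, map_zero, TensorProduct.comm_tmul, TensorProduct.comm_tmul, add_comm] at h'
    have ht : t = 0 := Subtype.ext (eq_zero_of_tmul_one_add_one_tmul h2 (hmem _ s) h')
    rw [hs, ht]; rfl
  have hWle : finrank K W ≤ finrank k A.skew := by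
    let b := finBasis k A.skew
    have : W ≤ Submodule.span K (Set.range fun i => e.embed (b i)) := by
      refine Submodule.span_le.2 ?_
      rintro _ ⟨s, rfl⟩
      change e.embed s ∈ _
      have hs : (s : A.carrier) = ∑ i, b.repr s i • (b i : A.carrier) := by
        simpa [-Basis.sum_repr] using (congrArg (Submodule.subtype _) (b.sum_repr s)).symm
      rw [hs, map_sum]
      refine sum_mem fun i _ => ?_
      rw [embed_smul]
      exact Submodule.smul_mem _ _ (Submodule.subset_span ⟨i, rfl⟩)
    refine (Submodule.finrank_mono this).trans ((finrank_range_le_card _).trans ?_)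
    simp
  have := LinearMap.finrank_le_finrank_of_injective hL
  rw [finrank_prod] at this
  have h₁ := hU C₁
  have h₂ := hU C₂
  omega

end AlgebraWithInvolution.Iso

namespace AlgebraWithInvolution.Iso

open CompositionAlgebra

variable {k K : Type u} [Field k] [Field K] [Algebra k K] {A : AlgebraWithInvolution k}
  {C₁ C₂ : CompositionAlgebra K} (e : (A.baseChange K).Iso (C₁.toAWI.tensor C₂.toAWI))

theorem linearIndependent_dagger_embed {s t : A.carrier} (h : LinearIndependent k ![s, t]) :
    LinearIndependent K ![dagger C₁ C₂ (e.embed s), dagger C₁ C₂ (e.embed t)] := by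
  have h' := (e.linearIndependent_embed h).map' (dagger C₁ C₂)
    (LinearMap.ker_eq_bot.2 (Function.LeftInverse.injective dagger_dagger))
  have heq : ![dagger C₁ C₂ (e.embed s), dagger C₁ C₂ (e.embed t)] =
      dagger C₁ C₂ ∘ fun i => e.embed (![s, t] i) := by
    funext i
    fin_cases i <;> rfl
  rw [heq]
  exact h'

variable (h2 : (2 : K) ≠ 0) (Φ : AlbertForm A)
include h2

theorem norm_eq_norm_of_albertForm_eq_zero [FiniteDimensional k A.carrier] {s : A.skew}
    (hs : Φ.Q s = 0) :
    ∃ s₁ s₂, C₁.conj s₁ = -s₁ ∧ C₂.conj s₂ = -s₂ ∧ e.embed s = s₁ ⊗ₜ 1 + 1 ⊗ₜ s₂ ∧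
      C₁.norm s₁ = C₂.norm s₂ := by
  obtain ⟨s₁, s₂, h₁, h₂, h⟩ := exists_eq_tmul_add_tmul_of_skew C₁ C₂ h2 (e.embed_skew s)
  refine ⟨s₁, s₂, h₁, h₂, h, ?_⟩
  by_contra hn
  refine (Φ.nonzero_iff s).not.1 (not_not.2 hs) ?_
  have hinj : Function.Injective (LinearMap.mulLeft k (s : A.carrier)) := by
    rw [← LinearMap.ker_eq_bot, LinearMap.ker_eq_bot']
    intro a ha
    rw [LinearMap.mulLeft_apply] at ha
    have := dagger_mul_mul_of_skew h₁ h₂ (e.embed a)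
    rw [← h, ← embed_mul, ha, map_zero, mul_zero] at this
    refine e.embed_injective ?_
    rw [map_zero]
    exact (smul_eq_zero.1 this.symm).resolve_left (neg_ne_zero.2 (sub_ne_zero.2 hn))
  exact ⟨hinj, LinearMap.injective_iff_surjective.1 hinj⟩

variable {Φ} (hQ : Φ.Q.Anisotropic)
include hQ

theorem exists_embed_natMap_eq_smul {s : A.skew} (hs : s ≠ 0) :
    ∃ γ : K, γ ≠ 0 ∧ e.embed (Φ.natMap s) = γ • dagger C₁ C₂ (e.embed s) := by
  obtain ⟨s₁, s₂, h₁, h₂, h⟩ := exists_eq_tmul_add_tmul_of_skew C₁ C₂ h2 (e.embed_skew s)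
  have hQs : algebraMap k K (Φ.Q s) ≠ 0 := by
    rw [Ne, FaithfulSMul.algebraMap_eq_zero_iff]
    exact fun h => hs (hQ s h)
  have hinj : ∀ z, e.embed s * z = 0 → z = 0 := by
    intro z hz
    have hz' : ∀ z, e.embed (Φ.natMap s) * (e.embed s * z) = -algebraMap k K (Φ.Q s) • z := by
      intro z
      induction z using e.embed_induction with
      | smul c a =>
        rw [mul_smul_comm, mul_smul_comm, ← embed_mul, ← embed_mul, Φ.natMap_mul hQ, embed_smul,
          map_neg, smul_comm]
      | add x y hx hy => rw [mul_add, mul_add, hx, hy, smul_add]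
    have := hz' z
    rw [hz, mul_zero] at this
    exact (smul_eq_zero.1 this.symm).resolve_left (neg_ne_zero.2 hQs)
  have h₃ : e.embed s * dagger C₁ C₂ (e.embed s) = -(C₁.norm s₁ - C₂.norm s₂) • 1 := by
    have := mul_dagger_mul_of_skew h₁ h₂ 1
    rwa [← h, mul_one] at this
  have h₄ : e.embed s * e.embed (Φ.natMap s) = -algebraMap k K (Φ.Q s) • 1 := by
    have := congrArg e.embed (Φ.mul_natMap s 1)
    rwa [mul_one, embed_mul, embed_smul, embed_one, map_neg] at this
  have hd : C₁.norm s₁ - C₂.norm s₂ ≠ 0 := by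
    intro hd
    rw [hd, neg_zero, zero_smul] at h₃
    have h₅ := congrArg (dagger C₁ C₂) (hinj _ h₃)
    rw [dagger_dagger, map_zero, ← map_zero e.embed] at h₅
    exact hs (Subtype.ext (e.embed_injective h₅))
  refine ⟨(C₁.norm s₁ - C₂.norm s₂)⁻¹ * algebraMap k K (Φ.Q s),
    mul_ne_zero (inv_ne_zero hd) hQs, ?_⟩
  rw [mul_smul, eq_inv_smul_iff₀ hd]
  refine sub_eq_zero.1 (hinj _ ?_)
  rw [mul_sub, mul_smul_comm, mul_smul_comm, h₃, h₄]
  module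

theorem exists_embed_natMap_eq :
    ∃ γ : K, γ ≠ 0 ∧ ∀ s : A.skew, e.embed (Φ.natMap s) = γ • dagger C₁ C₂ (e.embed s) := by
  by_cases h0 : ∀ s : A.skew, s = 0
  · exact ⟨1, one_ne_zero, fun s => by simp [h0 s]⟩
  push Not at h0
  obtain ⟨s, hs⟩ := h0
  obtain ⟨γ, hγ, hγs⟩ := e.exists_embed_natMap_eq_smul h2 hQ hs
  refine ⟨γ, hγ, fun t => ?_⟩
  by_cases hst : LinearIndependent k ![s, t]
  · have ht : t ≠ 0 := hst.ne_zero 1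
    have hst0 : s + t ≠ 0 := by
      intro h
      have := LinearIndependent.pair_iff.1 hst 1 1 (by simpa using h)
      exact one_ne_zero this.1
    obtain ⟨δ, -, hδ⟩ := e.exists_embed_natMap_eq_smul h2 hQ ht
    obtain ⟨ε, -, hε⟩ := e.exists_embed_natMap_eq_smul h2 hQ hst0
    have hst' : LinearIndependent k ![(s : A.carrier), t] := by
      have := hst.map' A.skew.subtype A.skew.ker_subtype
      have heq : ![(s : A.carrier), t] = A.skew.subtype ∘ ![s, t] := by
        funext i
        fin_cases i <;> rfl
      rw [heq]
      exact this
    have hli := LinearIndependent.pair_iff.1 (e.linearIndependent_dagger_embed hst')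
      (γ - ε) (δ - ε) (by
        rw [map_add, Submodule.coe_add, Submodule.coe_add, map_add, map_add, map_add, hγs, hδ]
          at hε
        rw [sub_smul, sub_smul]
        linear_combination (norm := module) hε)
    rw [hδ, sub_eq_zero.1 hli.1, sub_eq_zero.1 hli.2]
  · have : ∃ c : k, c • s = t := by
      rw [LinearIndependent.pair_iff' hs] at hst
      push Not at hst
      exact hst
    obtain ⟨c, rfl⟩ := this
    rw [map_smul, Submodule.coe_smul, Submodule.coe_smul, embed_smul, embed_smul, map_smul, hγs,
      smul_comm]

theorem extend_mul_dagger_comm {f : A.carrier →ₗ[k] k} {x : A.carrier}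
    (hf : ∀ s t : A.skew, f (s * ((Φ.natMap t : A.carrier) * x)) =
      f (t * ((Φ.natMap s : A.carrier) * x)))
    {u v : C₁.carrier ⊗[K] C₂.carrier} (hu : conjTensor C₁ C₂ u = -u)
    (hv : conjTensor C₁ C₂ v = -v) :
    e.extend f (u * (dagger C₁ C₂ v * e.embed x)) =
      e.extend f (v * (dagger C₁ C₂ u * e.embed x)) := by
  obtain ⟨γ, hγ, hγs⟩ := e.exists_embed_natMap_eq h2 hQ
  replace hu := e.mem_span_of_skew h2 hu
  replace hv := e.mem_span_of_skew h2 hv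
  induction hu using Submodule.span_induction with
  | zero => simp
  | add u u' _ _ hu hu' => simp only [add_mul, mul_add, map_add, hu, hu']
  | smul c u _ hu => simp only [smul_mul_assoc, mul_smul_comm, map_smul, hu]
  | mem u hu =>
    obtain ⟨s, rfl⟩ := hu
    induction hv using Submodule.span_induction with
    | zero => simp
    | add u u' _ _ hu hu' => simp only [add_mul, mul_add, map_add, hu, hu']
    | smul c u _ hu => simp only [smul_mul_assoc, mul_smul_comm, map_smul, hu]
    | mem v hv =>
      obtain ⟨t, rfl⟩ := hv
      have key : ∀ s t : A.skew,
          e.extend f (e.embed s * (dagger C₁ C₂ (e.embed t) * e.embed x)) =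
            γ⁻¹ * algebraMap k K (f (s * ((Φ.natMap t : A.carrier) * x))) := by
        intro s t
        rw [← extend_embed, embed_mul, embed_mul, hγs, smul_mul_assoc, mul_smul_comm, map_smul,
          smul_eq_mul, inv_mul_cancel_left₀ hγ]
      rw [key, key, hf]

end AlgebraWithInvolution.Iso

namespace AlgebraWithInvolution.Iso

open CompositionAlgebra

variable {k K : Type u} [Field k] [Field K] [Algebra k K] {A : AlgebraWithInvolution k}
  {C₁ C₂ : CompositionAlgebra K} (e : (A.baseChange K).Iso (C₁.toAWI.tensor C₂.toAWI))
  (hm₁ : finrank K C₁.carrier ∈ ({1, 2, 4, 8} : Set ℕ))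
  (hm₂ : finrank K C₂.carrier ∈ ({1, 2, 4, 8} : Set ℕ))
include e hm₁ hm₂

theorem finiteDimensional : FiniteDimensional k A.carrier := by
  refine Module.finite_of_finrank_pos ?_
  rw [e.finrank_eq]
  rcases hm₁ with h | h | h | h <;> rcases hm₂ with h' | h' | h' | h' <;> rw [h, h'] <;> norm_num

theorem exists_tau_eq_four (hk2 : (2 : k) ≠ 0) (hk3 : (3 : k) ≠ 0) {Φ : AlbertForm A}
    (hQ : Φ.Q.Anisotropic) (N : Submodule k A.carrier)
    (hN : ∀ b ∈ N, (∀ (s : A.skew) (a : A.carrier), (s : A.carrier) * (a * b) = s * a * b) ∧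
      ∃ β : k, (β = 0 ∨ ¬ IsSquare β) ∧ ∀ a, a * b * b = β • a)
    {x : A.carrier} (hx : x ≠ 0) :
    ∃ y, tau C₁ C₂ (e.embed x) y = 4 ∧
      (∀ s t, C₁.conj s = -s → C₂.conj t = -t → tau C₁ C₂ ((s ⊗ₜ t) * e.embed x) y = 0) ∧
      (∀ s t, C₁.conj s = -s → C₁.conj t = -t →
        tau C₁ C₂ ((s ⊗ₜ 1) * ((t ⊗ₜ 1) * e.embed x) - (t ⊗ₜ 1) * ((s ⊗ₜ 1) * e.embed x)) y = 0) ∧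
      (∀ s t, C₂.conj s = -s → C₂.conj t = -t →
        tau C₁ C₂ ((1 ⊗ₜ s) * ((1 ⊗ₜ t) * e.embed x) - (1 ⊗ₜ t) * ((1 ⊗ₜ s) * e.embed x)) y = 0) ∧
      ∀ z, (∀ φ : K →ₗ[k] k, e.contract φ z ∈ N) → tau C₁ C₂ (e.embed x * z) y = 0 := by
  have h2 : (2 : K) ≠ 0 := two_ne_zero_of_algebra k K hk2
  have := e.finiteDimensional hm₁ hm₂
  have hS := e.finrank_add_finrank_le h2
  obtain ⟨f, hfx, hf, hfN⟩ := Φ.exists_functional hk2 hk3 hQ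
    ((finrank K C₁.carrier + finrank K C₂.carrier - 2) / 2) (by omega) (by
      rw [e.finrank_eq]
      rcases hm₁ with h | h | h | h <;> rcases hm₂ with h' | h' | h' | h' <;> rw [h, h'] <;>
        norm_num) N hN hx
  obtain ⟨y, hy⟩ := exists_tau_eq C₁ C₂ ((4 : K) • e.extend f)
  have hG : ∀ u v, conjTensor C₁ C₂ u = -u → conjTensor C₁ C₂ v = -v →
      tau C₁ C₂ (u * (dagger C₁ C₂ v * e.embed x) - v * (dagger C₁ C₂ u * e.embed x)) y = 0 := by
    intro u v hu hv
    rw [← hy, LinearMap.smul_apply, map_sub, e.extend_mul_dagger_comm h2 hQ hf hu hv, sub_self,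
      smul_zero]
  refine ⟨y, ?_, fun s t hs ht => ?_, fun s t hs ht => ?_, fun s t hs ht => ?_, fun z hz => ?_⟩
  · rw [← hy, LinearMap.smul_apply, extend_embed, hfx, _root_.map_one, smul_eq_mul, mul_one]
  · have := hG _ _ (conjTensor_tmul_one hs) (conjTensor_one_tmul ht)
    rw [dagger_one_tmul ht, dagger_tmul_one, neg_mul, mul_neg, tmul_one_mul_one_tmul_mul,
      one_tmul_mul_tmul_one_mul, map_sub, map_neg, LinearMap.sub_apply, LinearMap.neg_apply] at this
    refine (mul_eq_zero.1 (?_ : (2 : K) * _ = 0)).resolve_left h2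
    linear_combination -this
  · have := hG _ _ (conjTensor_tmul_one hs) (conjTensor_tmul_one ht)
    rwa [dagger_tmul_one, dagger_tmul_one] at this
  · have := hG _ _ (conjTensor_one_tmul ht) (conjTensor_one_tmul hs)
    rw [dagger_one_tmul ht, dagger_one_tmul hs, neg_mul, neg_mul, mul_neg, mul_neg] at this
    rwa [neg_sub_neg] at this
  · rw [← hy, LinearMap.smul_apply]
    have : e.extend f (e.embed x * z) = 0 := by
      rw [← Module.forall_dual_apply_eq_zero_iff k]
      intro φ
      rw [apply_extend, contract_embed_mul, hfN _ (hz φ)]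
    rw [this, smul_zero]

end AlgebraWithInvolution.Iso

namespace CompositionAlgebra

variable {F : Type u} [Field F] {C₁ C₂ : CompositionAlgebra F}

theorem tmul_one_mul_assoc (h4 : finrank F C₁.carrier ≤ 4) (s : C₁.carrier)
    (x y : C₁.carrier ⊗[F] C₂.carrier) :
    (s ⊗ₜ[F] (1 : C₂.carrier)) * (x * y) = (s ⊗ₜ 1) * x * y := by
  induction x, y using tmul_induction₂ with
  | zero_left | zero_right => simp
  | add_left x x' y h h' => simp only [add_mul, mul_add, h, h']
  | add_right x y y' h h' => simp only [mul_add, h, h']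
  | tmul a b c d =>
    simp only [Algebra.TensorProduct.tmul_mul_tmul, one_mul, C₁.mul_assoc_of_finrank_le_four h4]

theorem mul_mul_tmul_one (h4 : finrank F C₁.carrier ≤ 4) (s : C₁.carrier)
    (x y : C₁.carrier ⊗[F] C₂.carrier) :
    x * (y * (s ⊗ₜ[F] (1 : C₂.carrier))) = x * y * (s ⊗ₜ 1) := by
  induction x, y using tmul_induction₂ with
  | zero_left | zero_right => simp
  | add_left x x' y h h' => simp only [add_mul, h, h']
  | add_right x y y' h h' => simp only [mul_add, add_mul, h, h']
  | tmul a b c d =>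
    simp only [Algebra.TensorProduct.tmul_mul_tmul, mul_one, C₁.mul_assoc_of_finrank_le_four h4]

theorem tensor_mul_assoc (h4₁ : finrank F C₁.carrier ≤ 4) (h4₂ : finrank F C₂.carrier ≤ 4)
    (x y z : C₁.carrier ⊗[F] C₂.carrier) : x * y * z = x * (y * z) := by
  induction z with
  | zero => simp
  | add z z' h h' => simp only [mul_add, h, h']
  | tmul c d =>
    induction x, y using tmul_induction₂ with
    | zero_left | zero_right => simp
    | add_left x x' y h h' => simp only [add_mul, h, h']
    | add_right x y y' h h' => simp only [mul_add, add_mul, h, h']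
    | tmul a b c d =>
      simp only [Algebra.TensorProduct.tmul_mul_tmul, C₁.mul_assoc_of_finrank_le_four h4₁,
        C₂.mul_assoc_of_finrank_le_four h4₂]

theorem eq_zero_of_one_tmul_eq_zero (h2 : (2 : F) ≠ 0) {b : C₂.carrier}
    (h : (1 : C₁.carrier) ⊗ₜ[F] b = 0) : b = 0 := by
  refine C₂.bilin_nondegenerate fun a => ?_
  have := congrArg (fun x => tau C₁ C₂ x (1 ⊗ₜ a)) h
  simp only [tau_tmul, map_zero, LinearMap.zero_apply, bilin_one_one] at this
  exact (mul_eq_zero.1 this).resolve_left h2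

end CompositionAlgebra

namespace AlgebraWithInvolution.Iso

open CompositionAlgebra

variable {k K : Type u} [Field k] [Field K] [Algebra k K] {A : AlgebraWithInvolution k}
  {C₁ C₂ : CompositionAlgebra K} (e : (A.baseChange K).Iso (C₁.toAWI.tensor C₂.toAWI))

include e in
theorem mul_assoc_of_finrank_le_four (h4₁ : finrank K C₁.carrier ≤ 4)
    (h4₂ : finrank K C₂.carrier ≤ 4) (a b c : A.carrier) : a * b * c = a * (b * c) := by
  refine e.embed_injective ?_
  simp only [embed_mul, tensor_mul_assoc h4₁ h4₂]

include e in
theorem conjInvertible_of_finrank_le_four (hm₁ : finrank K C₁.carrier ∈ ({1, 2, 4, 8} : Set ℕ))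
    (hm₂ : finrank K C₂.carrier ∈ ({1, 2, 4, 8} : Set ℕ)) (hk2 : (2 : k) ≠ 0) (hk3 : (3 : k) ≠ 0)
    {Φ : AlbertForm A} (hQ : Φ.Q.Anisotropic)
    (hZ : ∀ a ∈ Set.center A.carrier, a ≠ 0 → ∃ b ∈ Set.center A.carrier, a * b = 1 ∧ b * a = 1)
    (h4₁ : finrank K C₁.carrier ≤ 4) (h4₂ : finrank K C₂.carrier ≤ 4) {x : A.carrier}
    (hx : x ≠ 0) : A.ConjInvertible x := by
  have h2 : (2 : K) ≠ 0 := two_ne_zero_of_algebra k K hk2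
  have := e.finiteDimensional hm₁ hm₂
  have hassoc := e.mul_assoc_of_finrank_le_four h4₁ h4₂
  obtain ⟨y, hy, h, hl₁, hl₂, -⟩ := e.exists_tau_eq_four hm₁ hm₂ hk2 hk3 hQ ⊥
    (fun b hb => by
      rw [(Submodule.mem_bot k).1 hb]
      exact ⟨by simp, 0, Or.inl rfl, by simp⟩) hx
  have hcomm := commute_mul_conjTensor h2 h4₁ h4₂ h hl₁ hl₂
  have hP : y * conjTensor C₁ C₂ (e.embed x) ≠ 0 := by
    intro hP
    have := tau_mul_conjTensor C₁ C₂ 1 1 (e.embed x) y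
    rw [hP, map_zero, ← Algebra.TensorProduct.one_def, one_mul, hy] at this
    exact four_ne_zero_of_two_ne_zero h2 this.symm
  obtain ⟨φ, hφ⟩ := e.exists_contract_ne_zero hP
  have hcenter : e.contract φ (y * conjTensor C₁ C₂ (e.embed x)) ∈ Set.center A.carrier := by
    refine ⟨fun a => ?_, fun b c => (hassoc _ b c).symm, fun a b => hassoc a b _⟩
    change _ = _
    rw [← contract_mul_embed, ← contract_embed_mul, hcomm]
  obtain ⟨b, -, -, hb⟩ := hZ _ hcenter hφ
  rw [← embed_invol, contract_mul_embed, ← hassoc] at hb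
  obtain ⟨w, hw⟩ : ∃ w, w = b * e.contract φ y := ⟨_, rfl⟩
  rw [← hw] at hb
  have h₁ : x * A.invol w = 1 := by
    have := congrArg A.invol hb
    rwa [A.invol_mul, A.invol_invol, A.invol_one] at this
  have h₂ : A.invol w * x = 1 := by
    have h₃ : LinearMap.mulLeft k x * LinearMap.mulLeft k (A.invol w) = 1 :=
      LinearMap.ext fun a => by
        simp only [Module.End.mul_apply, LinearMap.mulLeft_apply, ← hassoc, h₁, one_mul,
          Module.End.one_apply]
    have := LinearMap.congr_fun (mul_eq_one_comm.1 h₃) 1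
    simpa using this
  have h₃ : A.invol x * w = 1 := by
    have := congrArg A.invol h₂
    rwa [A.invol_mul, A.invol_invol, A.invol_one] at this
  refine ⟨w, fun z => ?_⟩
  rw [Vop, h₁, hassoc, hassoc, h₂, h₃, one_mul, mul_one, add_sub_cancel_right]

end AlgebraWithInvolution.Iso

namespace AlgebraWithInvolution

variable {k : Type u} [Field k]

/-- The skew elements `b` of `A` with `s (a b) = (s a) b` for all `s ∈ S` and `a ∈ A`. -/
def skewNucleus (A : AlgebraWithInvolution k) : Submodule k A.carrier where
  carrier := {b | b ∈ A.skew ∧ ∀ (s : A.skew) (a : A.carrier), (s : A.carrier) * (a * b) = s * a * b}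
  add_mem' {b c} hb hc := ⟨add_mem hb.1 hc.1, fun s a => by
    rw [mul_add, mul_add, mul_add, hb.2, hc.2]⟩
  zero_mem' := ⟨zero_mem _, by simp⟩
  smul_mem' c b hb := ⟨Submodule.smul_mem _ c hb.1, fun s a => by
    rw [mul_smul_comm, mul_smul_comm, mul_smul_comm, hb.2]⟩

theorem mem_skew {A : AlgebraWithInvolution k} {b : A.carrier} :
    b ∈ A.skew ↔ A.invol b = -b :=
  Iff.rfl

theorem eq_zero_of_smul_one_mem_skew (hk2 : (2 : k) ≠ 0) {A : AlgebraWithInvolution k} {c : k}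
    (h : c • (1 : A.carrier) ∈ A.skew) : c • (1 : A.carrier) = 0 := by
  rw [mem_skew, map_smul, A.invol_one] at h
  have : (2 : k) • c • (1 : A.carrier) = 0 := by
    linear_combination (norm := module) h
  exact (smul_eq_zero.1 this).resolve_left hk2

end AlgebraWithInvolution

namespace AlgebraWithInvolution.Iso

open CompositionAlgebra

variable {k K : Type u} [Field k] [Field K] [Algebra k K] {A : AlgebraWithInvolution k}
  {C₁ C₂ : CompositionAlgebra K} (e : (A.baseChange K).Iso (C₁.toAWI.tensor C₂.toAWI))

theorem flip_embed (a : A.carrier) : e.flip.embed a = flipTensor C₁ C₂ (e.embed a) := rfl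

section Nucleus

variable (h2 : (2 : K) ≠ 0) {b : A.carrier} (hb : b ∈ A.skewNucleus)
include h2 hb

theorem mul_mul_embed_of_mem_skewNucleus {u : C₁.carrier ⊗[K] C₂.carrier}
    (hu : conjTensor C₁ C₂ u = -u) (z : C₁.carrier ⊗[K] C₂.carrier) :
    u * (z * e.embed b) = u * z * e.embed b := by
  replace hu := e.mem_span_of_skew h2 hu
  induction hu using Submodule.span_induction with
  | zero => simp
  | add u u' _ _ hu hu' => simp only [add_mul, hu, hu']
  | smul c u _ hu => simp only [smul_mul_assoc, hu]
  | mem u hu =>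
    obtain ⟨s, rfl⟩ := hu
    induction z using e.embed_induction with
    | smul c a =>
      simp only [smul_mul_assoc, mul_smul_comm, ← embed_mul, hb.2]
    | add x y hx hy => simp only [add_mul, mul_add, hx, hy]

theorem right_eq_zero_of_mem_skewNucleus (h8 : 8 ≤ finrank K C₂.carrier) {b₁ : C₁.carrier}
    {b₂ : C₂.carrier} (hb₂ : C₂.conj b₂ = -b₂) (h : e.embed b = b₁ ⊗ₜ 1 + 1 ⊗ₜ b₂) : b₂ = 0 := by
  have key : ∀ s t, C₂.conj s = -s → s * t * b₂ = s * (t * b₂) := by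
    intro s t hs
    have := e.mul_mul_embed_of_mem_skewNucleus h2 hb (conjTensor_one_tmul hs) (1 ⊗ₜ t)
    simp only [h, mul_add, Algebra.TensorProduct.tmul_mul_tmul, one_mul, mul_one,
      add_right_inj] at this
    rw [← sub_eq_zero, ← TensorProduct.tmul_sub] at this
    exact (sub_eq_zero.1 (eq_zero_of_one_tmul_eq_zero h2 this)).symm
  refine C₂.eq_zero_of_skew_of_nucleus h2 h8 hb₂ fun s t => ?_
  have hs := C₂.two_smul_eq s
  have : (2 : K) • (s * t * b₂ - s * (t * b₂)) = 0 := by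
    rw [smul_sub, ← smul_mul_assoc, ← smul_mul_assoc, ← smul_mul_assoc, hs]
    simp only [add_mul, smul_mul_assoc, one_mul, key _ _ (C₂.conj_rho s), sub_self]
  exact sub_eq_zero.1 ((smul_eq_zero.1 this).resolve_left h2)

theorem exists_embed_eq_tmul_one (h8 : 8 ≤ finrank K C₂.carrier) :
    ∃ b₁, C₁.conj b₁ = -b₁ ∧ e.embed b = b₁ ⊗ₜ 1 ∧ (8 ≤ finrank K C₁.carrier → b₁ = 0) := by
  obtain ⟨b₁, b₂, h₁, h₂, h⟩ := exists_eq_tmul_add_tmul_of_skew C₁ C₂ h2 (e.embed_skew ⟨b, hb.1⟩)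
  change e.embed b = _ at h
  have hb₂ := e.right_eq_zero_of_mem_skewNucleus h2 hb h8 h₂ h
  refine ⟨b₁, h₁, by rw [h, hb₂, TensorProduct.tmul_zero, add_zero], fun h8' => ?_⟩
  refine e.flip.right_eq_zero_of_mem_skewNucleus h2 hb h8' (b₁ := b₂) h₁ ?_
  rw [flip_embed, h, map_add, TensorProduct.comm_tmul, TensorProduct.comm_tmul, add_comm]

end Nucleus

theorem contract_tmul_one_mem_skewNucleus (h4 : finrank K C₁.carrier ≤ 4) {b : C₁.carrier}
    (hb : C₁.conj b = -b) (φ : K →ₗ[k] k) : e.contract φ (b ⊗ₜ 1) ∈ A.skewNucleus := by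
  refine ⟨?_, fun s a => ?_⟩
  · rw [mem_skew, ← contract_conjTensor, conjTensor_tmul_one hb, map_neg]
  · rw [← contract_embed_mul, ← contract_embed_mul, ← contract_embed_mul, embed_mul,
      mul_mul_tmul_one h4]

include e in
theorem conjInvertible_of_forall_mem_skewNucleus
    (hm₁ : finrank K C₁.carrier ∈ ({1, 2, 4, 8} : Set ℕ))
    (hm₂ : finrank K C₂.carrier ∈ ({1, 2, 4, 8} : Set ℕ)) (hk2 : (2 : k) ≠ 0) (hk3 : (3 : k) ≠ 0)
    {Φ : AlbertForm A} (hQ : Φ.Q.Anisotropic) (h8 : 8 ≤ finrank K C₂.carrier)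
    (hN : ∀ b ∈ A.skewNucleus, ∃ β : k, (β = 0 ∨ ¬ IsSquare β) ∧ ∀ a, a * b * b = β • a)
    {x : A.carrier} (hx : x ≠ 0) : A.ConjInvertible x := by
  have h2 : (2 : K) ≠ 0 := two_ne_zero_of_algebra k K hk2
  obtain ⟨y, hy, h, hl₁, hl₂, hr⟩ := e.exists_tau_eq_four hm₁ hm₂ hk2 hk3 hQ A.skewNucleus
    (fun b hb => ⟨hb.2, hN b hb⟩) hx
  have hV := vopTensor_eq_self h2 hm₁ hm₂ h hl₁
    (fun h4 b hb => hr _ fun φ => e.contract_tmul_one_mem_skewNucleus h4 hb φ) hl₂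
    (fun h4 => by omega) hy
  obtain ⟨φ, hφ⟩ := exists_apply_one (k := k) (K := K)
  refine ⟨e.contract φ y, fun z => ?_⟩
  have := congrArg (e.contract φ) (hV (e.embed z))
  simp only [vopTensor, map_add, map_sub, ← embed_invol, ← embed_mul, contract_mul_embed,
    contract_embed_mul, contract_embed, contract_conjTensor, hφ, one_smul] at this
  exact this

end AlgebraWithInvolution.Iso

namespace AlgebraWithInvolution

variable {k : Type u} [Field k] {A : AlgebraWithInvolution k}

theorem AlbertForm.exists_mul_eq_one {Φ : AlbertForm A} (hQ : Φ.Q.Anisotropic) {s : A.carrier}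
    (hs : s ∈ A.skew) (h0 : s ≠ 0) : ∃ a, s * a = 1 :=
  ((Φ.nonzero_iff ⟨s, hs⟩).1 fun h => h0 (congrArg Subtype.val (hQ _ h))).2 1

/-- An element `b` with `b² = c²`, an inner skew element anticommuting with `b`, and an anisotropic
Albert form force `b` to be a scalar. -/
theorem eq_smul_one_of_anticomm {Φ : AlbertForm A} (hQ : Φ.Q.Anisotropic) {b s : A.carrier} {c : k}
    (hb : b ∈ A.skew) (hs : s ∈ A.skew) (h0 : s ≠ 0) (hbs : b * s = -(s * b))
    (hbb : ∀ a, b * (b * a) = (c * c) • a) (hba : ∀ x y, b * (x * y) = b * x * y) :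
    ∃ d : k, b = d • (1 : A.carrier) := by
  have hs' : b * s + c • s ∈ A.skew := by
    rw [mem_skew] at hb hs ⊢
    rw [map_add, map_smul, A.invol_mul, hb, hs, hbs, neg_mul_neg]
    module
  by_cases h : b * s + c • s = 0
  · obtain ⟨a, ha⟩ := AlbertForm.exists_mul_eq_one hQ hs h0
    have := congrArg (· * a) h
    simp only [add_mul, smul_mul_assoc, zero_mul, ← hba, ha, mul_one] at this
    exact ⟨-c, by rw [neg_smul]; exact eq_neg_of_add_eq_zero_left this⟩
  · obtain ⟨a, ha⟩ := AlbertForm.exists_mul_eq_one hQ hs' h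
    rw [add_mul, smul_mul_assoc, ← hba] at ha
    have h₁ := congrArg (b * ·) ha
    simp only [mul_add, mul_smul_comm, hbb, mul_one] at h₁
    refine ⟨c, ?_⟩
    rw [← h₁, ← ha]
    module

end AlgebraWithInvolution

namespace AlgebraWithInvolution.Iso

open CompositionAlgebra

variable {k K : Type u} [Field k] [Field K] [Algebra k K] {A : AlgebraWithInvolution k}
  {C₁ C₂ : CompositionAlgebra K} (e : (A.baseChange K).Iso (C₁.toAWI.tensor C₂.toAWI))

section Left

variable (h4 : finrank K C₁.carrier ≤ 4) {a : A.carrier} {a₁ : C₁.carrier}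
  (ha : e.embed a = a₁ ⊗ₜ 1)
include h4 ha

theorem mul_mul_of_embed_eq_tmul_one (x y : A.carrier) : a * (x * y) = a * x * y := by
  refine e.embed_injective ?_
  simp only [embed_mul, ha, tmul_one_mul_assoc h4]

theorem mul_mul_of_embed_eq_tmul_one' (x y : A.carrier) : x * (y * a) = x * y * a := by
  refine e.embed_injective ?_
  simp only [embed_mul, ha, mul_mul_tmul_one h4]

end Left

theorem mem_center_of_embed_eq_tmul_one (h2 : finrank K C₁.carrier ≤ 2) {a : A.carrier}
    {a₁ : C₁.carrier} (ha : e.embed a = a₁ ⊗ₜ 1) : a ∈ Set.center A.carrier := by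
  refine ⟨fun x => e.embed_injective ?_,
    fun x y => e.mul_mul_of_embed_eq_tmul_one (h2.trans (by norm_num)) ha x y,
    fun x y => (e.mul_mul_of_embed_eq_tmul_one' (h2.trans (by norm_num)) ha x y).symm⟩
  rw [embed_mul, embed_mul, ha, tmul_one_mul_comm _ h2]

theorem exists_eq_smul_one {a : A.carrier} {γ : K} (h : e.embed a = γ • 1) :
    ∃ c : k, a = c • (1 : A.carrier) := by
  by_cases h1 : (1 : A.carrier) = 0
  · exact ⟨0, by rw [← mul_one a, h1, mul_zero, smul_zero]⟩
  by_contra! hc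
  have := e.linearIndependent_embed ((LinearIndependent.pair_iff' h1).2 fun c => (hc c).symm)
  have := Fintype.linearIndependent_iff.1 this ![-γ, 1] (by
    simp [Fin.sum_univ_two, h, embed_one]) 1
  exact one_ne_zero this

include e in
theorem exists_mul_mul_eq_smul_of_mem_skewNucleus
    (hm₁ : finrank K C₁.carrier ∈ ({1, 2, 4, 8} : Set ℕ)) (hk2 : (2 : k) ≠ 0)
    {Φ : AlbertForm A} (hQ : Φ.Q.Anisotropic)
    (hZ : ∀ a ∈ Set.center A.carrier, a ≠ 0 → ∃ b ∈ Set.center A.carrier, a * b = 1 ∧ b * a = 1)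
    (h8 : 8 ≤ finrank K C₂.carrier) {b : A.carrier} (hb : b ∈ A.skewNucleus) :
    ∃ β : k, (β = 0 ∨ ¬ IsSquare β) ∧ ∀ a, a * b * b = β • a := by
  have h2 : (2 : K) ≠ 0 := two_ne_zero_of_algebra k K hk2
  obtain ⟨b₁, hb₁, hbe, hb8⟩ := e.exists_embed_eq_tmul_one h2 hb h8
  have h0 : b₁ = 0 → b = 0 := fun h => e.embed_injective (by
    rw [hbe, h, TensorProduct.zero_tmul, map_zero])
  by_cases hb0 : b = 0
  · exact ⟨0, Or.inl rfl, by simp [hb0]⟩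
  have h1 : ¬ finrank K C₁.carrier ≤ 1 := fun h1 =>
    hb0 (h0 (C₁.eq_zero_of_finrank_le_one h2 h1 hb₁))
  have h8' : ¬ 8 ≤ finrank K C₁.carrier := fun h => hb0 (h0 (hb8 h))
  have h4 : finrank K C₁.carrier ≤ 4 := by
    rcases hm₁ with h | h | h | h <;> rw [h] at h8' ⊢ <;> omega
  obtain ⟨β, hβ⟩ := e.exists_eq_smul_one (a := b * b) (γ := -C₁.norm b₁) (by
    rw [embed_mul, hbe, Algebra.TensorProduct.tmul_mul_tmul, one_mul, ← mul_one (b₁ * b₁),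
      C₁.mul_mul_self_left, C₁.mul_self_of_skew hb₁, ← TensorProduct.smul_tmul',
      Algebra.TensorProduct.one_def])
  have hba := e.mul_mul_of_embed_eq_tmul_one h4 hbe
  refine ⟨β, Or.inr ?_, fun a => by
    rw [← e.mul_mul_of_embed_eq_tmul_one' h4 hbe, hβ, mul_smul_comm, mul_one]⟩
  rintro ⟨c, rfl⟩
  suffices ∃ d : k, b = d • (1 : A.carrier) by
    obtain ⟨d, rfl⟩ := this
    exact hb0 (eq_zero_of_smul_one_mem_skew hk2 hb.1)
  by_cases h2' : finrank K C₁.carrier ≤ 2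
  · by_cases hbc : b - c • (1 : A.carrier) = 0
    · exact ⟨c, sub_eq_zero.1 hbc⟩
    obtain ⟨d, hd, -, hdb⟩ := hZ _ (e.mem_center_of_embed_eq_tmul_one h2'
      (a₁ := b₁ - algebraMap k K c • 1) (by
        rw [map_sub, hbe, embed_smul, embed_one, TensorProduct.sub_tmul,
          ← TensorProduct.smul_tmul', Algebra.TensorProduct.one_def])) hbc
    have h₁ : (b - c • (1 : A.carrier)) * (b + c • (1 : A.carrier)) = 0 := by
      simp only [sub_mul, mul_add, smul_mul_assoc, mul_smul_comm, one_mul, mul_one, hβ]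
      module
    have h₂ := hd.left_assoc (b - c • (1 : A.carrier)) (b + c • (1 : A.carrier))
    rw [h₁, hdb, mul_zero, one_mul] at h₂
    exact ⟨-c, by rw [neg_smul]; exact eq_neg_of_add_eq_zero_left h₂.symm⟩
  · obtain ⟨v, hv, hv1, hvb⟩ := C₁.exists_orthogonal_list [b₁] (by
      rcases hm₁ with h | h | h | h <;> simp at h ⊢ <;> omega)
    replace hv1 := (C₁.conj_eq_neg_iff h2 v).2 hv1
    have hv0 : v ⊗ₜ[K] (1 : C₂.carrier) ≠ 0 := by
      intro h
      have := eq_zero_of_tmul_one_add_one_tmul h2 (s := v) (t := (0 : C₂.carrier)) (by simp)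
        (by rw [h, TensorProduct.tmul_zero, add_zero])
      exact hv (by rw [this, QuadraticMap.map_zero])
    obtain ⟨φ, hφ⟩ := e.exists_contract_ne_zero hv0
    refine eq_smul_one_of_anticomm hQ hb.1 (e.contract_tmul_one_mem_skewNucleus h4 hv1 φ).1 hφ ?_
      (fun a => by rw [hba, hβ, smul_mul_assoc, one_mul]) hba
    rw [← contract_embed_mul, ← contract_mul_embed, hbe, Algebra.TensorProduct.tmul_mul_tmul,
      Algebra.TensorProduct.tmul_mul_tmul, one_mul, ← map_neg, ← TensorProduct.neg_tmul,
      C₁.anticomm_of_orthogonal hb₁ hv1 ((C₁.bilin_comm _ _).trans (hvb b₁ (by simp)))]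

include e in
theorem conjInvertible_of_eight_le_finrank (hm₁ : finrank K C₁.carrier ∈ ({1, 2, 4, 8} : Set ℕ))
    (hm₂ : finrank K C₂.carrier ∈ ({1, 2, 4, 8} : Set ℕ)) (hk2 : (2 : k) ≠ 0) (hk3 : (3 : k) ≠ 0)
    {Φ : AlbertForm A} (hQ : Φ.Q.Anisotropic)
    (hZ : ∀ a ∈ Set.center A.carrier, a ≠ 0 → ∃ b ∈ Set.center A.carrier, a * b = 1 ∧ b * a = 1)
    (h8 : 8 ≤ finrank K C₂.carrier) {x : A.carrier} (hx : x ≠ 0) : A.ConjInvertible x :=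
  e.conjInvertible_of_forall_mem_skewNucleus hm₁ hm₂ hk2 hk3 hQ h8
    (fun _ hb => e.exists_mul_mul_eq_smul_of_mem_skewNucleus hm₁ hk2 hQ hZ h8 hb) hx

include e in
theorem conjInvertible (hm₁ : finrank K C₁.carrier ∈ ({1, 2, 4, 8} : Set ℕ))
    (hm₂ : finrank K C₂.carrier ∈ ({1, 2, 4, 8} : Set ℕ)) (hk2 : (2 : k) ≠ 0) (hk3 : (3 : k) ≠ 0)
    {Φ : AlbertForm A} (hQ : Φ.Q.Anisotropic)
    (hZ : ∀ a ∈ Set.center A.carrier, a ≠ 0 → ∃ b ∈ Set.center A.carrier, a * b = 1 ∧ b * a = 1)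
    {x : A.carrier} (hx : x ≠ 0) : A.ConjInvertible x := by
  by_cases h8₂ : 8 ≤ finrank K C₂.carrier
  · exact e.conjInvertible_of_eight_le_finrank hm₁ hm₂ hk2 hk3 hQ hZ h8₂ hx
  by_cases h8₁ : 8 ≤ finrank K C₁.carrier
  · exact e.flip.conjInvertible_of_eight_le_finrank hm₂ hm₁ hk2 hk3 hQ hZ h8₁ hx
  have h4 : ∀ n ∈ ({1, 2, 4, 8} : Set ℕ), ¬ 8 ≤ n → n ≤ 4 := by
    rintro n (rfl | rfl | rfl | rfl) <;> norm_num
  exact e.conjInvertible_of_finrank_le_four hm₁ hm₂ hk2 hk3 hQ hZ (h4 _ hm₁ h8₁) (h4 _ hm₂ h8₂) hx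

end AlgebraWithInvolution.Iso

namespace AlgebraWithInvolution

variable {k : Type u} [Field k] {A : AlgebraWithInvolution k}

theorem exists_mem_center_mul_eq_one (hk3 : (3 : k) ≠ 0) {a : A.carrier}
    (ha : a ∈ Set.center A.carrier) (h : A.ConjInvertible a) :
    ∃ b ∈ Set.center A.carrier, a * b = 1 ∧ b * a = 1 := by
  have hcomm : ∀ x, a * x = x * a := fun x => ha.comm x
  have hl : ∀ x y, a * (x * y) = a * x * y := ha.left_assoc
  have hr : ∀ x y, x * (a * y) = a * (x * y) := fun x y => by
    rw [hcomm y, hcomm (x * y), ha.right_assoc]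
  obtain ⟨y, hy⟩ := h
  have h₁ := hy 1
  simp only [Vop, mul_one, one_mul] at h₁
  have h₂ : A.invol a * y = (2 : k) • (a * A.invol y) - 1 := by
    rw [← hcomm] at h₁
    rw [two_smul, ← h₁]
    abel
  have h₃ := congrArg A.invol h₂
  rw [A.invol_mul, A.invol_invol, map_sub, map_smul, A.invol_mul, A.invol_invol, A.invol_one] at h₃
  have hya : y * A.invol a = A.invol a * y := by
    have := congrArg A.invol (hcomm (A.invol y))
    rw [A.invol_mul, A.invol_mul, A.invol_invol] at this
    exact this
  rw [hya, h₂, ← hcomm] at h₃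
  have h₄ : a * A.invol y = 1 := by
    have : (3 : k) • (a * A.invol y - 1) = 0 := by
      linear_combination (norm := module) -h₃
    exact sub_eq_zero.1 ((smul_eq_zero.1 this).resolve_left hk3)
  obtain ⟨b, hb⟩ : ∃ b, b = A.invol y := ⟨_, rfl⟩
  rw [← hb] at h₄
  have hab : ∀ x, a * (b * x) = x := fun x => by rw [hl, h₄, one_mul]
  have hab' : ∀ x, a * (x * b) = x := fun x => by rw [← hr, h₄, mul_one]
  have hinj : Function.Injective (a * ·) :=
    Function.LeftInverse.injective (g := (· * b)) fun x => by
      change a * x * b = x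
      rw [← hl, hab']
  refine ⟨b, ⟨fun x => hinj ?_, fun x z => hinj ?_, fun x z => hinj ?_⟩, h₄, ?_⟩
  · change a * _ = a * _
    rw [hab, hab']
  · change a * _ = a * _
    rw [hab, hl, hab]
  · change a * _ = a * _
    rw [hab', ← hr, hab']
  · rw [← hcomm, h₄]

end AlgebraWithInvolution

namespace AlgebraWithInvolution.Iso

open CompositionAlgebra

variable {k K : Type u} [Field k] [Field K] [Algebra k K] {A : AlgebraWithInvolution k}
  {C₁ C₂ : CompositionAlgebra K} (e : (A.baseChange K).Iso (C₁.toAWI.tensor C₂.toAWI))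

theorem vopTensor_embed_eq_self {x y : A.carrier} (h : ∀ z, A.Vop x y z = z)
    (z : C₁.carrier ⊗[K] C₂.carrier) : vopTensor C₁ C₂ (e.embed x) (e.embed y) z = z := by
  induction z using e.embed_induction with
  | smul c a =>
    conv_rhs => rw [← h a]
    simp only [vopTensor, Vop, smul_mul_assoc, mul_smul_comm, ← embed_invol, ← embed_mul, map_sub,
      map_add, smul_add, smul_sub]
  | add z z' h h' =>
    conv_rhs => rw [← h, ← h']
    simp only [vopTensor, mul_add, add_mul]
    abel

include e in
theorem anisotropic_of_isStructurableDivisionAlgebra [FiniteDimensional k A.carrier]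
    (h2 : (2 : K) ≠ 0) (Φ : AlbertForm A) (h : A.IsStructurableDivisionAlgebra) :
    Φ.Q.Anisotropic := by
  intro s hs
  by_contra h0
  obtain ⟨s₁, s₂, h₁, h₂, hse, hn⟩ := e.norm_eq_norm_of_albertForm_eq_zero h2 Φ hs
  obtain ⟨y, hy⟩ := h s fun h => h0 (Subtype.ext h)
  have hV := e.vopTensor_embed_eq_self hy
  have hV' := e.flip.vopTensor_embed_eq_self hy
  refine h0 (Subtype.ext (e.embed_injective ?_))
  have hs₁ := eq_zero_of_vopTensor_eq_self h2 h₁ h₂ hn hse hV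
  have hs₂ := eq_zero_of_vopTensor_eq_self h2 h₂ h₁ hn.symm (by
    rw [flip_embed, hse, map_add, TensorProduct.comm_tmul, TensorProduct.comm_tmul, add_comm]) hV'
  rw [hse, hs₁, hs₂, TensorProduct.zero_tmul, TensorProduct.tmul_zero, add_zero]
  exact (map_zero e.embed).symm

end AlgebraWithInvolution.Iso

end

/-- Let `k` be a field of characteristic not 2 or 3 and let `(A,−)` be an
`(m₁,m₂)`-product algebra over `k`.  Then `(A,−)` is a structurable division algebra iff its
Albert form `Q` is anisotropic and the centre `Z(A)` is a field (every nonzero central element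
has a central two-sided inverse). -/
theorem structurable_division_iff_albert_anisotropic
    {k : Type u} [Field k] (hk2 : (2 : k) ≠ 0) (hk3 : (3 : k) ≠ 0)
    (m₁ m₂ : ℕ) (hm₁ : m₁ ∈ ({1, 2, 4, 8} : Set ℕ)) (hm₂ : m₂ ∈ ({1, 2, 4, 8} : Set ℕ))
    (hne : (m₁, m₂) ≠ (2, 2))
    (A : AlgebraWithInvolution k) (hA : IsProductAlgebra A m₁ m₂)
    (Φ : AlbertForm A) :
    A.IsStructurableDivisionAlgebra ↔
      (Φ.Q.Anisotropic ∧
        ∀ a ∈ Set.center A.carrier, a ≠ 0 →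
          ∃ b ∈ Set.center A.carrier, a * b = 1 ∧ b * a = 1) := by
  obtain ⟨σ⟩ := hA
  rw [← σ.finrank₁] at hm₁
  rw [← σ.finrank₂] at hm₂
  have := σ.iso.finiteDimensional hm₁ hm₂
  have h2 : (2 : σ.K) ≠ 0 := two_ne_zero_of_algebra k σ.K hk2
  refine ⟨fun h => ⟨σ.iso.anisotropic_of_isStructurableDivisionAlgebra h2 Φ h,
    fun a ha h0 => AlgebraWithInvolution.exists_mem_center_mul_eq_one hk3 ha (h a h0)⟩, ?_⟩
  rintro ⟨hQ, hZ⟩ x hx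
  exact σ.iso.conjInvertible hm₁ hm₂ hk2 hk3 hQ hZ hx
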